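/- Let 0 → J → E → A → 0 be a short exact sequence of separable C*-algebras, and let D be a separable, unital, strongly self-absorbing, K₁-injective C*-algebra. If J and A are D-stable, then E is D-stable. -/

import Mathlib

open scoped MultiplierAlgebra TensorProduct
open Filter Topology

noncomputable section

universe u v w x

/-- Approximate unitary equivalence of two maps `φ ψ : A → B`, witnessed by a sequence of
unitaries in the multiplier algebra `𝓜(ℂ, B)` (in which `B` embeds canonically). -/
def ApproxUnitaryEquiv {A : Type u} {B : Type v} [NonUnitalCStarAlgebra B]
    (φ ψ : A → B) : Prop :=
  ∃ v : ℕ → 𝓜(ℂ, B), (∀ n, v n ∈ unitary 𝓜(ℂ, B)) ∧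
    ∀ a : A, Tendsto
      (fun n => ‖star (v n) * (φ a : 𝓜(ℂ, B)) * v n - (ψ a : 𝓜(ℂ, B))‖)
      atTop (𝓝 (0 : ℝ))

/-- Data exhibiting `T` as a C*-tensor product of `A` and `B`: a bilinear, multiplicative,
star-preserving, cross-normed map `A × B → T` with dense span. -/
structure CStarTensor (A : Type u) (B : Type v) (T : Type w) [NonUnitalCStarAlgebra A]
    [NonUnitalCStarAlgebra B] [NonUnitalCStarAlgebra T] where
  tmul : A → B → T
  add_left : ∀ a a' b, tmul (a + a') b = tmul a b + tmul a' b
  add_right : ∀ a b b', tmul a (b + b') = tmul a b + tmul a b'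
  smul_left : ∀ (c : ℂ) a b, tmul (c • a) b = c • tmul a b
  smul_right : ∀ (c : ℂ) a b, tmul a (c • b) = c • tmul a b
  mul_tmul : ∀ a a' b b', tmul a b * tmul a' b' = tmul (a * a') (b * b')
  star_tmul : ∀ a b, star (tmul a b) = tmul (star a) (star b)
  norm_tmul : ∀ a b, ‖tmul a b‖ = ‖a‖ * ‖b‖
  dense_span : Dense ((Submodule.span ℂ {t : T | ∃ a b, tmul a b = t} : Submodule ℂ T) : Set T)

/-- Data exhibiting `T` as *the minimal (spatial) tensor product* of `A` and `B`: a C*-tensor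
product which is dominated by every other C*-tensor product of `A` and `B` (i.e., it carries
the smallest C*-norm). -/
structure MinTensor (A : Type u) (B : Type v) (T : Type w) [NonUnitalCStarAlgebra A]
    [NonUnitalCStarAlgebra B] [NonUnitalCStarAlgebra T] extends CStarTensor A B T where
  minimal : ∀ (T' : Type (max u v)) [NonUnitalCStarAlgebra T'] (h : CStarTensor A B T'),
    ∃ π : T' →⋆ₙₐ[ℂ] T, ∀ a b, π (h.tmul a b) = tmul a b

/-- The first-factor unital embedding `d ↦ d ⊗ 1`. -/
def MinTensor.fst {D : Type u} {E : Type v} {T : Type w} [CStarAlgebra D] [CStarAlgebra E]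
    [CStarAlgebra T] (h : MinTensor D E T) : D → T := fun d => h.tmul d 1

/-- The second-factor unital embedding `d ↦ 1 ⊗ d`. -/
def MinTensor.snd {D : Type u} {E : Type v} {T : Type w} [CStarAlgebra D] [CStarAlgebra E]
    [CStarAlgebra T] (h : MinTensor D E T) : E → T := fun d => h.tmul 1 d

/-- A unital C*-algebra `D` has *approximately inner half flip* (with respect to a
realization `T` of the minimal tensor product `D ⊗ D`) if the two factor embeddings
`id_D ⊗ 1_D` and `1_D ⊗ id_D` of `D` into `D ⊗ D` are approximately unitarily equivalent. -/
def HasApproxInnerHalfFlip {D : Type u} {T : Type w} [CStarAlgebra D] [CStarAlgebra T]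
    (h : MinTensor D D T) : Prop :=
  ApproxUnitaryEquiv h.fst h.snd

/-- A unital C*-algebra `D` has *approximately inner flip* (with respect to a realization
`T` of `D ⊗ D`) if the flip automorphism `σ_D : a ⊗ b ↦ b ⊗ a` of `D ⊗ D` is approximately
unitarily equivalent to the identity map. -/
def HasApproxInnerFlip {D : Type u} {T : Type w} [CStarAlgebra D] [CStarAlgebra T]
    (h : MinTensor D D T) : Prop :=
  ∃ σ : T ≃⋆ₐ[ℂ] T, (∀ a b, σ (h.tmul a b) = h.tmul b a) ∧
    ApproxUnitaryEquiv (⇑σ) (id : T → T)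

/-- A unital C*-algebra `D ≇ ℂ` is *strongly self-absorbing* (with respect to a realization
`T` of the minimal tensor product `D ⊗ D`) if there is an isomorphism `φ : D → D ⊗ D` which
is approximately unitarily equivalent to `id_D ⊗ 1_D`. -/
def IsStronglySelfAbsorbing {D : Type u} {T : Type w} [CStarAlgebra D] [CStarAlgebra T]
    (h : MinTensor D D T) : Prop :=
  IsEmpty (D ≃⋆ₐ[ℂ] ℂ) ∧ ∃ φ : D ≃⋆ₐ[ℂ] T, ApproxUnitaryEquiv (⇑φ) h.fst

/-- The image of `u` under the upper-left-corner stabilization `u ↦ diag(u, 1, …, 1)`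
into `M_{n+1}(A)`. -/
def stabUnitary {A : Type u} [CStarAlgebra A] (n : ℕ) (u : A) :
    Matrix (Fin (n + 1)) (Fin (n + 1)) A :=
  Matrix.diagonal (fun i => if i = 0 then u else 1)

/-- A unitary `u` represents `0` in `K₁(A)`: some matrix stabilization `diag(u, 1, …, 1)`
is connected to the identity through the unitary group of a matrix algebra over `A`. -/
def RepresentsZeroInK1 {A : Type u} [CStarAlgebra A] (u : A) : Prop :=
  ∃ n : ℕ, ∃ h : stabUnitary n u ∈ unitary (Matrix (Fin (n + 1)) (Fin (n + 1)) A),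
    Joined (⟨stabUnitary n u, h⟩ : ↥(unitary (Matrix (Fin (n + 1)) (Fin (n + 1)) A))) 1

/-- A unital C*-algebra is `K₁`-injective if the canonical map `U(A)/U₀(A) → K₁(A)` is
injective, i.e. every unitary representing `0` in `K₁(A)` lies in the connected component
of the unit of `U(A)`. -/
def K1Injective (A : Type u) [CStarAlgebra A] : Prop :=
  ∀ u : ↥(unitary A), RepresentsZeroInK1 (u : A) → Joined u 1

section Excision

variable {D : Type*} [CStarAlgebra D] [PartialOrder D] [StarOrderedRing D]

lemma IsSelfAdjoint.norm_le_of_le_algebraMap {x : D} (hx : IsSelfAdjoint x) {r : ℝ} (hr : 0 ≤ r)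
    (h₁ : x ≤ algebraMap ℝ D r) (h₂ : -x ≤ algebraMap ℝ D r) : ‖x‖ ≤ r := by
  cases subsingleton_or_nontrivial D with
  | inl h => simpa [Subsingleton.elim x 0] using hr
  | inr h =>
    have h₁' := (le_algebraMap_iff_spectrum_le (a := x) (r := r)).1 h₁
    have h₂' := (le_algebraMap_iff_spectrum_le (a := -x) (r := r)).1 h₂
    rcases CStarAlgebra.norm_or_neg_norm_mem_spectrum (a := x) hx with h | h
    · exact h₁' _ h
    · exact h₂' _ (by rw [← spectrum.neg_eq]; simpa)

/-- Every positive element of a unital C*-algebra attains its norm at a state. -/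
lemma exists_state_apply_eq_norm [Nontrivial D] {b : D} (hb : 0 ≤ b) :
    ∃ ω : D →ₗ[ℂ] ℂ, ω 1 = 1 ∧ (∀ a, ω (star a) = star (ω a)) ∧ (∀ a, 0 ≤ (ω (star a * a)).re) ∧
      (∀ a, IsSelfAdjoint a → (ω a).re ≤ ‖a‖) ∧ ω b = ‖b‖ := by
  have hnorm : ‖1 + b‖ = 1 + ‖b‖ := by
    have h1 : (1 : ℝ) + ‖b‖ ∈ spectrum ℝ (1 + b) := by
      have := CStarAlgebra.norm_mem_spectrum_of_nonneg (a := b) hb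
      have h2 := spectrum.add_mem_add_iff (R := ℝ) (a := b) (r := ‖b‖) (s := 1)
      simpa [add_comm] using h2.2 this
    refine le_antisymm ((norm_add_le _ _).trans (by simp)) ?_
    have := spectrum.norm_le_norm_of_mem h1
    rwa [Real.norm_of_nonneg (by positivity)] at this
  obtain ⟨g, hg, hgb⟩ := exists_dual_vector ℂ (1 + b) (by rw [hnorm]; positivity)
  have hle : ∀ a, ‖g a‖ ≤ ‖a‖ := fun a => by simpa [hg] using g.le_opNorm a
  have hre : ∀ a, (g a).re ≤ ‖a‖ := fun a => (Complex.re_le_norm _).trans (hle a)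
  have hsum : g 1 + g b = 1 + ‖b‖ := by rw [← map_add, hgb, hnorm]; simp
  have hsum_re : (g 1).re + (g b).re = 1 + ‖b‖ := by simpa using congrArg Complex.re hsum
  have h1n : ‖g 1‖ ≤ 1 := by simpa using hle 1
  have h1re : (g 1).re = 1 := by
    have := hre 1; have := hre b
    simp only [norm_one] at *; linarith
  have hbre : (g b).re = ‖b‖ := by linarith
  let ω : D →ₗ[ℂ] ℂ :=
    { toFun := fun a => (1 / 2 : ℂ) * (g a + star (g (star a)))
      map_add' := fun a b => by simp only [star_add, map_add]; ring
      map_smul' := fun c a => by simp; ring }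
  have hω : ∀ a, IsSelfAdjoint a → ω a = (g a).re := fun a ha => by
    have : ω a = (1 / 2 : ℂ) * (g a + star (g (star a))) := rfl
    rw [this, ha.star_eq]
    have := Complex.add_conj (g a)
    simp only [Complex.star_def, this]; push_cast; ring
  refine ⟨ω, ?_, ?_, ?_, ?_, ?_⟩
  · rw [hω 1 (.one _), h1re]; simp
  · intro a
    change (1 / 2 : ℂ) * (g (star a) + star (g (star (star a)))) =
      star ((1 / 2 : ℂ) * (g a + star (g (star a))))
    simp; ring
  · intro a
    rw [hω _ (.star_mul_self a), Complex.ofReal_re]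
    have h : ‖algebraMap ℝ D (‖a‖ ^ 2) - star a * a‖ ≤ ‖a‖ ^ 2 := by
      have h0 : star a * a ≤ algebraMap ℝ D (‖a‖ ^ 2) := CStarAlgebra.star_mul_le_algebraMap_norm_sq
      rw [CStarAlgebra.norm_le_iff_le_algebraMap _ (by positivity) (by simpa using h0)]
      simp
    have h2 := (hre (algebraMap ℝ D (‖a‖ ^ 2) - star a * a)).trans h
    have h3 : g (algebraMap ℝ D (‖a‖ ^ 2)) = ((‖a‖ ^ 2 : ℝ) : ℂ) * g 1 := by
      rw [Algebra.algebraMap_eq_smul_one, ← Complex.coe_smul, map_smul, smul_eq_mul]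
    rw [map_sub, h3, Complex.sub_re, Complex.re_ofReal_mul, h1re] at h2
    linarith
  · intro a ha
    simpa [hω a ha] using hre a
  · rw [hω b (.of_nonneg hb), hbre]

/-- A positive element of norm one compressing a positive `F` to its norm, up to `η`. -/
lemma exists_spike [Nontrivial D] {F : D} (hF : 0 ≤ F) {η : ℝ} (hη : 0 < η) (hηF : η ≤ ‖F‖) :
    ∃ h : D, IsSelfAdjoint h ∧ ‖h‖ = 1 ∧ (‖F‖ - η) • (h * h) ≤ h * F * h := by
  have hFsa : IsSelfAdjoint F := .of_nonneg hF
  let g : ℝ → ℝ := fun t => max (t - (‖F‖ - η)) 0 / η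
  have hg : Continuous g := by fun_prop
  have hsp : ∀ t ∈ spectrum ℝ F, t ≤ ‖F‖ := fun t ht =>
    (Real.le_norm_self t).trans (spectrum.norm_le_norm_of_mem ht)
  refine ⟨cfc g F, cfc_predicate g F, le_antisymm ?_ ?_, ?_⟩
  · refine norm_cfc_le zero_le_one fun t ht => ?_
    have hg0 : 0 ≤ g t := by positivity
    rw [Real.norm_of_nonneg hg0, div_le_one hη]
    have := hsp t ht
    exact max_le (by linarith) hη.le
  · have := norm_apply_le_norm_cfc g F (CStarAlgebra.norm_mem_spectrum_of_nonneg (a := F) hF)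
      hg.continuousOn
    have h1 : g ‖F‖ = 1 := by simp [g, hη.le, hη.ne']
    simpa [h1] using this
  · have h1 : cfc g F * F * cfc g F = cfc (fun t => g t * t * g t) F := by
      rw [cfc_mul (fun t => g t * t) g F, cfc_mul g (fun t => t) F, cfc_id' ℝ F]
    have h2 : (‖F‖ - η) • (cfc g F * cfc g F) = cfc (fun t => (‖F‖ - η) • (g t * g t)) F := by
      rw [cfc_smul (‖F‖ - η) (fun t => g t * g t) F, cfc_mul g g F]
    rw [h1, h2]
    refine cfc_mono fun t ht => ?_
    rcases le_total t (‖F‖ - η) with h | h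
    · have : g t = 0 := by simp [g, h]
      simp [this]
    · have := mul_le_mul_of_nonneg_right h (mul_self_nonneg (g t))
      simp only [smul_eq_mul]; linarith

/-- Finitely many self-adjoint elements can be excised by a state. -/
lemma exists_state_excision_selfAdjoint [Nontrivial D] {ι : Type} [Fintype ι] (f : ι → D)
    (hf : ∀ i, IsSelfAdjoint (f i)) {ε : ℝ} (hε : 0 < ε) :
    ∃ ω : D →ₗ[ℂ] ℂ, ω 1 = 1 ∧ (∀ a, ω (star a) = star (ω a)) ∧ (∀ a, 0 ≤ (ω (star a * a)).re) ∧
      ∃ h : D, IsSelfAdjoint h ∧ ‖h‖ = 1 ∧ ∀ i, ‖h * f i * h - ω (f i) • (h * h)‖ ≤ ε := by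
  classical
  set c : ℝ := 1 + ∑ i, ‖f i‖ with hc
  let P : (ι → ℝ) → D := fun x => algebraMap ℝ D c + ∑ i, x i • f i
  let N : (ι → ℝ) → ℝ := fun x => ‖P x‖
  have hPsa : ∀ x, IsSelfAdjoint (P x) := fun x =>
    (IsSelfAdjoint.algebraMap D (IsSelfAdjoint.all c)).add
      (isSelfAdjoint_sum _ fun i _ => (IsSelfAdjoint.all (x i)).smul (hf i))
  have hLip : LipschitzWith (∑ i, ‖f i‖₊) N := by
    refine LipschitzWith.of_dist_le_mul fun x y => ?_
    rw [Real.dist_eq]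
    refine (abs_norm_sub_norm_le _ _).trans ?_
    have : P x - P y = ∑ i, (x i - y i) • f i := by
      simp [P, sub_smul]
    rw [this]
    refine (norm_sum_le _ _).trans ?_
    push_cast
    rw [Finset.sum_mul]
    refine Finset.sum_le_sum fun i _ => ?_
    rw [norm_smul, mul_comm]
    refine mul_le_mul_of_nonneg_left ?_ (norm_nonneg _)
    rw [← dist_eq_norm]
    exact dist_le_pi_dist x y i
  obtain ⟨x, hx1, hx⟩ : ∃ x : ι → ℝ, x ∈ Metric.ball (0 : ι → ℝ) 1 ∧ DifferentiableAt ℝ N x := by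
    have hd := hLip.ae_differentiableAt (μ := MeasureTheory.volume)
    have hdense := MeasureTheory.Measure.dense_of_ae hd
    exact hdense.exists_mem_open Metric.isOpen_ball ⟨0, by simp⟩ |>.imp fun x h => ⟨h.2, h.1⟩
  have hxi : ∀ i, |x i| ≤ 1 := fun i => by
    have := (dist_le_pi_dist x 0 i).trans (Metric.mem_ball.1 hx1).le
    simpa using this
  have hsum : ‖∑ i, x i • f i‖ ≤ c - 1 := by
    refine (norm_sum_le _ _).trans ?_
    rw [hc, add_sub_cancel_left]
    refine Finset.sum_le_sum fun i _ => ?_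
    rw [norm_smul]
    exact mul_le_of_le_one_left (norm_nonneg _) (hxi i)
  have hP1 : 1 ≤ P x := by
    have hsa : IsSelfAdjoint (∑ i, x i • f i) :=
      isSelfAdjoint_sum _ fun i _ => (IsSelfAdjoint.all (x i)).smul (hf i)
    have h1 := hsa.neg_algebraMap_norm_le_self
    have h2 : algebraMap ℝ D ‖∑ i, x i • f i‖ ≤ algebraMap ℝ D (c - 1) :=
      algebraMap_mono D hsum
    have h3 : algebraMap ℝ D c - algebraMap ℝ D (c - 1) = 1 := by rw [← map_sub]; simp
    calc (1 : D) = algebraMap ℝ D c - algebraMap ℝ D (c - 1) := h3.symm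
      _ ≤ algebraMap ℝ D c - algebraMap ℝ D ‖∑ i, x i • f i‖ := sub_le_sub_left h2 _
      _ ≤ P x := by rw [sub_eq_add_neg]; exact add_le_add_right h1 _
  have hP0 : 0 ≤ P x := zero_le_one.trans hP1
  have hΛ : 1 ≤ N x := by
    have := CStarAlgebra.norm_le_norm_of_nonneg_of_le (a := (1 : D)) zero_le_one hP1
    simpa using this
  obtain ⟨ω, hω1, hωs, hωp, hωle, hωP⟩ := exists_state_apply_eq_norm hP0
  have hωre : ∀ a, IsSelfAdjoint a → ω a = (ω a).re := fun a ha => by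
    have := hωs a
    rw [ha.star_eq] at this
    exact (Complex.conj_eq_iff_re.1 this.symm).symm
  have hωsmul : ∀ (r : ℝ) a, ω (r • a) = r * ω a := fun r a => by
    rw [← Complex.coe_smul, map_smul, smul_eq_mul]
  have hline : ∀ i (δ : ℝ), P (x + δ • Pi.single i 1) = P x + δ • f i := fun i δ => by
    simp only [P, Pi.add_apply, add_smul, Finset.sum_add_distrib, Pi.smul_apply, smul_assoc]
    rw [← add_assoc]
    congr 1
    simp [Pi.single_apply]
  have hbelow : ∀ i (δ : ℝ), N x + δ * (ω (f i)).re ≤ N (x + δ • Pi.single i 1) := fun i δ => by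
    have := hωle _ (hPsa (x + δ • Pi.single i 1))
    rw [hline i δ, map_add, hωsmul, hωP] at this
    rw [← hline i δ] at this
    simpa [N] using this
  have hder : ∀ i, HasDerivAt (fun δ : ℝ => N (x + δ • Pi.single i 1)) (ω (f i)).re 0 := by
    intro i
    have h1 : HasDerivAt (fun δ : ℝ => N (x + δ • Pi.single i 1))
        (fderiv ℝ N x (Pi.single i 1)) 0 := by
      have hx' : HasFDerivAt N (fderiv ℝ N x) (x + (0 : ℝ) • Pi.single i (1 : ℝ)) := by
        simpa using hx.hasFDerivAt
      have h2 : HasDerivAt (fun δ : ℝ => x + δ • (Pi.single i 1 : ι → ℝ))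
          (Pi.single i 1) 0 := by
        simpa using ((hasDerivAt_id (0 : ℝ)).smul_const (Pi.single i 1 : ι → ℝ)).const_add x
      exact hx'.comp_hasDerivAt 0 h2
    have h3 : HasDerivAt (fun δ : ℝ => N (x + δ • Pi.single i 1) - δ * (ω (f i)).re)
        (fderiv ℝ N x (Pi.single i 1) - 1 * (ω (f i)).re) 0 :=
      h1.sub ((hasDerivAt_id (0 : ℝ)).mul_const _)
    have h4 := IsLocalMin.hasDerivAt_eq_zero (Filter.Eventually.of_forall fun δ => by
      have := hbelow i δ
      simp only [zero_smul, add_zero, zero_mul, sub_zero]; linarith) h3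
    rwa [show fderiv ℝ N x (Pi.single i 1) = (ω (f i)).re by linarith] at h1
  have hev : ∀ᶠ δ : ℝ in 𝓝 0, ∀ i,
      |N (x + δ • Pi.single i 1) - N x - δ * (ω (f i)).re| ≤ ε / 2 * |δ| := by
    refine Filter.eventually_all.2 fun i => ?_
    have := (hasDerivAt_iff_isLittleO.1 (hder i)).def (half_pos hε)
    simpa using this
  obtain ⟨δ₀, hδ₀, hball⟩ := Metric.eventually_nhds_iff.1 hev
  set δ : ℝ := min (δ₀ / 2) (1 / ε) with hδ
  have hδpos : 0 < δ := by positivity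
  have hδlt : |δ| < δ₀ := by
    rw [abs_of_pos hδpos]
    exact (min_le_left _ _).trans_lt (by linarith)
  have hδε : δ * (ε / 2) ≤ 1 := by
    have : δ * ε ≤ 1 := by
      have := mul_le_mul_of_nonneg_right (min_le_right (δ₀ / 2) (1 / ε)) hε.le
      rwa [one_div_mul_cancel hε.ne'] at this
    have : 0 < δ * ε := by positivity
    linarith
  obtain ⟨h, hsa, hn, hsp⟩ := exists_spike hP0 (η := δ * (ε / 2)) (by positivity) (hδε.trans hΛ)
  refine ⟨ω, hω1, hωs, hωp, h, hsa, hn, fun i => ?_⟩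
  have hhh : h * h ≤ 1 := by
    have := CStarAlgebra.star_mul_le_algebraMap_norm_sq (a := h)
    simpa [hsa.star_eq, hn] using this
  have hhh0 : 0 ≤ h * h := by simpa [hsa.star_eq] using star_mul_self_nonneg h
  have key : ∀ s : ℝ, |s| = 1 → s • (h * f i * h - (ω (f i)).re • (h * h)) ≤ algebraMap ℝ D ε := by
    intro s hs
    have h1 := hball (y := s * δ) (by simpa [abs_mul, hs] using hδlt) i
    rw [abs_mul, hs, one_mul, abs_of_pos hδpos] at h1
    have h2 : N (x + (s * δ) • Pi.single i 1) ≤ N x + s * δ * (ω (f i)).re + ε / 2 * δ := by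
      have := (abs_le.1 h1).2; linarith
    have h3 : P x + (s * δ) • f i ≤ algebraMap ℝ D (N x + s * δ * (ω (f i)).re + ε / 2 * δ) := by
      rw [← hline]
      exact ((hPsa _).le_algebraMap_norm_self).trans (algebraMap_mono D h2)
    have h4 := hsa.conjugate_le_conjugate h3
    rw [Algebra.algebraMap_eq_smul_one, mul_smul_comm, mul_one, smul_mul_assoc, mul_add, add_mul,
      mul_smul_comm, smul_mul_assoc] at h4
    have h5 : (N x - δ * (ε / 2)) • (h * h) + (s * δ) • (h * f i * h) ≤
      (N x + s * δ * (ω (f i)).re + ε / 2 * δ) • (h * h) := (add_le_add_left hsp _).trans h4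
    have h6 : δ • (s • (h * f i * h - (ω (f i)).re • (h * h))) ≤ δ • (ε • (h * h)) := by
      rw [← sub_nonneg] at h5 ⊢
      convert h5 using 1
      module
    have h7 := smul_le_smul_of_nonneg_left h6 (inv_nonneg.2 hδpos.le)
    rw [inv_smul_smul₀ hδpos.ne', inv_smul_smul₀ hδpos.ne'] at h7
    rw [Algebra.algebraMap_eq_smul_one]
    exact h7.trans (smul_le_smul_of_nonneg_left hhh hε.le)
  have hcast : ω (f i) • (h * h) = (ω (f i)).re • (h * h) := by
    conv_lhs => rw [hωre _ (hf i), Complex.coe_smul]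
  rw [hcast]
  refine IsSelfAdjoint.norm_le_of_le_algebraMap ?_ hε.le (by simpa using key 1 (by simp))
    (by simpa using key (-1) (by simp))
  refine IsSelfAdjoint.sub ?_ ((IsSelfAdjoint.all _).smul (.of_nonneg hhh0))
  simpa [hsa.star_eq] using (hf i).conjugate h

/-- Finitely many elements can be excised by a state. -/
lemma exists_state_excision [Nontrivial D] (S : Finset D) {ε : ℝ} (hε : 0 < ε) :
    ∃ ω : D →ₗ[ℂ] ℂ, ω 1 = 1 ∧ (∀ a, ω (star a) = star (ω a)) ∧ (∀ a, 0 ≤ (ω (star a * a)).re) ∧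
      ∃ h : D, IsSelfAdjoint h ∧ ‖h‖ = 1 ∧ ∀ d ∈ S, ‖h * d * h - ω d • (h * h)‖ ≤ ε := by
  classical
  let f : Fin S.card ⊕ Fin S.card → D :=
    Sum.elim (fun i => (realPart (S.equivFin.symm i : D) : D))
      (fun i => (imaginaryPart (S.equivFin.symm i : D) : D))
  have hf : ∀ i, IsSelfAdjoint (f i) := by
    rintro (i | i) <;> exact Subtype.prop _
  obtain ⟨ω, h1, h2, h3, h, h4, h5, h6⟩ :=
    exists_state_excision_selfAdjoint f hf (half_pos hε)
  refine ⟨ω, h1, h2, h3, h, h4, h5, fun d hd => ?_⟩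
  have ha := h6 (.inl (S.equivFin ⟨d, hd⟩))
  have hb := h6 (.inr (S.equivFin ⟨d, hd⟩))
  simp only [f, Sum.elim_inl, Sum.elim_inr, Equiv.symm_apply_apply] at ha hb
  set a : D := (realPart d : D)
  set b : D := (imaginaryPart d : D)
  have hd' : d = a + Complex.I • b := (realPart_add_I_smul_imaginaryPart d).symm
  have : h * d * h - ω d • (h * h) =
      (h * a * h - ω a • (h * h)) + Complex.I • (h * b * h - ω b • (h * h)) := by
    rw [hd', map_add, map_smul, mul_add, add_mul, mul_smul_comm, smul_mul_assoc, smul_eq_mul]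
    module
  rw [this]
  refine (norm_add_le _ _).trans ?_
  rw [norm_smul, Complex.norm_I, one_mul]
  linarith

end Excision

/-- A bilinear map of C*-algebras which is multiplicative and star-preserving. -/
structure StarBilin (A : Type u) (B : Type v) (P : Type w) [NonUnitalCStarAlgebra A]
    [CStarAlgebra B] [NonUnitalCStarAlgebra P] where
  lin : A →ₗ[ℂ] B →ₗ[ℂ] P
  mul_map' : ∀ a a' b b', lin a b * lin a' b' = lin (a * a') (b * b')
  star_map' : ∀ a b, star (lin a b) = lin (star a) (star b)

namespace StarBilin

section Basic

variable {A : Type u} {B : Type v} {P : Type w} [NonUnitalCStarAlgebra A]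
    [CStarAlgebra B] [NonUnitalCStarAlgebra P]

instance : CoeFun (StarBilin A B P) (fun _ => A → B →ₗ[ℂ] P) := ⟨fun ρ => ⇑ρ.lin⟩

variable (ρ : StarBilin A B P)

lemma mul_map (a a' b b') : ρ a b * ρ a' b' = ρ (a * a') (b * b') := ρ.mul_map' a a' b b'

lemma star_map (a b) : star (ρ a b) = ρ (star a) (star b) := ρ.star_map' a b

/-- The restriction to the first factor. -/
def left : A →⋆ₙₐ[ℂ] P where
  toFun a := ρ a 1
  map_smul' c a := by simp
  map_zero' := by simp
  map_add' a b := by simp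
  map_mul' a b := by simp [mul_map]
  map_star' a := by simp [star_map]

@[simp] lemma left_apply (a : A) : ρ.left a = ρ a 1 := rfl

lemma isSelfAdjoint {a : A} {b : B} (ha : IsSelfAdjoint a) (hb : IsSelfAdjoint b) :
    IsSelfAdjoint (ρ a b) := by
  rw [IsSelfAdjoint, star_map, ha.star_eq, hb.star_eq]

lemma norm_le (a : A) (b : B) : ‖ρ a b‖ ≤ ‖a‖ * ‖b‖ := by
  let _ := CStarAlgebra.spectralOrder B
  have _ := CStarAlgebra.spectralOrderedRing B
  let _ := CStarAlgebra.spectralOrder P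
  have _ := CStarAlgebra.spectralOrderedRing P
  have h1 : ‖ρ a 1‖ ≤ ‖a‖ := NonUnitalStarAlgHom.norm_apply_le ρ.left a
  have h0 : 0 ≤ algebraMap ℝ B (‖b‖ ^ 2) - star b * b :=
    sub_nonneg.2 CStarAlgebra.star_mul_le_algebraMap_norm_sq
  obtain ⟨s, hs⟩ := CStarAlgebra.nonneg_iff_eq_star_mul_self.1 h0
  have h2 : star (ρ a b) * ρ a b ≤ (‖b‖ ^ 2) • (star (ρ a 1) * ρ a 1) := by
    rw [← sub_nonneg]
    have : (‖b‖ ^ 2) • (star (ρ a 1) * ρ a 1) - star (ρ a b) * ρ a b = star (ρ a s) * ρ a s := by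
      rw [star_map, star_map, star_map, mul_map, mul_map, mul_map, ← hs, map_sub (ρ.lin (star a * a)),
        Algebra.algebraMap_eq_smul_one, ← Complex.coe_smul, ← Complex.coe_smul, map_smul]
      simp
    rw [this]
    exact star_mul_self_nonneg _
  have h3 := CStarAlgebra.norm_le_norm_of_nonneg_of_le (star_mul_self_nonneg _) h2
  rw [norm_smul, CStarRing.norm_star_mul_self, CStarRing.norm_star_mul_self,
    Real.norm_of_nonneg (by positivity)] at h3
  have h4 : ‖ρ a b‖ ≤ ‖b‖ * ‖ρ a 1‖ := by
    refine abs_le_of_sq_le_sq' (by nlinarith) (by positivity) |>.2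
  calc ‖ρ a b‖ ≤ ‖b‖ * ‖ρ a 1‖ := h4
    _ ≤ ‖b‖ * ‖a‖ := by gcongr
    _ = ‖a‖ * ‖b‖ := mul_comm _ _

end Basic

section Alg

variable {A : Type u} {B : Type v} {P : Type w} [CStarAlgebra A]
    [CStarAlgebra B] [CStarAlgebra P] (ρ : StarBilin A B P)

/-- The linearization on the algebraic tensor product. -/
def alg : A ⊗[ℂ] B →ₗ[ℂ] P := TensorProduct.lift ρ.lin

@[simp] lemma alg_tmul (a : A) (b : B) : ρ.alg (a ⊗ₜ b) = ρ a b := rfl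

lemma alg_mul (s t : A ⊗[ℂ] B) : ρ.alg (s * t) = ρ.alg s * ρ.alg t := by
  induction s with
  | zero => simp
  | add x y hx hy => rw [add_mul, map_add, map_add, add_mul, hx, hy]
  | tmul a b =>
    induction t with
    | zero => simp
    | add x y hx hy => rw [mul_add, map_add, map_add, mul_add, hx, hy]
    | tmul c d => simp [mul_map]

lemma alg_star (s : A ⊗[ℂ] B) : ρ.alg (star s) = star (ρ.alg s) := by
  induction s with
  | zero => simp
  | add x y hx hy => rw [star_add, map_add, map_add, star_add, hx, hy]
  | tmul a b => simp [star_map]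

end Alg

end StarBilin

/-- The right slice map `x ⊗ y ↦ ω y • x`. -/
def sliceRight {D : Type*} [CStarAlgebra D] (ω : D →ₗ[ℂ] ℂ) : D ⊗[ℂ] D →ₗ[ℂ] D :=
  TensorProduct.lift ((LinearMap.lsmul ℂ D).flip.compl₂ ω)

@[simp] lemma sliceRight_tmul {D : Type*} [CStarAlgebra D] (ω : D →ₗ[ℂ] ℂ) (x y : D) :
    sliceRight ω (x ⊗ₜ y) = ω y • x := by
  simp [sliceRight]

/-- Slice maps are approximately contractive for suitable states, on finite sets. -/
lemma exists_state_slice {D T : Type*} [CStarAlgebra D] [Nontrivial D] [CStarAlgebra T]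
    (ρ : StarBilin D D T) (hρ : ∀ x y, ‖ρ x y‖ = ‖x‖ * ‖y‖)
    (Y : Finset (D ⊗[ℂ] D)) {ε : ℝ} (hε : 0 < ε) :
    ∃ ω : D →ₗ[ℂ] ℂ, ω 1 = 1 ∧ (∀ a, ω (star a) = star (ω a)) ∧ (∀ a, 0 ≤ (ω (star a * a)).re) ∧
      ∀ y ∈ Y, ‖sliceRight ω y‖ ≤ ‖ρ.alg y‖ + ε := by
  classical
  let _ := CStarAlgebra.spectralOrder D
  have _ := CStarAlgebra.spectralOrderedRing D
  choose R hR using fun y : D ⊗[ℂ] D => TensorProduct.exists_finset y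
  set K : ℝ := 1 + ∑ y ∈ Y, ∑ i ∈ R y, ‖i.1‖ with hK
  have hKpos : 0 < K := by positivity
  obtain ⟨ω, h1, h2, h3, h, h4, h5, h6⟩ :=
    exists_state_excision (Y.biUnion fun y => (R y).image Prod.snd) (div_pos hε hKpos)
  refine ⟨ω, h1, h2, h3, fun y hy => ?_⟩
  have hs : ρ (sliceRight ω y) (h * h) = ∑ i ∈ R y, ρ i.1 (ω i.2 • (h * h)) := by
    conv_lhs => rw [hR y]
    simp
  have ht : ρ 1 h * ρ.alg y * ρ 1 h = ∑ i ∈ R y, ρ i.1 (h * i.2 * h) := by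
    conv_lhs => rw [hR y]
    simp [Finset.mul_sum, Finset.sum_mul, StarBilin.mul_map]
  have hhh : ‖h * h‖ = 1 := by
    have := CStarRing.norm_star_mul_self (x := h)
    rwa [h4.star_eq, h5, one_mul] at this
  have hn1 : ‖ρ (1 : D) h‖ = 1 := by simp [hρ, h5]
  calc ‖sliceRight ω y‖ = ‖ρ (sliceRight ω y) (h * h)‖ := by simp [hρ, hhh]
    _ = ‖ρ 1 h * ρ.alg y * ρ 1 h - ∑ i ∈ R y, ρ i.1 (h * i.2 * h - ω i.2 • (h * h))‖ := by
      rw [hs, ht, ← Finset.sum_sub_distrib]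
      simp
    _ ≤ ‖ρ 1 h * ρ.alg y * ρ 1 h‖ + ‖∑ i ∈ R y, ρ i.1 (h * i.2 * h - ω i.2 • (h * h))‖ :=
      norm_sub_le _ _
    _ ≤ ‖ρ.alg y‖ + ε := by
      gcongr
      · refine (norm_mul_le _ _).trans ?_
        rw [hn1, mul_one]
        refine (norm_mul_le _ _).trans ?_
        rw [hn1, one_mul]
      · calc ‖∑ i ∈ R y, ρ i.1 (h * i.2 * h - ω i.2 • (h * h))‖
            ≤ ∑ i ∈ R y, ‖i.1‖ * (ε / K) := by
              refine norm_sum_le_of_le _ fun i hi => ?_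
              rw [hρ]
              gcongr
              exact h6 _ (Finset.mem_biUnion.2 ⟨y, hy, Finset.mem_image_of_mem _ hi⟩)
          _ = (∑ i ∈ R y, ‖i.1‖) * (ε / K) := by rw [Finset.sum_mul]
          _ ≤ K * (ε / K) := by
              gcongr
              have := Finset.single_le_sum (f := fun y => ∑ i ∈ R y, ‖i.1‖)
                (fun y _ => by positivity) hy
              linarith
          _ = ε := by field_simp

section Commutator

variable {D : Type u} [CStarAlgebra D]

lemma stabUnitary_mem {x : D} (hx : x ∈ unitary D) (n : ℕ) :
    stabUnitary n x ∈ unitary (Matrix (Fin (n + 1)) (Fin (n + 1)) D) := by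
  have h1 := Unitary.star_mul_self_of_mem hx
  have h2 := Unitary.mul_star_self_of_mem hx
  rw [Unitary.mem_iff, Matrix.star_eq_conjTranspose, stabUnitary, Matrix.diagonal_conjTranspose,
    Matrix.diagonal_mul_diagonal, Matrix.diagonal_mul_diagonal, ← Matrix.diagonal_one]
  constructor <;> congr 1 <;> ext i <;> by_cases hi : i = 0 <;> simp [hi, h1, h2]

/-- Scalar rotation matrices. -/
def rotationMatrix (D : Type u) [CStarAlgebra D] (θ : ℝ) : Matrix (Fin 2) (Fin 2) D :=
  !![algebraMap ℝ D (Real.cos θ), -algebraMap ℝ D (Real.sin θ);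
    algebraMap ℝ D (Real.sin θ), algebraMap ℝ D (Real.cos θ)]

lemma rotationMatrix_mem (θ : ℝ) :
    rotationMatrix D θ ∈ unitary (Matrix (Fin 2) (Fin 2) D) := by
  have hs : ∀ r : ℝ, star (algebraMap ℝ D r) = algebraMap ℝ D r := fun r =>
    (IsSelfAdjoint.algebraMap D (IsSelfAdjoint.all r)).star_eq
  have h1 : algebraMap ℝ D (Real.cos θ) * algebraMap ℝ D (Real.cos θ) +
      algebraMap ℝ D (Real.sin θ) * algebraMap ℝ D (Real.sin θ) = 1 := by
    rw [← map_mul, ← map_mul, ← map_add, ← sq, ← sq, Real.cos_sq_add_sin_sq, map_one]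
  have h2 : algebraMap ℝ D (Real.cos θ) * algebraMap ℝ D (Real.sin θ) =
      algebraMap ℝ D (Real.sin θ) * algebraMap ℝ D (Real.cos θ) := Algebra.commutes _ _
  have h3 : algebraMap ℝ D (Real.sin θ) * algebraMap ℝ D (Real.sin θ) +
      algebraMap ℝ D (Real.cos θ) * algebraMap ℝ D (Real.cos θ) = 1 := by rw [add_comm, h1]
  rw [Unitary.mem_iff]
  constructor <;> ext i j <;> fin_cases i <;> fin_cases j <;>
    simp [rotationMatrix, Matrix.mul_apply, Fin.sum_univ_two, Matrix.star_apply, hs, h1, h2, h3]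

lemma continuous_rotationMatrix : Continuous (rotationMatrix D) := by
  refine continuous_matrix fun i j => ?_
  have h : Continuous (algebraMap ℝ D) := continuous_algebraMap ℝ D
  fin_cases i <;> fin_cases j <;> simp [rotationMatrix] <;> fun_prop

lemma rotationMatrix_zero : rotationMatrix D 0 = 1 := by
  ext i j
  fin_cases i <;> fin_cases j <;> simp [rotationMatrix]

lemma rotationMatrix_conj_stabUnitary (y : D) :
    rotationMatrix D (Real.pi / 2) * stabUnitary 1 y * star (rotationMatrix D (Real.pi / 2)) =
      Matrix.diagonal (fun i => if i = 0 then 1 else y) := by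
  have h1 : rotationMatrix D (Real.pi / 2) = !![0, -1; 1, 0] := by simp [rotationMatrix]
  have h2 : stabUnitary 1 y = !![y, 0; 0, 1] := by
    ext i j
    fin_cases i <;> fin_cases j <;> simp [stabUnitary]
  rw [h1, h2]
  ext i j
  fin_cases i <;> fin_cases j <;>
    simp [Matrix.mul_apply, Fin.sum_univ_two, Matrix.star_apply]

/-- The stabilization map on unitary groups. -/
def stabUnitaryHom (D : Type u) [CStarAlgebra D] (n : ℕ) :
    unitary D →* unitary (Matrix (Fin (n + 1)) (Fin (n + 1)) D) where
  toFun x := ⟨stabUnitary n x, stabUnitary_mem x.2 n⟩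
  map_one' := by
    apply Subtype.ext
    simp [stabUnitary]
  map_mul' x y := by
    apply Subtype.ext
    simp only [stabUnitary, MulMemClass.mk_mul_mk, Matrix.diagonal_mul_diagonal]
    congr 1
    ext i
    by_cases hi : i = 0 <;> simp [hi]

lemma joined_commutator_one {G : Type*} [Group G] [TopologicalSpace G] [IsTopologicalGroup G]
    {X Y : G} {R : ℝ → G} (hR : Continuous R) (h0 : R 0 = 1) {t : ℝ}
    (ht : Commute X (R t * Y * (R t)⁻¹)) : Joined (X * Y * X⁻¹ * Y⁻¹) 1 := by
  refine ⟨⟨⟨fun s : unitInterval => X * (R (s * t) * Y * (R (s * t))⁻¹) * X⁻¹ *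
    (R (s * t) * Y * (R (s * t))⁻¹)⁻¹, by fun_prop⟩, ?_, ?_⟩⟩
  · simp [h0]
  · simp only [Set.Icc.coe_one, one_mul]
    rw [ht.eq, mul_inv_cancel_right, mul_inv_cancel]

/-- Multiplicative commutators of unitaries vanish in `K₁`. -/
lemma representsZeroInK1_commutator (x y : unitary D) :
    RepresentsZeroInK1 ((x * y * x⁻¹ * y⁻¹ : unitary D) : D) := by
  refine ⟨1, (stabUnitaryHom D 1 (x * y * x⁻¹ * y⁻¹)).2, ?_⟩
  change Joined (stabUnitaryHom D 1 (x * y * x⁻¹ * y⁻¹)) 1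
  rw [map_mul, map_mul, map_mul, map_inv, map_inv]
  have hR : Continuous fun θ : ℝ =>
      (⟨rotationMatrix D θ, rotationMatrix_mem θ⟩ : unitary (Matrix (Fin 2) (Fin 2) D)) :=
    continuous_rotationMatrix.subtype_mk _
  refine joined_commutator_one hR (Subtype.ext rotationMatrix_zero) (t := Real.pi / 2) ?_
  apply Subtype.ext
  have h := rotationMatrix_conj_stabUnitary (y : D)
  change stabUnitary 1 (x : D) * (rotationMatrix D (Real.pi / 2) * stabUnitary 1 (y : D) *
    star (rotationMatrix D (Real.pi / 2))) = (rotationMatrix D (Real.pi / 2) *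
    stabUnitary 1 (y : D) * star (rotationMatrix D (Real.pi / 2))) * stabUnitary 1 (x : D)
  rw [h, stabUnitary, Matrix.diagonal_mul_diagonal, Matrix.diagonal_mul_diagonal]
  congr 1
  ext i
  by_cases hi : i = 0 <;> simp [hi]

/-- In a `K₁`-injective C*-algebra, commutators of unitaries are products of exponentials. -/
lemma K1Injective.exists_list_expUnitary (hK : K1Injective D) (x y : unitary D) :
    ∃ L : List (selfAdjoint D), (L.map selfAdjoint.expUnitary).prod = x * y * x⁻¹ * y⁻¹ := by
  have h := hK _ (representsZeroInK1_commutator x y)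
  exact Unitary.mem_pathComponentOne_iff.1 h.symm

end Commutator

/-- Tensor product data with unital second factor, as a bilinear map. -/
def CStarTensor.toStarBilin {A : Type u} {B : Type v} {T : Type w} [NonUnitalCStarAlgebra A]
    [CStarAlgebra B] [NonUnitalCStarAlgebra T] (h : CStarTensor A B T) : StarBilin A B T where
  lin := LinearMap.mk₂ ℂ h.tmul h.add_left h.smul_left h.add_right h.smul_right
  mul_map' := h.mul_tmul
  star_map' := h.star_tmul

@[simp] lemma CStarTensor.toStarBilin_apply {A : Type u} {B : Type v} {T : Type w}
    [NonUnitalCStarAlgebra A] [CStarAlgebra B] [NonUnitalCStarAlgebra T] (h : CStarTensor A B T)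
    (a : A) (b : B) : h.toStarBilin a b = h.tmul a b := rfl

section ApproxConj

/-- Approximate unitary conjugacy, on finite sets. -/
def ApproxConj {A : Type*} {B : Type*} [CStarAlgebra B] (φ ψ : A → B) : Prop :=
  ∀ (S : Finset A) (ε : ℝ), 0 < ε →
    ∃ u : unitary B, ∀ a ∈ S, ‖(u : B) * φ a * star (u : B) - ψ a‖ ≤ ε

lemma norm_unitary_conj {B : Type*} [CStarAlgebra B] (u : unitary B) (x : B) :
    ‖(u : B) * x * star (u : B)‖ = ‖x‖ := by
  rw [← Unitary.coe_star, CStarRing.norm_mul_coe_unitary, CStarRing.norm_coe_unitary_mul]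

variable {A B : Type*} [CStarAlgebra B] {φ ψ χ : A → B}

lemma ApproxConj.symm (h : ApproxConj φ ψ) : ApproxConj ψ φ := fun S ε hε => by
  obtain ⟨u, hu⟩ := h S ε hε
  refine ⟨star u, fun a ha => ?_⟩
  rw [← norm_unitary_conj u, ← norm_neg]
  have h1 := Unitary.mul_star_self_of_mem u.2
  have e : -((u : B) * (((star u : unitary B) : B) * ψ a * star ((star u : unitary B) : B) - φ a) *
        star (u : B)) = (u : B) * φ a * star (u : B) - ψ a := by
    calc _ = (u : B) * φ a * star (u : B) - ((u : B) * star (u : B)) * ψ a *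
        ((u : B) * star (u : B)) := by
          simp only [Unitary.coe_star, star_star]; noncomm_ring
      _ = _ := by rw [h1]; simp
  rw [e]
  exact hu a ha

lemma ApproxConj.trans (h : ApproxConj φ ψ) (h' : ApproxConj ψ χ) : ApproxConj φ χ :=
  fun S ε hε => by
  obtain ⟨u, hu⟩ := h S (ε / 2) (half_pos hε)
  obtain ⟨v, hv⟩ := h' S (ε / 2) (half_pos hε)
  refine ⟨v * u, fun a ha => ?_⟩
  have : ((v * u : unitary B) : B) * φ a * star ((v * u : unitary B) : B) - χ a =
      (v : B) * ((u : B) * φ a * star (u : B) - ψ a) * star (v : B) +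
        ((v : B) * ψ a * star (v : B) - χ a) := by
    simp [mul_sub, sub_mul, mul_assoc]
  rw [this]
  refine (norm_add_le _ _).trans ?_
  rw [norm_unitary_conj]
  linarith [hu a ha, hv a ha]

lemma ApproxConj.comp_right {A' : Type*} (h : ApproxConj φ ψ) (f : A' → A) :
    ApproxConj (φ ∘ f) (ψ ∘ f) := fun S ε hε => by
  classical
  obtain ⟨u, hu⟩ := h (S.image f) ε hε
  exact ⟨u, fun a ha => hu _ (Finset.mem_image_of_mem f ha)⟩

lemma ApproxConj.comp_left {C : Type*} [CStarAlgebra C] (h : ApproxConj φ ψ) (f : B →⋆ₐ[ℂ] C) :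
    ApproxConj (f ∘ φ) (f ∘ ψ) := fun S ε hε => by
  obtain ⟨u, hu⟩ := h S ε hε
  refine ⟨⟨f u, Unitary.map_mem f u.2⟩, fun a ha => ?_⟩
  have : ‖f ((u : B) * φ a * star (u : B) - ψ a)‖ ≤ ε :=
    (NonUnitalStarAlgHom.norm_apply_le f _).trans (hu a ha)
  simpa [map_star] using this

lemma ApproxUnitaryEquiv.approxConj {A : Type u} {B : Type v} [CStarAlgebra B] {φ ψ : A → B}
    (h : ApproxUnitaryEquiv φ ψ) : ApproxConj φ ψ := fun S ε hε => by
  obtain ⟨v, hv, hlim⟩ := h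
  have hev : ∀ᶠ n in atTop, ∀ a ∈ S,
      ‖star (v n) * (φ a : 𝓜(ℂ, B)) * v n - (ψ a : 𝓜(ℂ, B))‖ < ε :=
    (Filter.eventually_all_finset S).2 fun a _ => (hlim a).eventually_lt_const hε
  obtain ⟨n, hn⟩ := hev.exists
  have hinj : Function.Injective (DoubleCentralizer.coeHom (𝕜 := ℂ) (A := B)) := fun a b hab => by
    have := congrArg (fun z : 𝓜(ℂ, B) => z.fst 1) hab
    simpa using this
  set u : B := (v n).fst 1 with hu
  have hvu : v n = (DoubleCentralizer.coeHom (𝕜 := ℂ) (A := B)) u := by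
    have hc := (v n).central
    have h1 : (v n).snd 1 = u := by simpa using hc 1 1
    apply DoubleCentralizer.ext
    apply Prod.ext
    · ext y
      have := hc 1 y
      simp only [one_mul] at this
      change (v n).fst y = u * y
      rw [← this, h1]
    · ext y
      have := hc y 1
      change (v n).snd y = y * u
      rw [hu, ← this, mul_one]
  have hone : (DoubleCentralizer.coeHom (𝕜 := ℂ) (A := B)) 1 = 1 := by
    apply DoubleCentralizer.ext
    apply Prod.ext <;> ext y <;> simp
  have huu : u ∈ unitary B := by
    have := hv n
    rw [Unitary.mem_iff, hvu, ← map_star, ← map_mul, ← map_mul] at this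
    exact Unitary.mem_iff.2 ⟨hinj (this.1.trans hone.symm), hinj (this.2.trans hone.symm)⟩
  refine ⟨star ⟨u, huu⟩, fun a ha => ?_⟩
  have h2 := hn a ha
  rw [hvu] at h2
  change ‖star ((DoubleCentralizer.coeHom (𝕜 := ℂ) (A := B)) u) *
    (DoubleCentralizer.coeHom (𝕜 := ℂ) (A := B)) (φ a) *
    (DoubleCentralizer.coeHom (𝕜 := ℂ) (A := B)) u -
    (DoubleCentralizer.coeHom (𝕜 := ℂ) (A := B)) (ψ a)‖ < ε at h2
  rw [← map_star, ← map_mul, ← map_mul, ← map_sub,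
    NonUnitalStarAlgHom.norm_map _ hinj] at h2
  simpa using h2.le

end ApproxConj

/-- A cross-normed tensor square whose factor embeddings are conjugate by unitaries connected
to the identity, and which admits approximately central copies of `D`. -/
structure StarBilin.HalfFlip {D : Type u} {T : Type w} [CStarAlgebra D] [CStarAlgebra T]
    (ρ : StarBilin D D T) : Prop where
  one_map : ρ 1 1 = 1
  norm_map : ∀ x y, ‖ρ x y‖ = ‖x‖ * ‖y‖
  dense : DenseRange ρ.alg
  flip : ∀ (S : Finset D) (ε : ℝ), 0 < ε → ∃ L : List (selfAdjoint T), ∀ d ∈ S,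
    ‖((L.map selfAdjoint.expUnitary).prod : T) * ρ 1 d *
      star ((L.map selfAdjoint.expUnitary).prod : T) - ρ d 1‖ ≤ ε
  central : ∀ (S : Finset D) (ε : ℝ), 0 < ε →
    ∃ ψ : D →⋆ₐ[ℂ] D, ∀ x ∈ S, ∀ y ∈ S, ‖ψ x * y - y * ψ x‖ ≤ ε

lemma StarBilin.exists_starAlgHom_right {D : Type u} {T : Type w} [CStarAlgebra D]
    [CStarAlgebra T] (ρ : StarBilin D D T) (h1 : ρ 1 1 = 1) :
    ∃ r : D →⋆ₐ[ℂ] T, ∀ d, r d = ρ 1 d :=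
  ⟨{ toFun := fun d => ρ 1 d
     map_one' := h1
     map_mul' := fun a b => by simp [ρ.mul_map]
     map_zero' := by simp
     map_add' := fun a b => by simp
     commutes' := fun c => by simp [Algebra.algebraMap_eq_smul_one, h1]
     map_star' := fun a => by simp [ρ.star_map] }, fun _ => rfl⟩

lemma MinTensor.halfFlip {D T : Type u} [CStarAlgebra D] [Nontrivial D] [CStarAlgebra T] (h : MinTensor D D T)
    (h1 : h.tmul 1 1 = 1) (hssa : IsStronglySelfAbsorbing h) (hK : K1Injective D) :
    h.toStarBilin.HalfFlip := by
  classical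
  obtain ⟨-, φ, hφ⟩ := hssa
  have _ : Nontrivial T := φ.injective.nontrivial
  have hdense : DenseRange h.toStarBilin.alg := by
    refine h.dense_span.mono ?_
    change ((Submodule.span ℂ {t : T | ∃ a b, h.tmul a b = t} : Submodule ℂ T) : Set T) ⊆
      (LinearMap.range h.toStarBilin.alg : Submodule ℂ T)
    refine Submodule.span_le.2 ?_
    rintro _ ⟨a, b, rfl⟩
    exact ⟨a ⊗ₜ b, rfl⟩
  have hext : ∀ f g : T →⋆ₙₐ[ℂ] T, (∀ a b, f (h.tmul a b) = g (h.tmul a b)) → f = g := by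
    intro f g hfg
    have hf : Continuous f := AddMonoidHomClass.continuous_of_bound f 1 fun x => by
      simpa using NonUnitalStarAlgHom.norm_apply_le f x
    have hg : Continuous g := AddMonoidHomClass.continuous_of_bound g 1 fun x => by
      simpa using NonUnitalStarAlgHom.norm_apply_le g x
    refine DFunLike.coe_injective (hdense.equalizer hf hg ?_)
    ext t
    simp only [Function.comp_apply]
    induction t with
    | zero => simp
    | add x y hx hy => simp [hx, hy]
    | tmul a b => exact hfg a b
  have hunital : ∀ f : T →⋆ₙₐ[ℂ] T, f 1 = 1 → ∃ f' : T →⋆ₐ[ℂ] T, ∀ t, f' t = f t := by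
    intro f hf
    exact ⟨{ toFun := f
             map_one' := hf
             map_mul' := map_mul f
             map_zero' := map_zero f
             map_add' := map_add f
             commutes' := fun c => by simp [Algebra.algebraMap_eq_smul_one, hf]
             map_star' := map_star f }, fun _ => rfl⟩
  obtain ⟨r, hr⟩ := h.toStarBilin.exists_starAlgHom_right h1
  have hl : ApproxConj φ h.fst := hφ.approxConj
  -- the flip
  obtain ⟨σ₀, hσ₀⟩ := h.minimal T
    { tmul := fun a b => h.tmul b a
      add_left := fun a a' b => h.add_right b a a'
      add_right := fun a b b' => h.add_left b b' a
      smul_left := fun c a b => h.smul_right c b a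
      smul_right := fun c a b => h.smul_left c b a
      mul_tmul := fun a a' b b' => h.mul_tmul b b' a a'
      star_tmul := fun a b => h.star_tmul b a
      norm_tmul := fun a b => by rw [h.norm_tmul, mul_comm]
      dense_span := by
        convert h.dense_span using 5
        exact ⟨fun ⟨a, b, h⟩ => ⟨b, a, h⟩, fun ⟨a, b, h⟩ => ⟨b, a, h⟩⟩ }
  simp only at hσ₀
  obtain ⟨σ, hσ'⟩ := hunital σ₀ (by rw [← h1, hσ₀])
  have hσ : ∀ a b, σ (h.tmul b a) = h.tmul a b := fun a b => by rw [hσ', hσ₀]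
  have hσσ : ∀ t, σ (σ t) = t := by
    have := hext (σ₀.comp σ₀) (NonUnitalStarAlgHom.id ℂ T) (fun a b => by simp [hσ₀])
    intro t
    simpa [hσ'] using DFunLike.congr_fun this t
  let α : D →⋆ₐ[ℂ] D := ((φ.symm : T →⋆ₐ[ℂ] D).comp σ).comp (φ : D →⋆ₐ[ℂ] T)
  have hα : ∀ d, α d = φ.symm (σ (φ d)) := fun _ => rfl
  have hαα : ∀ d, α (α d) = d := fun d => by simp [hα, hσσ]
  have hαnorm : ∀ d, ‖α d‖ = ‖d‖ := fun d => by
    refine le_antisymm (NonUnitalStarAlgHom.norm_apply_le α d) ?_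
    conv_lhs => rw [← hαα d]
    exact NonUnitalStarAlgHom.norm_apply_le α _
  obtain ⟨τ₀, hτ₀⟩ := h.minimal T
    { tmul := fun a b => h.tmul (α a) b
      add_left := fun a a' b => by rw [map_add, h.add_left]
      add_right := fun a b b' => h.add_right _ b b'
      smul_left := fun c a b => by rw [map_smul, h.smul_left]
      smul_right := fun c a b => h.smul_right c _ b
      mul_tmul := fun a a' b b' => by rw [h.mul_tmul, map_mul]
      star_tmul := fun a b => by rw [h.star_tmul, map_star]
      norm_tmul := fun a b => by rw [h.norm_tmul, hαnorm]
      dense_span := by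
        convert h.dense_span using 5
        exact ⟨fun ⟨a, b, h⟩ => ⟨α a, b, h⟩, fun ⟨a, b, h⟩ => ⟨α a, b, by rwa [hαα]⟩⟩ }
  simp only at hτ₀
  have hτ₁ : ∀ a b, τ₀ (h.tmul a b) = h.tmul (α a) b := fun a b => by
    rw [← hτ₀ (α a) b, hαα]
  obtain ⟨τ, hτ'⟩ := hunital τ₀ (by rw [← h1, hτ₁, map_one])
  have hτ : ∀ a b, τ (h.tmul a b) = h.tmul (α a) b := fun a b => by rw [hτ', hτ₁]
  -- the half flip: `1 ⊗ d = σ (d ⊗ 1) ~ σ (φ d) = φ (α d) ~ α d ⊗ 1`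
  have h2 : ApproxConj h.snd (fun d => h.tmul (α d) 1) := by
    have e1 : ApproxConj (σ ∘ φ) (σ ∘ h.fst) := hl.comp_left σ
    have e2 : ApproxConj (φ ∘ α) (h.fst ∘ α) := hl.comp_right α
    have e3 : (φ ∘ α : D → T) = σ ∘ φ := by ext d; simp [hα]
    have e4 : (σ ∘ h.fst : D → T) = h.snd := by ext d; exact hσ _ _
    rw [e3] at e2
    rw [e4] at e1
    exact e1.symm.trans e2
  have hflip : ApproxConj h.snd h.fst := by
    have := h2.comp_left τ
    convert this using 1
    · ext d
      simp [MinTensor.snd, hτ]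
    · ext d
      simp [MinTensor.fst, hτ, hαα]
  refine ⟨h1, h.norm_tmul, hdense, fun S ε hε => ?_, fun S ε hε => ?_⟩
  · obtain ⟨u, hu⟩ := hflip S (ε / 2) (half_pos hε)
    set K : ℝ := 1 + ∑ d ∈ S, ‖d‖ with hK'
    have hKpos : 0 < K := by positivity
    set y : D := φ.symm (star (u : T)) with hy
    obtain ⟨v, hv⟩ := hl {y} (ε / (4 * K)) (by positivity)
    have hv' := hv y (Finset.mem_singleton_self y)
    have hφy : φ y = star (u : T) := by simp [hy]
    rw [hφy] at hv'
    have hlist : ∃ L : List (selfAdjoint T),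
        ((L.map selfAdjoint.expUnitary).prod : unitary T) = u * v * u⁻¹ * v⁻¹ := by
      obtain ⟨L, hL⟩ := hK.exists_list_expUnitary
        (⟨φ.symm u, Unitary.map_mem φ.symm u.2⟩ : unitary D) ⟨φ.symm v, Unitary.map_mem φ.symm v.2⟩
      refine ⟨L.map fun k : selfAdjoint D => (⟨φ k, IsSelfAdjoint.map k.2 φ⟩ : selfAdjoint T), ?_⟩
      have hφc : Continuous φ := AddMonoidHomClass.continuous_of_bound φ 1 fun x => by
        simpa using NonUnitalStarAlgHom.norm_apply_le φ x
      have key : ∀ L : List (selfAdjoint D), ((((L.map fun k : selfAdjoint D =>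
          (⟨φ k, IsSelfAdjoint.map k.2 φ⟩ : selfAdjoint T)).map selfAdjoint.expUnitary).prod : unitary T) : T) =
          φ (((L.map selfAdjoint.expUnitary).prod : unitary D) : D) := by
        intro L
        induction L with
        | nil => simp
        | cons k L ih =>
          simp only [List.map_cons, List.prod_cons, Submonoid.coe_mul, map_mul]
          rw [ih]
          congr 1
          simp only [selfAdjoint.expUnitary_coe]
          let _ : NormedAlgebra ℚ D := NormedAlgebra.restrictScalars ℚ ℂ D
          let _ : NormedAlgebra ℚ T := NormedAlgebra.restrictScalars ℚ ℂ T
          rw [← map_smul]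
          exact (NormedSpace.map_exp (φ : D →⋆ₐ[ℂ] T) hφc _).symm
      apply Subtype.ext
      rw [key, hL]
      simp only [← Unitary.star_eq_inv, Submonoid.coe_mul, Unitary.coe_star, map_mul]
      rw [map_star, map_star]
      simp
    obtain ⟨L, hL⟩ := hlist
    refine ⟨L, fun d hd => ?_⟩
    have hL' : ((L.map selfAdjoint.expUnitary).prod : T) = u * v * star (u : T) * star (v : T) := by
      rw [hL]; simp [← Unitary.star_eq_inv]
    have hdK : ‖d‖ ≤ K := by
      have := Finset.single_le_sum (f := fun d : D => ‖d‖) (fun _ _ => norm_nonneg _) hd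
      linarith
    set w : T := v * star (u : T) * star (v : T) with hw
    have hwn : ‖star w‖ ≤ 1 := by
      rw [norm_star, hw, norm_unitary_conj v, norm_star]
      exact CStarRing.norm_of_mem_unitary u.2 |>.le
    have hww : w * star w = 1 := by
      have : w = ((v * star u * star v : unitary T) : T) := by simp [hw]
      rw [this]
      exact Unitary.mul_star_self_of_mem (v * star u * star v).2
    have hcomm : h.tmul y 1 * h.tmul 1 d = h.tmul 1 d * h.tmul y 1 := by simp [h.mul_tmul]
    have hRn : ‖h.tmul 1 d‖ ≤ K := by
      refine (h.norm_tmul 1 d).trans_le ?_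
      simpa using hdK
    have hwd : ‖w * h.tmul 1 d * star w - h.tmul 1 d‖ ≤ ε / 2 := by
      have e : w * h.tmul 1 d * star w - h.tmul 1 d =
          ((w - h.tmul y 1) * h.tmul 1 d - h.tmul 1 d * (w - h.tmul y 1)) * star w := by
        rw [sub_mul w, mul_sub, hcomm, sub_sub_sub_cancel_right, sub_mul, mul_assoc _ w, hww, mul_one]
      have hδ : ‖w - h.tmul y 1‖ ≤ ε / (4 * K) := hv'
      calc ‖w * h.tmul 1 d * star w - h.tmul 1 d‖
          ≤ ‖(w - h.tmul y 1) * h.tmul 1 d - h.tmul 1 d * (w - h.tmul y 1)‖ * 1 := by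
            rw [e]; exact (norm_mul_le _ _).trans (by gcongr)
        _ ≤ ε / (4 * K) * K + K * (ε / (4 * K)) := by
            rw [mul_one]
            refine (norm_sub_le _ _).trans (add_le_add ((norm_mul_le _ _).trans ?_)
              ((norm_mul_le _ _).trans ?_)) <;> gcongr
        _ = ε / 2 := by field_simp; ring
    have e : ((L.map selfAdjoint.expUnitary).prod : T) * h.tmul 1 d *
        star ((L.map selfAdjoint.expUnitary).prod : T) - h.tmul d 1 =
        u * (w * h.tmul 1 d * star w - h.tmul 1 d) * star (u : T) +
          (u * h.tmul 1 d * star (u : T) - h.tmul d 1) := by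
      have hL'' : ((L.map selfAdjoint.expUnitary).prod : T) = u * w := by
        rw [hL', hw]; simp only [mul_assoc]
      rw [hL'', star_mul]; noncomm_ring
    change ‖((L.map selfAdjoint.expUnitary).prod : T) * h.tmul 1 d *
        star ((L.map selfAdjoint.expUnitary).prod : T) - h.tmul d 1‖ ≤ ε
    rw [e]
    refine (norm_add_le _ _).trans ?_
    rw [norm_unitary_conj]
    have := hu d hd
    simp only [MinTensor.fst, MinTensor.snd] at this
    linarith
  · set K : ℝ := 1 + ∑ d ∈ S, ‖d‖ with hK'
    have hKpos : 0 < K := by positivity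
    obtain ⟨v, hv⟩ := hl S (ε / (2 * K)) (by positivity)
    let ψ : D →⋆ₐ[ℂ] D := ((φ.symm : T →⋆ₐ[ℂ] D).comp
      (Unitary.conjStarAlgAut ℂ T (star v) : T →⋆ₐ[ℂ] T)).comp r
    have hψ : ∀ d, φ (ψ d) = star (v : T) * h.tmul 1 d * v := fun d => by
      simp [ψ, hr, Unitary.conjStarAlgAut_apply]
    refine ⟨ψ, fun x hx y hy => ?_⟩
    have hxK : ‖x‖ ≤ K := by
      have := Finset.single_le_sum (f := fun d : D => ‖d‖) (fun _ _ => norm_nonneg _) hx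
      linarith
    have hRn : ‖h.tmul 1 x‖ ≤ K := by
      refine (h.norm_tmul 1 x).trans_le ?_
      simpa using hxK
    have hφn : ∀ d, ‖φ d‖ = ‖d‖ := fun d => NonUnitalStarAlgHom.norm_map φ φ.injective d
    rw [← hφn, map_sub, map_mul, map_mul, hψ, ← norm_unitary_conj v]
    have hcomm : h.tmul y 1 * h.tmul 1 x = h.tmul 1 x * h.tmul y 1 := by simp [h.mul_tmul]
    have hvv := Unitary.mul_star_self_of_mem v.2
    set δ : T := v * φ y * star (v : T) - h.tmul y 1 with hδ
    have hδn : ‖δ‖ ≤ ε / (2 * K) := hv y hy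
    have e : (v : T) * (star (v : T) * h.tmul 1 x * v * φ y - φ y * (star (v : T) * h.tmul 1 x * v)) *
        star (v : T) = h.tmul 1 x * δ - δ * h.tmul 1 x := by
      calc _ = (v * star (v : T)) * h.tmul 1 x * (v * φ y * star (v : T)) -
            (v * φ y * star (v : T)) * h.tmul 1 x * (v * star (v : T)) := by noncomm_ring
        _ = _ := by rw [hvv, hδ, mul_sub, sub_mul, hcomm]; simp
    rw [e]
    calc _ ≤ K * (ε / (2 * K)) + ε / (2 * K) * K := by
            refine (norm_sub_le _ _).trans (add_le_add ((norm_mul_le _ _).trans ?_)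
              ((norm_mul_le _ _).trans ?_)) <;> gcongr
      _ = ε := by field_simp; ring

section GramPositivity

open scoped ComplexOrder MatrixOrder

/-- A positive functional evaluated on a Gram matrix gives a positive combination. -/
lemma sum_apply_star_mul_smul_nonneg {D P ι : Type*} [CStarAlgebra D] [NonUnitalCStarAlgebra P]
    [PartialOrder P] [StarOrderedRing P] (I : Finset ι)
    (ω : D →ₗ[ℂ] ℂ) (hstar : ∀ a, ω (star a) = star (ω a)) (hpos : ∀ a, 0 ≤ (ω (star a * a)).re)
    (w : ι → D) (Q : ι → P) :
    0 ≤ ∑ p ∈ I, ∑ q ∈ I, ω (star (w p) * w q) • (star (Q p) * Q q) := by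
  classical
  let M : Matrix I I ℂ := fun p q => ω (star (w p) * w q)
  have hM : M.PosSemidef := by
    refine Matrix.PosSemidef.of_dotProduct_mulVec_nonneg ?_ fun x => ?_
    · ext p q
      change star (ω (star (w q) * w p)) = ω (star (w p) * w q)
      simp [← hstar]
    · have e : star x ⬝ᵥ (M.mulVec x) =
          ω (star (∑ p, x p • w p) * (∑ p, x p • w p)) := by
        simp only [dotProduct, Matrix.mulVec, M, star_sum, Finset.sum_mul, Finset.mul_sum, map_sum,
          star_smul, smul_mul_assoc, mul_smul_comm, map_smul, smul_eq_mul, Pi.star_apply]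
        rw [Finset.sum_comm]
        refine Finset.sum_congr rfl fun p _ => Finset.sum_congr rfl fun q _ => by ring
      rw [e, Complex.le_def]
      refine ⟨hpos _, ?_⟩
      have := hstar (star (∑ p, x p • w p) * (∑ p, x p • w p))
      rw [star_mul, star_star, Complex.star_def, eq_comm, Complex.conj_eq_iff_im] at this
      exact this.symm
  obtain ⟨B, hB⟩ := CStarAlgebra.nonneg_iff_eq_star_mul_self.1 hM.nonneg
  rw [Matrix.star_eq_conjTranspose] at hB
  have e : ∑ p ∈ I, ∑ q ∈ I, ω (star (w p) * w q) • (star (Q p) * Q q) =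
      ∑ k, star (∑ p : I, B k p • Q p) * (∑ p : I, B k p • Q p) := by
    calc _ = ∑ p : I, ∑ q : I, M p q • (star (Q p) * Q q) := by
          rw [← Finset.sum_coe_sort]
          refine Finset.sum_congr rfl fun p _ => ?_
          rw [← Finset.sum_coe_sort]
      _ = _ := by
          rw [hB]
          simp only [Matrix.mul_apply, Matrix.conjTranspose_apply, star_sum, Finset.sum_mul,
            Finset.mul_sum, star_smul, smul_mul_assoc, mul_smul_comm, Finset.sum_smul, Finset.smul_sum, smul_smul]
          rw [Finset.sum_comm_cycle]
          refine Finset.sum_congr rfl fun k _ => ?_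
          rw [Finset.sum_comm]
          refine Finset.sum_congr rfl fun p _ => Finset.sum_congr rfl fun q _ => by
            rw [mul_comm]
  rw [e]
  exact Finset.sum_nonneg fun k _ => star_mul_self_nonneg _

end GramPositivity

section Nuclearity

variable {D : Type u} {T : Type v} [CStarAlgebra D] [CStarAlgebra T] {ρ : StarBilin D D T}

/-- The completely positive map `d ↦ (id ⊗ ω)(v* (1 ⊗ d) v)`. -/
def sliceConj (ω : D →ₗ[ℂ] ℂ) (v : D ⊗[ℂ] D) : D →ₗ[ℂ] D where
  toFun d := sliceRight ω (star v * (1 ⊗ₜ[ℂ] d) * v)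
  map_add' a b := by simp [TensorProduct.tmul_add, mul_add, add_mul]
  map_smul' c a := by simp [TensorProduct.tmul_smul]

lemma sliceConj_apply (ω : D →ₗ[ℂ] ℂ) (v : D ⊗[ℂ] D) (d : D) :
    sliceConj ω v d = sliceRight ω (star v * (1 ⊗ₜ[ℂ] d) * v) := rfl

lemma sliceConj_sum (ω : D →ₗ[ℂ] ℂ) (R : Finset (D × D)) (d : D) :
    sliceConj ω (∑ i ∈ R, i.1 ⊗ₜ[ℂ] i.2) d =
      ∑ i ∈ R, ∑ j ∈ R, ω (star i.2 * d * j.2) • (star i.1 * j.1) := by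
  simp [sliceConj_apply, Finset.sum_mul, Finset.mul_sum]
  rw [Finset.sum_comm]

lemma lTensor_sliceConj_sum (ω : D →ₗ[ℂ] ℂ) (R : Finset (D × D)) (t : D ⊗[ℂ] D) :
    (sliceConj ω (∑ i ∈ R, i.1 ⊗ₜ[ℂ] i.2)).lTensor D t =
      ∑ i ∈ R, ∑ j ∈ R, sliceRight ω ((1 ⊗ₜ star i.2) * t * (1 ⊗ₜ j.2)) ⊗ₜ (star i.1 * j.1) := by
  induction t with
  | zero => simp
  | add x y hx hy =>
    simp only [map_add, hx, hy, mul_add, add_mul, TensorProduct.add_tmul, Finset.sum_add_distrib]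
  | tmul a b =>
    simp [sliceConj_sum, TensorProduct.tmul_sum, TensorProduct.smul_tmul]

lemma StarBilin.HalfFlip.exists_tensor (hρ : ρ.HalfFlip) (S : Finset D) {ε : ℝ} (hε : 0 < ε) :
    ∃ v : D ⊗[ℂ] D, ∀ d ∈ S,
      ‖ρ.alg (d ⊗ₜ 1 - star v * (1 ⊗ₜ d) * v)‖ ≤ ε := by
  obtain ⟨L, hL⟩ := hρ.flip S (ε / 2) (half_pos hε)
  set W : T := ((L.map selfAdjoint.expUnitary).prod : T)
  have ho : IsOpen {s : T | ∀ d ∈ S, ‖star s * ρ 1 d * s - W * ρ 1 d * star W‖ < ε / 2} := by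
    have : {s : T | ∀ d ∈ S, ‖star s * ρ 1 d * s - W * ρ 1 d * star W‖ < ε / 2} =
        ⋂ d ∈ S, {s : T | ‖star s * ρ 1 d * s - W * ρ 1 d * star W‖ < ε / 2} := by
      ext; simp
    rw [this]
    exact isOpen_biInter_finset fun d _ => isOpen_lt (by fun_prop) continuous_const
  obtain ⟨v, hv⟩ := hρ.dense.exists_mem_open ho ⟨star W, fun d _ => by simp [half_pos hε]⟩
  refine ⟨v, fun d hd => ?_⟩
  have h1 := hv d hd
  have h2 := hL d hd
  have e : ρ.alg (d ⊗ₜ 1 - star v * (1 ⊗ₜ d) * v) =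
      -((star (ρ.alg v) * ρ 1 d * ρ.alg v - W * ρ 1 d * star W) +
        (W * ρ 1 d * star W - ρ d 1)) := by
    rw [map_sub, ρ.alg_mul, ρ.alg_mul, ρ.alg_star]
    simp
  rw [e, norm_neg]
  exact (norm_add_le _ _).trans (by linarith)

lemma StarBilin.HalfFlip.exists_star_mul_self_near (hρ : ρ.HalfFlip) [PartialOrder T]
    [StarOrderedRing T] {z : D ⊗[ℂ] D} (hz : 0 ≤ ρ.alg z) {ε : ℝ} (hε : 0 < ε) :
    ∃ r : D ⊗[ℂ] D, ‖ρ.alg (z - star r * r)‖ ≤ ε := by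
  obtain ⟨s, hs⟩ := CStarAlgebra.nonneg_iff_eq_star_mul_self.1 hz
  have ho : IsOpen {x : T | ‖star s * s - star x * x‖ < ε} :=
    isOpen_lt (by fun_prop) continuous_const
  obtain ⟨r, hr⟩ := hρ.dense.exists_mem_open ho ⟨s, by simpa⟩
  refine ⟨r, ?_⟩
  rw [map_sub, ρ.alg_mul, ρ.alg_star, hs]
  exact hr.le

section Bound

variable {C : Type w} {P : Type x} [NonUnitalCStarAlgebra C] [CStarAlgebra P]
  (G : C →ₗ[ℂ] (D ⊗[ℂ] D) →ₗ[ℂ] P)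

lemma lTensor_sliceConj_nonneg [PartialOrder P] [StarOrderedRing P]
    (hmul : ∀ c c' s t, G c s * G c' t = G (c * c') (s * t))
    (hstar : ∀ c s, star (G c s) = G (star c) (star s))
    (ω : D →ₗ[ℂ] ℂ) (hω : ∀ a, ω (star a) = star (ω a)) (hpos : ∀ a, 0 ≤ (ω (star a * a)).re)
    (v r : D ⊗[ℂ] D) (c : C) :
    0 ≤ G (star c * c) ((sliceConj ω v).lTensor D (star r * r)) := by
  classical
  obtain ⟨R, rfl⟩ := TensorProduct.exists_finset v
  obtain ⟨R', rfl⟩ := TensorProduct.exists_finset r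
  have key := sum_apply_star_mul_smul_nonneg (R' ×ˢ R) ω hω hpos
    (fun p => p.1.2 * p.2.2) (fun p => G c (p.1.1 ⊗ₜ p.2.1))
  convert key using 1
  simp only [hstar, hmul, TensorProduct.star_tmul, Algebra.TensorProduct.tmul_mul_tmul, star_sum,
    Finset.sum_mul, Finset.mul_sum, map_sum, LinearMap.lTensor_tmul, sliceConj_sum,
    TensorProduct.tmul_sum, TensorProduct.tmul_smul, map_smul, Finset.sum_product, star_mul,
    mul_assoc]
  rw [Finset.sum_comm]
  refine Finset.sum_congr rfl fun l _ => ?_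
  rw [Finset.sum_comm]

/-- Approximate positivity of `G (c* c)` on elements which are positive in the tensor norm. -/
lemma StarBilin.HalfFlip.neg_algebraMap_le [Nontrivial D] (hρ : ρ.HalfFlip) [PartialOrder P]
    [StarOrderedRing P] [PartialOrder T] [StarOrderedRing T]
    (hmul : ∀ c c' s t, G c s * G c' t = G (c * c') (s * t))
    (hstar : ∀ c s, star (G c s) = G (star c) (star s))
    (hnorm : ∀ c x y, ‖G c (x ⊗ₜ y)‖ ≤ ‖c‖ * (‖x‖ * ‖y‖))
    {z : D ⊗[ℂ] D} (hzs : IsSelfAdjoint z) (hz : 0 ≤ ρ.alg z) (c : C) {ε : ℝ} (hε : 0 < ε) :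
    -algebraMap ℝ P ε ≤ G (star c * c) z := by
  classical
  set N : ℝ := ‖star c * c‖ with hN
  obtain ⟨Z, hZ⟩ := TensorProduct.exists_finset z
  set K : ℝ := 1 + N * ∑ k ∈ Z, ‖k.1‖ with hK
  have hKpos : 0 < K := by positivity
  obtain ⟨v, hv⟩ := hρ.exists_tensor (Z.image Prod.snd) (ε := ε / (4 * K)) (by positivity)
  obtain ⟨R, hR⟩ := TensorProduct.exists_finset v
  set K' : ℝ := 1 + N * ∑ i ∈ R, ∑ j ∈ R, (‖i.2‖ * ‖j.2‖ + 1) * ‖star i.1 * j.1‖ with hK'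
  have hKpos' : 0 < K' := by positivity
  obtain ⟨r, hr⟩ := hρ.exists_star_mul_self_near hz (ε := ε / (4 * K')) (by positivity)
  set e := z - star r * r with he
  obtain ⟨ω, hω1, hωs, hωp, hω⟩ := exists_state_slice ρ hρ.norm_map
    ((Z.image fun k => k.2 ⊗ₜ 1 - star v * (1 ⊗ₜ k.2) * v) ∪
      ((R ×ˢ R).image fun p => (1 ⊗ₜ star p.1.2) * e * (1 ⊗ₜ p.2.2)))
    (ε := min (ε / (4 * K)) (ε / (4 * K'))) (by positivity)
  set Θ := (sliceConj ω v).lTensor D with hΘ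
  have h1 : ‖G (star c * c) (z - Θ z)‖ ≤ ε / 2 := by
    have e1 : z - Θ z = ∑ k ∈ Z, k.1 ⊗ₜ (k.2 - sliceConj ω v k.2) := by
      conv_lhs => rw [hZ]
      simp [hΘ, TensorProduct.tmul_sub]
    have e2 : ∀ k ∈ Z, ‖k.2 - sliceConj ω v k.2‖ ≤ ε / (2 * K) := fun k hk => by
      have e3 : k.2 - sliceConj ω v k.2 =
          sliceRight ω (k.2 ⊗ₜ 1 - star v * (1 ⊗ₜ k.2) * v) := by
        rw [map_sub, sliceRight_tmul, hω1, one_smul, sliceConj_apply]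
      rw [e3]
      refine (hω _ (Finset.mem_union_left _
        (Finset.mem_image_of_mem (fun k : D × D => k.2 ⊗ₜ 1 - star v * (1 ⊗ₜ k.2) * v) hk))).trans ?_
      have := hv k.2 (Finset.mem_image_of_mem _ hk)
      calc _ ≤ ε / (4 * K) + ε / (4 * K) := add_le_add this (min_le_left _ _)
        _ = ε / (2 * K) := by field_simp; ring
    rw [e1, map_sum]
    calc _ ≤ ∑ k ∈ Z, N * (‖k.1‖ * (ε / (2 * K))) :=
          norm_sum_le_of_le _ fun k hk => (hnorm _ _ _).trans (by gcongr; exact e2 k hk)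
      _ = (N * ∑ k ∈ Z, ‖k.1‖) * (ε / (2 * K)) := by
          rw [Finset.mul_sum, Finset.sum_mul]; simp only [mul_assoc]
      _ ≤ K * (ε / (2 * K)) := by gcongr; linarith
      _ = ε / 2 := by field_simp
  have h2 : ‖G (star c * c) (Θ e)‖ ≤ ε / 2 := by
    have e2 : ∀ i ∈ R, ∀ j ∈ R, ‖sliceRight ω ((1 ⊗ₜ star i.2) * e * (1 ⊗ₜ j.2))‖ ≤
        (‖i.2‖ * ‖j.2‖ + 1) * (ε / (4 * K')) := fun i hi j hj => by
      refine (hω _ (Finset.mem_union_right _ (Finset.mem_image_of_mem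
        (fun p : (D × D) × (D × D) => (1 ⊗ₜ star p.1.2) * e * (1 ⊗ₜ p.2.2))
        (Finset.mk_mem_product hi hj)))).trans ?_
      have e3 : ‖ρ.alg ((1 ⊗ₜ star i.2) * e * (1 ⊗ₜ j.2))‖ ≤ ‖i.2‖ * (ε / (4 * K')) * ‖j.2‖ := by
        rw [ρ.alg_mul, ρ.alg_mul]
        refine (norm_mul_le _ _).trans (mul_le_mul ((norm_mul_le _ _).trans
          (mul_le_mul ?_ hr (norm_nonneg _) (norm_nonneg _))) ?_ (norm_nonneg _) (by positivity)) <;>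
        simp [hρ.norm_map]
      calc _ ≤ ‖i.2‖ * (ε / (4 * K')) * ‖j.2‖ + ε / (4 * K') := add_le_add e3 (min_le_right _ _)
        _ = _ := by ring
    rw [hΘ, hR, lTensor_sliceConj_sum, map_sum]
    calc _ ≤ ∑ i ∈ R, ∑ j ∈ R, N * ((‖i.2‖ * ‖j.2‖ + 1) * (ε / (4 * K')) * ‖star i.1 * j.1‖) := by
          refine norm_sum_le_of_le _ fun i hi => ?_
          rw [map_sum]
          exact norm_sum_le_of_le _ fun j hj => (hnorm _ _ _).trans (by gcongr; exact e2 i hi j hj)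
      _ = (N * ∑ i ∈ R, ∑ j ∈ R, (‖i.2‖ * ‖j.2‖ + 1) * ‖star i.1 * j.1‖) * (ε / (4 * K')) := by
          simp only [Finset.mul_sum, Finset.sum_mul]
          refine Finset.sum_congr rfl fun i _ => Finset.sum_congr rfl fun j _ => by ring
      _ ≤ K' * (ε / (4 * K')) := by gcongr; linarith
      _ ≤ ε / 2 := by field_simp; norm_num
  have h3 : 0 ≤ G (star c * c) (Θ (star r * r)) :=
    lTensor_sliceConj_nonneg G hmul hstar ω hωs hωp v r c
  have h4 : G (star c * c) z =
      G (star c * c) (z - Θ z) + G (star c * c) (Θ e) + G (star c * c) (Θ (star r * r)) := by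
    rw [he, map_sub Θ]; simp only [map_sub]; abel
  have hsa : IsSelfAdjoint (G (star c * c) z) := by
    rw [IsSelfAdjoint, hstar, hzs.star_eq, star_mul, star_star]
  set y := G (star c * c) (z - Θ z) + G (star c * c) (Θ e) with hy
  have hysa : IsSelfAdjoint y := by
    have : y = G (star c * c) z - G (star c * c) (Θ (star r * r)) := by rw [h4]; abel
    rw [this]
    exact hsa.sub (IsSelfAdjoint.of_nonneg h3)
  have hyn : ‖y‖ ≤ ε := (norm_add_le _ _).trans (by linarith)
  have h5 : -algebraMap ℝ P ε ≤ y :=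
    (neg_le_neg (algebraMap_mono P hyn)).trans hysa.neg_algebraMap_norm_le_self
  rw [h4]
  exact h5.trans (le_add_of_nonneg_right h3)

lemma StarBilin.HalfFlip.norm_le_mul_norm_alg [Nontrivial D] (hρ : ρ.HalfFlip)
    (hmul : ∀ c c' s t, G c s * G c' t = G (c * c') (s * t))
    (hstar : ∀ c s, star (G c s) = G (star c) (star s))
    (hnorm : ∀ c x y, ‖G c (x ⊗ₜ y)‖ ≤ ‖c‖ * (‖x‖ * ‖y‖)) (c : C) (t : D ⊗[ℂ] D) :
    ‖G c t‖ ≤ ‖c‖ * ‖ρ.alg t‖ := by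
  let _ := CStarAlgebra.spectralOrder P
  have _ := CStarAlgebra.spectralOrderedRing P
  let _ := CStarAlgebra.spectralOrder T
  have _ := CStarAlgebra.spectralOrderedRing T
  set M : ℝ := ‖ρ.alg t‖ with hM
  set z : D ⊗[ℂ] D := ((M ^ 2 : ℝ) : ℂ) • (1 ⊗ₜ 1) - star t * t with hz
  have hzs : IsSelfAdjoint z := by
    rw [IsSelfAdjoint, hz, star_sub, star_mul, star_star, star_smul]
    simp
  have hz0 : 0 ≤ ρ.alg z := by
    rw [hz, map_sub, ρ.alg_mul, ρ.alg_star, map_smul, alg_tmul, hρ.one_map,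
      sub_nonneg]
    have := CStarAlgebra.star_mul_le_algebraMap_norm_sq (a := ρ.alg t)
    rwa [Algebra.algebraMap_eq_smul_one, ← Complex.coe_smul] at this
  refine abs_le_of_sq_le_sq' ?_ (by positivity) |>.2
  refine le_of_forall_pos_le_add fun ε hε => ?_
  have h1 := hρ.neg_algebraMap_le G hmul hstar hnorm hzs hz0 c hε
  have h2 : star (G c t) * G c t ≤ ((M ^ 2 : ℝ) : ℂ) • G (star c * c) (1 ⊗ₜ 1) + algebraMap ℝ P ε := by
    rw [hstar, hmul, ← sub_nonneg]
    rw [hz, map_sub, map_smul, ← sub_nonneg] at h1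
    convert h1 using 1
    abel
  have h3 := CStarAlgebra.norm_le_norm_of_nonneg_of_le (star_mul_self_nonneg _) h2
  rw [CStarRing.norm_star_mul_self] at h3
  calc ‖G c t‖ ^ 2
    _ ≤ M ^ 2 * (‖c‖ ^ 2) + ε := by
      rw [sq ‖G c t‖]
      refine h3.trans ?_
      refine (norm_add_le _ _).trans (add_le_add ?_ ?_)
      · rw [norm_smul, Complex.norm_real, Real.norm_of_nonneg (by positivity)]
        gcongr
        refine (hnorm _ _ _).trans ?_
        rw [CStarRing.norm_star_mul_self]
        simp [sq]
      · cases subsingleton_or_nontrivial P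
        · rw [Subsingleton.elim (algebraMap ℝ P ε) 0, norm_zero]; exact hε.le
        · rw [norm_algebraMap', Real.norm_of_nonneg hε.le]
    _ = (‖c‖ * M) ^ 2 + ε := by ring

/-- Multiplicative maps on the algebraic tensor square extend to the completion. -/
lemma StarBilin.HalfFlip.exists_extension [Nontrivial D] (hρ : ρ.HalfFlip)
    (hmul : ∀ c c' s t, G c s * G c' t = G (c * c') (s * t))
    (hstar : ∀ c s, star (G c s) = G (star c) (star s))
    (hnorm : ∀ c x y, ‖G c (x ⊗ₜ y)‖ ≤ ‖c‖ * (‖x‖ * ‖y‖)) :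
    ∃ F : StarBilin C T P, ∀ c t, F c (ρ.alg t) = G c t := by
  have hb := hρ.norm_le_mul_norm_alg G hmul hstar hnorm
  let F₀ : C → T →L[ℂ] P := fun c => (G c).extendOfNorm ρ.alg
  have hF : ∀ c t, F₀ c (ρ.alg t) = G c t := fun c t =>
    LinearMap.extendOfNorm_eq hρ.dense ⟨‖c‖, hb c⟩ t
  refine ⟨⟨{ toFun := fun c => F₀ c, map_add' := fun c c' => ?_, map_smul' := fun a c => ?_ },
    fun c c' s t => ?_, fun c t => ?_⟩, hF⟩
  · ext t
    refine hρ.dense.induction_on (p := fun t => F₀ (c + c') t = F₀ c t + F₀ c' t) t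
      (isClosed_eq (by fun_prop) (by fun_prop)) fun t => by simp [hF]
  · ext t
    refine hρ.dense.induction_on (p := fun t => F₀ (a • c) t = a • F₀ c t) t
      (isClosed_eq (by fun_prop) (by fun_prop)) fun t => by simp [hF]
  · refine hρ.dense.induction_on₂ (p := fun s t => F₀ c s * F₀ c' t = F₀ (c * c') (s * t))
      (isClosed_eq (by fun_prop) (by fun_prop)) (fun s t => ?_) s t
    rw [← ρ.alg_mul, hF, hF, hF, hmul]
  · refine hρ.dense.induction_on (p := fun t => star (F₀ c t) = F₀ (star c) (star t)) t
      (isClosed_eq (by fun_prop) (by fun_prop)) fun t => ?_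
    rw [← ρ.alg_star, hF, hF, hstar]

end Bound

end Nuclearity

section QuasiCentral

lemma exists_filter_of_forall_finset {α I : Type*} (p : α → Prop) (f : I → α → ℝ)
    (hf : ∀ i a, 0 ≤ f i a)
    (h : ∀ (S : Finset I) (ε : ℝ), 0 < ε → ∃ a, p a ∧ ∀ i ∈ S, f i a ≤ ε) :
    ∃ l : Filter α, l.NeBot ∧ (∀ᶠ a in l, p a) ∧ ∀ i, Tendsto (f i) l (𝓝 0) := by
  classical
  choose a hp ha using fun (k : Finset I × ℕ) => h k.1 (1 / ((k.2 : ℝ) + 1)) (by positivity)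
  refine ⟨map a atTop, inferInstance, eventually_map.2 (Eventually.of_forall hp), fun i => ?_⟩
  rw [tendsto_map'_iff]
  have h1 : Tendsto (fun k : Finset I × ℕ => 1 / ((k.2 : ℝ) + 1)) atTop (𝓝 0) := by
    rw [← prod_atTop_atTop_eq]
    exact tendsto_one_div_add_atTop_nhds_zero_nat.comp tendsto_snd
  refine squeeze_zero' (Eventually.of_forall fun k => hf _ _) ?_ h1
  filter_upwards [eventually_ge_atTop (({i}, 0) : Finset I × ℕ)] with k hk
  exact ha k i (hk.1 (Finset.mem_singleton_self i))

variable {C : Type*} {X : Type*} [NonUnitalCStarAlgebra C] [NonUnitalCStarAlgebra X]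

lemma norm_sq_sum_le_of_almost_orthogonal (N : ℕ) (K : ℕ → X) {ε r : ℝ} (hε : 0 ≤ ε)
    (hr : ∀ k, ‖K k‖ ≤ r) (h : ∀ k l, k < l → ‖star (K l) * K k‖ ≤ ε) :
    ‖∑ k ∈ Finset.range N, K k‖ ^ 2 ≤ N * r ^ 2 + N ^ 2 * ε := by
  have h' : ∀ k l, ‖star (K l) * K k‖ ≤ ε + if k = l then r ^ 2 else 0 := by
    intro k l
    rcases lt_trichotomy k l with hkl | rfl | hkl
    · simpa [hkl.ne] using h k l hkl
    · rw [CStarRing.norm_star_mul_self, if_pos rfl, ← sq]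
      have := pow_le_pow_left₀ (norm_nonneg _) (hr k) 2
      linarith
    · rw [← norm_star, star_mul, star_star]
      simpa [hkl.ne'] using h l k hkl
  rw [sq, ← CStarRing.norm_star_mul_self, star_sum, Finset.sum_mul_sum]
  calc _ ≤ ∑ l ∈ Finset.range N, ∑ k ∈ Finset.range N, (ε + if k = l then r ^ 2 else 0) :=
        norm_sum_le_of_le _ fun l _ => norm_sum_le_of_le _ fun k _ => h' k l
    _ ≤ ∑ l ∈ Finset.range N, (N * ε + r ^ 2) := by
        refine Finset.sum_le_sum fun l hl => ?_
        rw [Finset.sum_add_distrib, Finset.sum_ite_eq' , if_pos hl]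
        simp
    _ = _ := by simp; ring

lemma exists_quasicentral_finset [PartialOrder C] [StarOrderedRing C] (ι : C →⋆ₙₐ[ℂ] X)
    (hι : ∀ x c, x * ι c ∈ Set.range ι) (σ : C →⋆ₙₐ[ℂ] C)
    (hσ : ∀ s, Tendsto (fun c => σ c * s) (CStarAlgebra.approximateUnit C) (𝓝 s))
    (S : Finset C) (F : Finset X) {ε : ℝ} (hε : 0 < ε) :
    ∃ c, (0 ≤ c ∧ ‖c‖ ≤ 1) ∧ (∀ s ∈ S, ‖c * s - s‖ ≤ ε) ∧ (∀ s ∈ S, ‖σ c * s - s‖ ≤ ε) ∧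
      ∀ x ∈ F, ‖ι (σ c) * x - x * ι (σ c)‖ ≤ ε := by
  classical
  have hl := CStarAlgebra.increasingApproximateUnit C
  have _ := hl.toIsApproximateUnit.neBot
  set l := CStarAlgebra.approximateUnit C
  have hιc : Continuous ι := AddMonoidHomClass.continuous_of_bound ι 1 fun x => by
    simpa using NonUnitalStarAlgHom.norm_apply_le ι x
  have hιr : ∀ x c, ι c * x ∈ Set.range ι := fun x c => by
    obtain ⟨c', hc'⟩ := hι (star x) (star c)
    exact ⟨star c', by rw [map_star, hc', star_mul, star_star, map_star, star_star]⟩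
  have hιunit : ∀ y ∈ Set.range ι, Tendsto (fun c => ι (σ c) * y) l (𝓝 y) := by
    rintro _ ⟨s, rfl⟩
    simp only [← map_mul]
    exact (hιc.tendsto _).comp (hσ s)
  let K : C → X → X := fun c x => ι (σ c) * x - x * ι (σ c)
  have hKr : ∀ c x, K c x ∈ Set.range ι := fun c x => by
    obtain ⟨a, ha⟩ := hιr x (σ c)
    obtain ⟨b, hb⟩ := hι x (σ c)
    exact ⟨a - b, by rw [map_sub, ha, hb]⟩
  have hK2 : ∀ c x, Tendsto (fun c' => star (K c' x) * K c x) l (𝓝 0) := fun c x => by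
    have h1 : Tendsto (fun c' => star x * (ι (σ c') * K c x) - ι (σ c') * (star x * K c x)) l
        (𝓝 (star x * K c x - star x * K c x)) :=
      ((hιunit _ (hKr c x)).const_mul _).sub (hιunit _ (by
        obtain ⟨a, ha⟩ := hKr c x
        rw [← ha]; exact hι _ _))
    rw [sub_self] at h1
    refine h1.congr' ?_
    filter_upwards [hl.eventually_star_eq] with c' hc'
    simp only [K, star_sub, star_mul, ← map_star, hc', sub_mul, mul_assoc]
  set B : ℝ := 1 + ∑ x ∈ F, ‖x‖ with hB
  have hBpos : 0 < B := by positivity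
  have hxB : ∀ x ∈ F, ‖x‖ ≤ B := fun x hx => by
    have := Finset.single_le_sum (f := fun d : X => ‖d‖) (fun _ _ => norm_nonneg _) hx
    linarith
  obtain ⟨c, hc, hcr⟩ := exists_seq_of_forall_finset_exists
    (fun c : C => (0 ≤ c ∧ ‖c‖ ≤ 1) ∧ (∀ s ∈ S, ‖c * s - s‖ ≤ ε) ∧ (∀ s ∈ S, ‖σ c * s - s‖ ≤ ε))
    (fun c c' => ∀ x ∈ F, ‖star (K c' x) * K c x‖ ≤ ε ^ 2 / 2) (fun s _ => by
      have e1 : ∀ᶠ c in l, ∀ s ∈ S, ‖c * s - s‖ ≤ ε :=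
        (Filter.eventually_all_finset S).2 fun s _ => by
          have := (tendsto_iff_norm_sub_tendsto_zero.1 (hl.tendsto_mul_right s))
          exact this.eventually_le_const hε
      have e2 : ∀ᶠ c in l, ∀ s ∈ S, ‖σ c * s - s‖ ≤ ε :=
        (Filter.eventually_all_finset S).2 fun s _ => by
          have := (tendsto_iff_norm_sub_tendsto_zero.1 (hσ s))
          exact this.eventually_le_const hε
      have e3 : ∀ᶠ c' in l, ∀ c ∈ s, ∀ x ∈ F, ‖star (K c' x) * K c x‖ ≤ ε ^ 2 / 2 :=
        (Filter.eventually_all_finset s).2 fun c _ => (Filter.eventually_all_finset F).2 fun x _ =>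
          (tendsto_zero_iff_norm_tendsto_zero.1 (hK2 c x)).eventually_le_const (by positivity)
      obtain ⟨c', h⟩ := (hl.eventually_nonneg.and (hl.eventually_norm.and
        (e1.and (e2.and e3)))).exists
      exact ⟨c', ⟨⟨h.1, h.2.1⟩, h.2.2.1, h.2.2.2.1⟩, h.2.2.2.2⟩)
  obtain ⟨N, hN⟩ := exists_nat_gt (2 * (2 * B) ^ 2 / ε ^ 2)
  have hNpos : (0 : ℝ) < N := lt_trans (by positivity) hN
  have hcard : (N : ℝ) * (N : ℝ)⁻¹ = 1 := mul_inv_cancel₀ hNpos.ne'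
  have havg : ∀ {Y : Type _} [NonUnitalCStarAlgebra Y] (g : C → Y) (y : Y) (δ : ℝ),
      (∀ n, ‖g (c n) - y‖ ≤ δ) →
      ‖((N : ℂ)⁻¹ • ∑ n ∈ Finset.range N, g (c n)) - y‖ ≤ δ := by
    intro Y _ g y δ h
    have : ((N : ℂ)⁻¹ • ∑ n ∈ Finset.range N, g (c n)) - y =
        (N : ℂ)⁻¹ • ∑ n ∈ Finset.range N, (g (c n) - y) := by
      rw [Finset.sum_sub_distrib, smul_sub]
      congr 1
      rw [Finset.sum_const, Finset.card_range, ← Nat.cast_smul_eq_nsmul ℂ, smul_smul,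
        inv_mul_cancel₀ (by exact_mod_cast hNpos.ne'), one_smul]
    rw [this, norm_smul, norm_inv, Complex.norm_natCast]
    calc _ ≤ (N : ℝ)⁻¹ * (N * δ) := by
          gcongr
          refine (norm_sum_le_of_le _ fun n _ => h n).trans ?_
          simp
      _ = δ := by rw [← mul_assoc, inv_mul_cancel₀ hNpos.ne', one_mul]
  refine ⟨(N : ℂ)⁻¹ • ∑ n ∈ Finset.range N, c n, ⟨?_, ?_⟩, fun s hs => ?_, fun s hs => ?_,
    fun x hx => ?_⟩
  · have : (N : ℂ)⁻¹ • ∑ n ∈ Finset.range N, c n = (N : ℝ)⁻¹ • ∑ n ∈ Finset.range N, c n := by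
      rw [← Complex.coe_smul]; simp
    rw [this]
    exact smul_nonneg (by positivity) (Finset.sum_nonneg fun n _ => (hc n).1.1)
  · simpa using havg (fun c => c) 0 1 fun n => by simpa using (hc n).1.2
  · rw [smul_mul_assoc, Finset.sum_mul]
    exact havg (fun c => c * s) s ε fun n => (hc n).2.1 s hs
  · rw [map_smul, map_sum, smul_mul_assoc, Finset.sum_mul]
    exact havg (fun c => σ c * s) s ε fun n => (hc n).2.2 s hs
  · have e1 : ι (σ ((N : ℂ)⁻¹ • ∑ n ∈ Finset.range N, c n)) * x -
        x * ι (σ ((N : ℂ)⁻¹ • ∑ n ∈ Finset.range N, c n)) =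
        (N : ℂ)⁻¹ • ∑ n ∈ Finset.range N, K (c n) x := by
      simp only [map_smul, map_sum, smul_mul_assoc, mul_smul_comm, Finset.sum_mul, Finset.mul_sum,
        K, Finset.sum_sub_distrib, smul_sub]
    have hKn : ∀ n, ‖K (c n) x‖ ≤ 2 * B := fun n => by
      have h1 : ‖ι (σ (c n))‖ ≤ 1 := (NonUnitalStarAlgHom.norm_apply_le ι _).trans
        ((NonUnitalStarAlgHom.norm_apply_le σ _).trans (hc n).1.2)
      calc ‖K (c n) x‖ ≤ ‖ι (σ (c n))‖ * ‖x‖ + ‖x‖ * ‖ι (σ (c n))‖ :=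
            (norm_sub_le _ _).trans (add_le_add (norm_mul_le _ _) (norm_mul_le _ _))
        _ ≤ 1 * B + B * 1 := by gcongr <;> exact hxB x hx
        _ = 2 * B := by ring
    have h2 := norm_sq_sum_le_of_almost_orthogonal N (fun n => K (c n) x) (by positivity) hKn
      fun k l hkl => hcr k l hkl x hx
    rw [e1, norm_smul, norm_inv, Complex.norm_natCast]
    refine abs_le_of_sq_le_sq' ?_ hε.le |>.2
    rw [div_lt_iff₀ (by positivity)] at hN
    rw [mul_pow, inv_pow, inv_mul_le_iff₀ (by positivity)]
    nlinarith

/-- Existence of quasi-central approximate units. -/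
lemma exists_quasicentral [PartialOrder C] [StarOrderedRing C] (ι : C →⋆ₙₐ[ℂ] X)
    (hι : ∀ x c, x * ι c ∈ Set.range ι) (σ : C →⋆ₙₐ[ℂ] C)
    (hσ : ∀ s, Tendsto (fun c => σ c * s) (CStarAlgebra.approximateUnit C) (𝓝 s)) :
    ∃ l : Filter C, l.NeBot ∧ (∀ᶠ c in l, 0 ≤ c ∧ ‖c‖ ≤ 1) ∧
      (∀ s, Tendsto (fun c => c * s) l (𝓝 s)) ∧ (∀ s, Tendsto (fun c => σ c * s) l (𝓝 s)) ∧
      ∀ x, Tendsto (fun c => ι (σ c) * x - x * ι (σ c)) l (𝓝 0) := by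
  classical
  obtain ⟨l, hl, h1, h2⟩ := exists_filter_of_forall_finset (I := C ⊕ X)
    (fun c : C => 0 ≤ c ∧ ‖c‖ ≤ 1)
    (fun i c => i.elim (fun s => ‖c * s - s‖ + ‖σ c * s - s‖)
      fun x => ‖ι (σ c) * x - x * ι (σ c)‖)
    (fun i c => by cases i <;> simp only [Sum.elim_inl, Sum.elim_inr] <;> positivity)
    (fun S ε hε => by
      obtain ⟨c, h1, h2, h3, h4⟩ := exists_quasicentral_finset ι hι σ hσ
        (S.toLeft) (S.toRight) (half_pos hε)
      refine ⟨c, h1, ?_⟩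
      rintro (s | x) hi
      · have hs := Finset.mem_toLeft.2 hi
        simp only [Sum.elim_inl]
        linarith [h2 s hs, h3 s hs]
      · simp only [Sum.elim_inr]
        linarith [h4 x (Finset.mem_toRight.2 hi)])
  refine ⟨l, hl, h1, fun s => ?_, fun s => ?_, fun x => ?_⟩
  · refine tendsto_iff_norm_sub_tendsto_zero.2 (squeeze_zero (fun _ => norm_nonneg _) (fun c => ?_)
      (h2 (Sum.inl s)))
    simp
  · refine tendsto_iff_norm_sub_tendsto_zero.2 (squeeze_zero (fun _ => norm_nonneg _) (fun c => ?_)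
      (h2 (Sum.inl s)))
    simp
  · exact tendsto_zero_iff_norm_tendsto_zero.2 (h2 (Sum.inr x))

end QuasiCentral

section ExpConj

variable {P : Type*} [CStarAlgebra P]

lemma selfAdjoint.expUnitary_smul_coe (H : selfAdjoint P) (s : ℝ) :
    (selfAdjoint.expUnitary (s • H) : P) = NormedSpace.exp (s • (Complex.I • (H : P))) := by
  rw [selfAdjoint.expUnitary_coe, selfAdjoint.val_smul, smul_comm]

lemma hasDerivAt_expUnitary_smul (H : selfAdjoint P) (s : ℝ) :
    HasDerivAt (fun s : ℝ => (selfAdjoint.expUnitary (s • H) : P))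
      (selfAdjoint.expUnitary (s • H) * (Complex.I • (H : P))) s := by
  simp only [selfAdjoint.expUnitary_smul_coe]
  exact hasDerivAt_exp_smul_const (Complex.I • (H : P)) s

lemma hasDerivAt_expUnitary_smul' (H : selfAdjoint P) (s : ℝ) :
    HasDerivAt (fun s : ℝ => (selfAdjoint.expUnitary (s • H) : P))
      ((Complex.I • (H : P)) * selfAdjoint.expUnitary (s • H)) s := by
  simp only [selfAdjoint.expUnitary_smul_coe]
  exact hasDerivAt_exp_smul_const' (Complex.I • (H : P)) s

lemma hasDerivAt_star_expUnitary_smul (H : selfAdjoint P) (s : ℝ) :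
    HasDerivAt (fun s : ℝ => star (selfAdjoint.expUnitary (s • H) : P))
      (-(star (selfAdjoint.expUnitary (s • H) : P) * (Complex.I • (H : P)))) s := by
  have := (hasDerivAt_expUnitary_smul' H s).star
  simpa [star_mul, H.2.star_eq] using this

lemma hasDerivAt_star_expUnitary_smul' (H : selfAdjoint P) (s : ℝ) :
    HasDerivAt (fun s : ℝ => star (selfAdjoint.expUnitary (s • H) : P))
      (-((Complex.I • (H : P)) * star (selfAdjoint.expUnitary (s • H) : P))) s := by
  have := (hasDerivAt_expUnitary_smul H s).star
  simpa [star_mul, H.2.star_eq] using this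

/-- A path almost following the flow generated by `H` ends near the conjugate of its start. -/
lemma norm_sub_expUnitary_conj_le (H : selfAdjoint P) (f f' : ℝ → P)
    (hf : ∀ s, HasDerivAt f (f' s) s) {B : ℝ}
    (hB : ∀ s, ‖f' s - Complex.I • ((H : P) * f s - f s * H)‖ ≤ B) :
    ‖f 1 - selfAdjoint.expUnitary H * f 0 * star (selfAdjoint.expUnitary H : P)‖ ≤ B := by
  set u : ℝ → unitary P := fun s => selfAdjoint.expUnitary (s • H) with hu
  have h := norm_image_sub_le_of_norm_deriv_le_segment_01' (E := P)
    (f := fun s => star (u s : P) * f s * u s)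
    (f' := fun s => star (u s : P) * (f' s - Complex.I • ((H : P) * f s - f s * H)) * u s)
    (C := B) (fun s _ => by
      refine HasDerivAt.hasDerivWithinAt ?_
      refine (((hasDerivAt_star_expUnitary_smul H s).mul (hf s)).mul
        (hasDerivAt_expUnitary_smul' H s)).congr_deriv ?_
      simp only [hu, Pi.mul_apply, mul_sub, sub_mul, smul_sub, neg_mul, mul_smul_comm,
        smul_mul_assoc, mul_assoc, add_mul]
      abel) (fun s _ => by
      have := norm_unitary_conj (star (u s))
        (f' s - Complex.I • ((H : P) * f s - f s * H))
      rw [Unitary.coe_star, star_star] at this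
      rw [this]
      exact hB s)
  have h1 : u 1 = selfAdjoint.expUnitary H := by simp [hu]
  have h0 : u 0 = 1 := by simp [hu]
  simp only [h1, h0] at h
  rw [← norm_unitary_conj (selfAdjoint.expUnitary H)] at h
  convert h using 2
  have h2 := Unitary.mul_star_self_of_mem (selfAdjoint.expUnitary H).2
  set w : P := (selfAdjoint.expUnitary H : P)
  calc _ = (w * star w) * f 1 * (w * star w) - w * f 0 * star w := by rw [h2]; simp
    _ = _ := by simp only [OneMemClass.coe_one, star_one]; noncomm_ring

lemma norm_expUnitary_conj_sub_le (H : selfAdjoint P) (x : P) :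
    ‖selfAdjoint.expUnitary H * x * star (selfAdjoint.expUnitary H : P) - x‖ ≤
      ‖(H : P) * x - x * H‖ := by
  rw [norm_sub_rev]
  exact norm_sub_expUnitary_conj_le H (fun _ => x) (fun _ => 0) (fun s => hasDerivAt_const s x)
    (fun s => by simp [norm_smul])

/-- The product of the exponentials of a list of self-adjoint elements. -/
def expProd (L : List (selfAdjoint P)) : unitary P := (L.map selfAdjoint.expUnitary).prod

@[simp] lemma expProd_nil : expProd ([] : List (selfAdjoint P)) = 1 := rfl

@[simp] lemma expProd_cons (H : selfAdjoint P) (L : List (selfAdjoint P)) :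
    expProd (H :: L) = selfAdjoint.expUnitary H * expProd L := by simp [expProd]

/-- The total size of the commutators of a list of self-adjoint elements with `x`. -/
def commSum (L : List (selfAdjoint P)) (x : P) : ℝ :=
  (L.map fun H : selfAdjoint P => ‖(H : P) * x - x * H‖).sum

@[simp] lemma commSum_nil (x : P) : commSum [] x = 0 := rfl

@[simp] lemma commSum_cons (H : selfAdjoint P) (L : List (selfAdjoint P)) (x : P) :
    commSum (H :: L) x = ‖(H : P) * x - x * H‖ + commSum L x := by simp [commSum]

lemma norm_expProd_conj_sub_le (L : List (selfAdjoint P)) (x : P) :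
    ‖expProd L * x * star (expProd L : P) - x‖ ≤ commSum L x := by
  induction L with
  | nil => simp
  | cons H L ih =>
    have e : (expProd (H :: L) : P) * x * star (expProd (H :: L) : P) - x =
        selfAdjoint.expUnitary H * (expProd L * x * star (expProd L : P) - x) *
          star (selfAdjoint.expUnitary H : P) +
        (selfAdjoint.expUnitary H * x * star (selfAdjoint.expUnitary H : P) - x) := by
      simp only [expProd_cons, Submonoid.coe_mul, star_mul]; noncomm_ring
    rw [e, commSum_cons]
    refine (norm_add_le _ _).trans ?_
    rw [norm_unitary_conj, add_comm]
    exact add_le_add (norm_expUnitary_conj_sub_le H x) ih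

variable {C T : Type*} [NonUnitalCStarAlgebra C] [CStarAlgebra T]

lemma StarBilin.norm_expUnitary_conj_sub_le (F : StarBilin C T P) (c₀ c₁ : C) (k : selfAdjoint T)
    (hH : IsSelfAdjoint (F c₀ k)) (t : T) :
    ‖selfAdjoint.expUnitary ⟨F c₀ k, hH⟩ * F c₁ t *
        star (selfAdjoint.expUnitary ⟨F c₀ k, hH⟩ : P) -
      F c₁ (selfAdjoint.expUnitary k * t * star (selfAdjoint.expUnitary k : T))‖ ≤
      (‖c₁ - c₀ * c₁‖ + ‖c₁ - c₁ * c₀‖) * ‖(k : T)‖ * ‖t‖ := by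
  set u : ℝ → unitary T := fun s => selfAdjoint.expUnitary (s • k) with hu
  set τ : ℝ → T := fun s => u s * t * star (u s : T) with hτ
  have hτd : ∀ s, HasDerivAt τ (Complex.I • ((k : T) * τ s - τ s * k)) s := fun s => by
    refine (((hasDerivAt_expUnitary_smul' k s).mul (hasDerivAt_const s t)).mul
      (hasDerivAt_star_expUnitary_smul' k s)).congr_deriv ?_
    have hc : (selfAdjoint.expUnitary (s • k) : T) * (Complex.I • (k : T)) =
        (Complex.I • (k : T)) * selfAdjoint.expUnitary (s • k) :=
      (hasDerivAt_expUnitary_smul k s).unique (hasDerivAt_expUnitary_smul' k s)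
    have hc' : (star (selfAdjoint.expUnitary (s • k) : T)) * (Complex.I • (k : T)) =
        (Complex.I • (k : T)) * star (selfAdjoint.expUnitary (s • k) : T) := by
      have := (hasDerivAt_star_expUnitary_smul k s).unique (hasDerivAt_star_expUnitary_smul' k s)
      exact neg_injective this
    rw [← hc']
    simp only [hτ, hu, Pi.mul_apply, smul_sub, mul_zero, add_zero, mul_neg, mul_smul_comm, smul_mul_assoc,
      mul_assoc]
    abel
  have hτn : ∀ s, ‖τ s‖ = ‖t‖ := fun s => norm_unitary_conj (u s) t
  have h1 : u 1 = selfAdjoint.expUnitary k := by simp [hu]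
  have h0 : u 0 = 1 := by simp [hu]
  let Φ : T →L[ℂ] P := (F c₁).mkContinuous ‖c₁‖ (F.norm_le c₁)
  have hΦ : ∀ t, Φ t = F c₁ t := fun _ => rfl
  rw [norm_sub_rev]
  have := norm_sub_expUnitary_conj_le ⟨F c₀ k, hH⟩ (fun s => Φ (τ s))
    (fun s => Φ (Complex.I • ((k : T) * τ s - τ s * k)))
    (fun s => (Φ.restrictScalars ℝ).hasFDerivAt.comp_hasDerivAt s (hτd s))
    (B := (‖c₁ - c₀ * c₁‖ + ‖c₁ - c₁ * c₀‖) * ‖(k : T)‖ * ‖t‖) (fun s => by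
      have e : Φ (Complex.I • ((k : T) * τ s - τ s * k)) -
          Complex.I • (F c₀ k * Φ (τ s) - Φ (τ s) * F c₀ k) =
          Complex.I • (F (c₁ - c₀ * c₁) (k * τ s) - F (c₁ - c₁ * c₀) (τ s * k)) := by
        rw [map_smul, ← smul_sub, hΦ, hΦ, F.mul_map, F.mul_map]
        simp only [map_sub, LinearMap.sub_apply]
        congr 1
        abel
      change ‖Φ (Complex.I • ((k : T) * τ s - τ s * k)) -
          Complex.I • (F c₀ k * Φ (τ s) - Φ (τ s) * F c₀ k)‖ ≤ _
      rw [e, norm_smul, Complex.norm_I, one_mul]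
      refine (norm_sub_le _ _).trans ?_
      rw [add_mul, add_mul]
      refine add_le_add ?_ ?_
      · refine (F.norm_le _ _).trans ?_
        rw [mul_assoc, ← hτn s]
        exact mul_le_mul_of_nonneg_left (norm_mul_le _ _) (norm_nonneg _)
      · refine (F.norm_le _ _).trans ?_
        refine (mul_le_mul_of_nonneg_left (norm_mul_le _ _) (norm_nonneg _)).trans_eq ?_
        rw [hτn s]
        ring)
  simpa [hτ, h1, h0, hΦ] using this

lemma StarBilin.norm_expProd_conj_sub_le (F : StarBilin C T P) (c₀ c₁ : C) (hc₀ : IsSelfAdjoint c₀)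
    (L : List (selfAdjoint T)) (t : T) :
    ‖(expProd (L.map fun k : selfAdjoint T =>
        (⟨F c₀ k, F.isSelfAdjoint hc₀ k.2⟩ : selfAdjoint P)) : P) * F c₁ t *
        star (expProd (L.map fun k : selfAdjoint T =>
        (⟨F c₀ k, F.isSelfAdjoint hc₀ k.2⟩ : selfAdjoint P)) : P) -
      F c₁ (expProd L * t * star (expProd L : T))‖ ≤
      (‖c₁ - c₀ * c₁‖ + ‖c₁ - c₁ * c₀‖) * (L.map fun k : selfAdjoint T => ‖(k : T)‖).sum * ‖t‖ := by
  induction L with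
  | nil => simp
  | cons k L ih =>
    simp only [List.map_cons, expProd_cons, List.sum_cons, Submonoid.coe_mul, star_mul]
    set U : P := (selfAdjoint.expUnitary (⟨F c₀ k, F.isSelfAdjoint hc₀ k.2⟩ : selfAdjoint P) : P)
      with hU
    set W : P := (expProd (L.map fun k : selfAdjoint T =>
        (⟨F c₀ k, F.isSelfAdjoint hc₀ k.2⟩ : selfAdjoint P)) : P)
    set t' : T := expProd L * t * star (expProd L : T) with ht'
    have h1 := F.norm_expUnitary_conj_sub_le c₀ c₁ k (F.isSelfAdjoint hc₀ k.2) t'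
    have ht'n : ‖t'‖ = ‖t‖ := norm_unitary_conj _ _
    have e : U * W * F c₁ t * (star W * star U) -
        F c₁ (selfAdjoint.expUnitary k * expProd L * t * (star (expProd L : T) *
          star (selfAdjoint.expUnitary k : T))) =
        U * (W * F c₁ t * star W - F c₁ t') * star U +
        (U * F c₁ t' * star U -
          F c₁ (selfAdjoint.expUnitary k * t' * star (selfAdjoint.expUnitary k : T))) := by
      have : (selfAdjoint.expUnitary k : T) * expProd L * t * (star (expProd L : T) *
          star (selfAdjoint.expUnitary k : T)) =
          selfAdjoint.expUnitary k * t' * star (selfAdjoint.expUnitary k : T) := by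
        rw [ht']; noncomm_ring
      rw [this]; noncomm_ring
    rw [e]
    refine (norm_add_le _ _).trans ?_
    rw [hU, norm_unitary_conj, ← hU]
    rw [ht'n] at h1
    calc _ ≤ _ := add_le_add ih h1
      _ = _ := by ring

end ExpConj

section LocalFlip

/-- Pointwise convergence to zero of uniformly bounded linear maps extends to closed spans. -/
lemma tendsto_zero_of_mem_closure_span {α V W : Type*} [SeminormedAddCommGroup V]
    [NormedSpace ℂ V] [SeminormedAddCommGroup W] [NormedSpace ℂ W] {l : Filter α}
    (f : α → V →ₗ[ℂ] W) {B : ℝ} (hf : ∀ᶠ a in l, ∀ v, ‖f a v‖ ≤ B * ‖v‖) {s : Set V}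
    (hs : ∀ v ∈ s, Tendsto (fun a => f a v) l (𝓝 0)) {v : V}
    (hv : v ∈ closure (Submodule.span ℂ s : Set V)) : Tendsto (fun a => f a v) l (𝓝 0) := by
  have hspan : ∀ v ∈ Submodule.span ℂ s, Tendsto (fun a => f a v) l (𝓝 0) := fun v hv => by
    induction hv using Submodule.span_induction with
    | mem v hv => exact hs v hv
    | zero => simpa using tendsto_const_nhds
    | add v w _ _ hv hw => simpa using hv.add hw
    | smul c v _ hv => simpa using hv.const_smul c
  rw [Metric.tendsto_nhds]
  intro ε hε
  obtain ⟨w, hw, hvw⟩ := Metric.mem_closure_iff.1 hv (ε / (2 * (|B| + 1))) (by positivity)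
  filter_upwards [hf, Metric.tendsto_nhds.1 (hspan w hw) (ε / 2) (by positivity)] with a h1 h2
  rw [dist_zero_right] at h2 ⊢
  rw [dist_eq_norm, lt_div_iff₀ (by positivity)] at hvw
  have h3 : ‖f a (v - w)‖ ≤ (|B| + 1) * ‖v - w‖ :=
    (h1 _).trans (by gcongr; linarith [le_abs_self B])
  have h4 : ‖f a v‖ ≤ ‖f a (v - w)‖ + ‖f a w‖ := by
    rw [map_sub]
    exact norm_le_norm_sub_add _ _
  linarith

variable {X C P : Type*} {D T : Type*} [NonUnitalCStarAlgebra X] [NonUnitalCStarAlgebra C]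
  [CStarAlgebra P] [CStarAlgebra D] [CStarAlgebra T] [Nontrivial D]
  {ρ : StarBilin D D T} (ι : C →⋆ₙₐ[ℂ] X) (γ : StarBilin C D C) (m : StarBilin X D P)

/-- A homomorphism placing the two legs of a tensor square in a multiplier position of `C` and
in the second factor of `m`. -/
lemma StarBilin.HalfFlip.exists_amplification (hρ : ρ.HalfFlip) (ψ : D →⋆ₐ[ℂ] D) :
    ∃ F : StarBilin C T P, ∀ c x y, F c (ρ x y) = m (ι (γ c (ψ x))) y := by
  let G : C →ₗ[ℂ] (D ⊗[ℂ] D) →ₗ[ℂ] P :=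
    { toFun := fun c => TensorProduct.lift
        ((m.lin ∘ₗ (ι : C →ₗ[ℂ] X)) ∘ₗ (γ c) ∘ₗ (ψ : D →ₗ[ℂ] D))
      map_add' := fun c c' => by ext; simp
      map_smul' := fun a c => by ext; simp }
  have hG : ∀ c x y, G c (x ⊗ₜ y) = m (ι (γ c (ψ x))) y := fun _ _ _ => rfl
  have hψ : ∀ x, ‖ψ x‖ ≤ ‖x‖ := fun x => NonUnitalStarAlgHom.norm_apply_le ψ x
  obtain ⟨F, hF⟩ := hρ.exists_extension G
    (fun c c' s t => by
      induction s with
      | zero => simp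
      | add x y hx hy => rw [add_mul, map_add, map_add, add_mul, hx, hy]
      | tmul a b =>
        induction t with
        | zero => simp
        | add x y hx hy => rw [mul_add, map_add, map_add, mul_add, hx, hy]
        | tmul a' b' => simp [hG, m.mul_map, ← map_mul, γ.mul_map])
    (fun c s => by
      induction s with
      | zero => simp
      | add x y hx hy => rw [star_add, map_add, map_add, star_add, hx, hy]
      | tmul a b => simp [hG, m.star_map, ← map_star, γ.star_map])
    (fun c x y => by
      rw [hG]
      calc _ ≤ ‖ι (γ c (ψ x))‖ * ‖y‖ := m.norm_le _ _
        _ ≤ ‖c‖ * ‖x‖ * ‖y‖ := by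
          gcongr
          refine (NonUnitalStarAlgHom.norm_apply_le ι _).trans ((γ.norm_le _ _).trans ?_)
          gcongr
          exact hψ x
        _ = _ := mul_assoc _ _ _)
  exact ⟨F, fun c x y => by rw [← hG, ← hF, ρ.alg_tmul]⟩

/-- The effect of an amplified half flip on an elementary tensor. -/
lemma StarBilin.norm_amplification_conj_sub_le {ψ : D → D} (F : StarBilin C T P)
    (hF : ∀ c x y, F c (ρ x y) = m (ι (γ c (ψ x))) y) (hψ : ψ 1 = 1) (K : List (selfAdjoint T))
    {c₀ c₁ : C} (hc₀ : IsSelfAdjoint c₀) (hc₁ : ‖c₁‖ ≤ 1) (c : C) (d : D)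
    (hd : ‖ρ 1 d‖ ≤ ‖d‖)
    {L : List (selfAdjoint P)} (hL : L = K.map fun k : selfAdjoint T =>
        (⟨F c₀ k, F.isSelfAdjoint hc₀ k.2⟩ : selfAdjoint P)) :
    ‖expProd L * m (ι c) d * star (expProd L : P) - m (ι (c * γ c₁ (ψ d))) 1‖ ≤
      ‖c - c * γ c₁ 1‖ * ‖d‖ + commSum L (m (ι c) 1) * ‖d‖ +
      ‖c‖ * ((‖c₁ - c₀ * c₁‖ + ‖c₁ - c₁ * c₀‖) *
        (K.map fun k : selfAdjoint T => ‖(k : T)‖).sum * ‖d‖) +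
      ‖c‖ * ‖(expProd K : T) * ρ 1 d * star (expProd K : T) - ρ d 1‖ := by
  have h1 := F.norm_expProd_conj_sub_le c₀ c₁ hc₀ K (ρ 1 d)
  rw [← hL] at h1
  have h2 := _root_.norm_expProd_conj_sub_le L (m (ι c) 1)
  have hWW : star (expProd L : P) * expProd L = 1 := Unitary.star_mul_self_of_mem (expProd L).2
  have h0 := norm_unitary_conj (expProd L) (m (ι (c - c * γ c₁ 1)) d)
  have h3 := norm_unitary_conj (expProd L) (F c₁ (ρ 1 d))
  set W : P := (expProd L : P)
  set w : T := (expProd K : T)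
  have e1 : m (ι c) d = m (ι (c - c * γ c₁ 1)) d + m (ι c) 1 * F c₁ (ρ 1 d) := by
    rw [hF, hψ, m.mul_map, one_mul, ← map_mul ι, map_sub ι, map_sub m.lin]
    simp
  have e2 : m (ι (c * γ c₁ (ψ d))) 1 = m (ι c) 1 * F c₁ (ρ d 1) := by
    rw [hF, m.mul_map, one_mul, ← map_mul ι]
  have e3 : W * m (ι c) d * star W - m (ι (c * γ c₁ (ψ d))) 1 =
      W * m (ι (c - c * γ c₁ 1)) d * star W +
      (W * m (ι c) 1 * star W - m (ι c) 1) * (W * F c₁ (ρ 1 d) * star W) +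
      m (ι c) 1 * (W * F c₁ (ρ 1 d) * star W - F c₁ (w * ρ 1 d * star w)) +
      m (ι c) 1 * F c₁ (w * ρ 1 d * star w - ρ d 1) := by
    rw [e1, e2, map_sub (F c₁)]
    have : W * (m (ι c) 1 * F c₁ (ρ 1 d)) * star W =
        (W * m (ι c) 1 * star W) * (W * F c₁ (ρ 1 d) * star W) := by
      calc _ = W * m (ι c) 1 * 1 * F c₁ (ρ 1 d) * star W := by noncomm_ring
        _ = _ := by rw [← hWW]; noncomm_ring
    rw [mul_add, add_mul, this]
    noncomm_ring
  have hmc : ‖m (ι c) 1‖ ≤ ‖c‖ :=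
    (NonUnitalStarAlgHom.norm_apply_le m.left (ι c)).trans (NonUnitalStarAlgHom.norm_apply_le ι c)
  have hFd : ‖F c₁ (ρ 1 d)‖ ≤ ‖d‖ :=
    (F.norm_le _ _).trans ((mul_le_mul hc₁ hd (norm_nonneg _) zero_le_one).trans_eq (one_mul _))
  rw [e3]
  refine norm_add₄_le.trans ?_
  refine add_le_add (add_le_add (add_le_add ?_ ?_) ?_) ?_
  · rw [h0]
    exact (m.norm_le _ _).trans
      (mul_le_mul_of_nonneg_right (NonUnitalStarAlgHom.norm_apply_le ι _) (norm_nonneg _))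
  · refine (norm_mul_le _ _).trans ?_
    rw [h3]
    exact mul_le_mul h2 hFd (norm_nonneg _) ((norm_nonneg _).trans h2)
  · refine (norm_mul_le _ _).trans (mul_le_mul hmc (h1.trans ?_) (norm_nonneg _) (norm_nonneg _))
    exact mul_le_mul_of_nonneg_left hd (mul_nonneg (by positivity)
      (List.sum_nonneg (by rintro _ hx; obtain ⟨k, _, rfl⟩ := List.mem_map.1 hx; positivity)))
  · refine (norm_mul_le _ _).trans (mul_le_mul hmc ((F.norm_le _ _).trans ?_) (norm_nonneg _)
      (norm_nonneg _))
    exact mul_le_of_le_one_left (norm_nonneg _) hc₁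

end LocalFlip

section LocalFlipCommutator

variable {X C P : Type*} {D T : Type*} [NonUnitalCStarAlgebra X] [NonUnitalCStarAlgebra C]
  [CStarAlgebra P] [CStarAlgebra D] [CStarAlgebra T]
  {ρ : StarBilin D D T} {ι : C →⋆ₙₐ[ℂ] X} {γ : StarBilin C D C} {m : StarBilin X D P}
  {l : Filter (D →⋆ₐ[ℂ] D)}

lemma StarBilin.tendsto_commutator_right [PartialOrder C] [StarOrderedRing C]
    (hγ : Dense (Submodule.span ℂ {c | ∃ a d, γ a d = c} : Set C))
    (hl : ∀ x y, Tendsto (fun ψ : D →⋆ₐ[ℂ] D => ‖ψ x * y - y * ψ x‖) l (𝓝 0)) (d : D) (b : C) :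
    Tendsto (fun p : C × (D →⋆ₐ[ℂ] D) => b * γ p.1 (p.2 d) - γ p.1 (p.2 d) * b)
      (CStarAlgebra.approximateUnit C ×ˢ l) (𝓝 0) := by
  have hau := CStarAlgebra.increasingApproximateUnit C
  have hψ : ∀ (ψ : D →⋆ₐ[ℂ] D), ‖ψ d‖ ≤ ‖d‖ := fun ψ => NonUnitalStarAlgHom.norm_apply_le ψ d
  refine tendsto_zero_of_mem_closure_span (B := 2 * ‖d‖)
    (fun p : C × (D →⋆ₐ[ℂ] D) => LinearMap.mulRight ℂ (γ p.1 (p.2 d)) -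
      LinearMap.mulLeft ℂ (γ p.1 (p.2 d))) ?_ ?_ (hγ b)
  · filter_upwards [tendsto_fst.eventually hau.eventually_norm] with p hp v
    have h1 : ‖γ p.1 (p.2 d)‖ ≤ ‖d‖ :=
      (γ.norm_le _ _).trans ((mul_le_mul hp (hψ _) (norm_nonneg _) zero_le_one).trans_eq
        (one_mul _))
    calc _ ≤ ‖v * γ p.1 (p.2 d)‖ + ‖γ p.1 (p.2 d) * v‖ := norm_sub_le _ _
      _ ≤ ‖v‖ * ‖γ p.1 (p.2 d)‖ + ‖γ p.1 (p.2 d)‖ * ‖v‖ :=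
        add_le_add (norm_mul_le _ _) (norm_mul_le _ _)
      _ ≤ ‖v‖ * ‖d‖ + ‖d‖ * ‖v‖ := by gcongr
      _ = _ := by ring
  · rintro _ ⟨a, d', rfl⟩
    have t1 : Tendsto (fun p : C × (D →⋆ₐ[ℂ] D) => ‖a * p.1 - a‖)
        (CStarAlgebra.approximateUnit C ×ˢ l) (𝓝 0) :=
      tendsto_iff_norm_sub_tendsto_zero.1 ((hau.tendsto_mul_left a).comp tendsto_fst)
    have t2 : Tendsto (fun p : C × (D →⋆ₐ[ℂ] D) => ‖p.1 * a - a‖)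
        (CStarAlgebra.approximateUnit C ×ˢ l) (𝓝 0) :=
      tendsto_iff_norm_sub_tendsto_zero.1 ((hau.tendsto_mul_right a).comp tendsto_fst)
    have t3 : Tendsto (fun p : C × (D →⋆ₐ[ℂ] D) => ‖p.2 d * d' - d' * p.2 d‖)
        (CStarAlgebra.approximateUnit C ×ˢ l) (𝓝 0) := (hl d d').comp tendsto_snd
    refine squeeze_zero_norm (a := fun p : C × (D →⋆ₐ[ℂ] D) => ‖a * p.1 - a‖ * (‖d'‖ * ‖d‖) +
      ‖a‖ * ‖p.2 d * d' - d' * p.2 d‖ + ‖p.1 * a - a‖ * (‖d‖ * ‖d'‖)) (fun p => ?_) ?_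
    · have e : (LinearMap.mulRight ℂ (γ p.1 (p.2 d)) - LinearMap.mulLeft ℂ (γ p.1 (p.2 d)))
          (γ a d') = γ (a * p.1 - a) (d' * p.2 d) - γ a (p.2 d * d' - d' * p.2 d) -
          γ (p.1 * a - a) (p.2 d * d') := by
        simp only [LinearMap.sub_apply, LinearMap.mulRight_apply, LinearMap.mulLeft_apply,
          γ.mul_map, map_sub]
        abel
      rw [e]
      refine (norm_sub_le _ _).trans (add_le_add ((norm_sub_le _ _).trans (add_le_add ?_ ?_)) ?_)
      · refine (γ.norm_le _ _).trans ?_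
        gcongr
        exact (norm_mul_le _ _).trans (by gcongr; exact hψ _)
      · exact γ.norm_le _ _
      · refine (γ.norm_le _ _).trans ?_
        gcongr
        exact (norm_mul_le _ _).trans (by gcongr; exact hψ _)
    · simpa using ((t1.mul_const (‖d'‖ * ‖d‖)).add (t3.const_mul ‖a‖)).add
        (t2.mul_const (‖d‖ * ‖d'‖))

lemma StarBilin.eventually_norm_commutator_le (hι : ∀ x c, x * ι c ∈ Set.range ι)
    (hγ : Dense (Submodule.span ℂ {c | ∃ a d, γ a d = c} : Set C))
    (hl : ∀ x y, Tendsto (fun ψ : D →⋆ₐ[ℂ] D => ‖ψ x * y - y * ψ x‖) l (𝓝 0))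
    (c₀ : C) (x : X) (d : D) {ε : ℝ} (hε : 0 < ε) :
    ∀ᶠ ψ in l, ‖ι (γ c₀ (ψ d)) * x - x * ι (γ c₀ (ψ d))‖ ≤
      ‖ι (γ c₀ 1) * x - x * ι (γ c₀ 1)‖ * ‖d‖ + ε := by
  let _ := CStarAlgebra.spectralOrder C
  have _ := CStarAlgebra.spectralOrderedRing C
  have hau := CStarAlgebra.increasingApproximateUnit C
  have _ := hau.toIsApproximateUnit.neBot
  have hψ : ∀ (ψ : D →⋆ₐ[ℂ] D), ‖ψ d‖ ≤ ‖d‖ := fun ψ => NonUnitalStarAlgHom.norm_apply_le ψ d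
  obtain ⟨b, hb⟩ := hι x (γ c₀ 1)
  have t1 : Tendsto (fun p : C × (D →⋆ₐ[ℂ] D) => ‖c₀ * p.1 - c₀‖)
      (CStarAlgebra.approximateUnit C ×ˢ l) (𝓝 0) :=
    tendsto_iff_norm_sub_tendsto_zero.1 ((hau.tendsto_mul_left c₀).comp tendsto_fst)
  have t2 : Tendsto (fun p : C × (D →⋆ₐ[ℂ] D) => ‖p.1 * c₀ - c₀‖)
      (CStarAlgebra.approximateUnit C ×ˢ l) (𝓝 0) :=
    tendsto_iff_norm_sub_tendsto_zero.1 ((hau.tendsto_mul_right c₀).comp tendsto_fst)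
  have t3 := (StarBilin.tendsto_commutator_right hγ hl d b).norm
  have t4 : Tendsto (fun p : C × (D →⋆ₐ[ℂ] D) => ‖p.1 * c₀ - c₀‖ * ‖d‖ * ‖x‖ +
      ‖b * γ p.1 (p.2 d) - γ p.1 (p.2 d) * b‖ + ‖x‖ * (‖c₀ * p.1 - c₀‖ * ‖d‖))
      (CStarAlgebra.approximateUnit C ×ˢ l) (𝓝 0) := by
    simpa using (((t2.mul_const ‖d‖).mul_const ‖x‖).add t3).add
      ((t1.mul_const ‖d‖).const_mul ‖x‖)
  have key := ((t4.eventually (gt_mem_nhds hε)).and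
    (tendsto_fst.eventually hau.eventually_norm)).curry
  obtain ⟨c, hc⟩ := key.exists
  filter_upwards [hc] with ψ ⟨h1, h2⟩
  have e : ι (γ c₀ (ψ d)) * x - x * ι (γ c₀ (ψ d)) =
      -(ι (γ (c * c₀ - c₀) (ψ d)) * x) +
      ι (γ c (ψ d)) * (ι (γ c₀ 1) * x - x * ι (γ c₀ 1)) -
      ι (b * γ c (ψ d) - γ c (ψ d) * b) + x * ι (γ (c₀ * c - c₀) (ψ d)) := by
    have e1 : ι (γ c (ψ d)) * ι (γ c₀ 1) = ι (γ (c * c₀) (ψ d)) := by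
      rw [← map_mul, γ.mul_map, mul_one]
    have e2 : ι (γ c₀ 1) * ι (γ c (ψ d)) = ι (γ (c₀ * c) (ψ d)) := by
      rw [← map_mul, γ.mul_map, one_mul]
    rw [mul_sub, ← mul_assoc, e1, map_sub ι, map_mul ι, map_mul ι, hb, mul_assoc x, e2]
    simp only [map_sub, LinearMap.sub_apply, sub_mul, mul_sub]
    abel
  have hι1 : ∀ c, ‖ι c‖ ≤ ‖c‖ := fun c => NonUnitalStarAlgHom.norm_apply_le ι c
  have b1 : ‖-(ι (γ (c * c₀ - c₀) (ψ d)) * x)‖ ≤ ‖c * c₀ - c₀‖ * ‖d‖ * ‖x‖ := by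
    rw [norm_neg]
    refine (norm_mul_le _ _).trans ?_
    gcongr
    refine (hι1 _).trans ((γ.norm_le _ _).trans ?_)
    gcongr
    exact hψ ψ
  have b2 : ‖ι (γ c (ψ d)) * (ι (γ c₀ 1) * x - x * ι (γ c₀ 1))‖ ≤
      ‖ι (γ c₀ 1) * x - x * ι (γ c₀ 1)‖ * ‖d‖ := by
    rw [mul_comm _ ‖d‖]
    refine (norm_mul_le _ _).trans ?_
    gcongr
    exact (hι1 _).trans ((γ.norm_le _ _).trans
      ((mul_le_mul h2 (hψ ψ) (norm_nonneg _) zero_le_one).trans_eq (one_mul _)))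
  have b4 : ‖x * ι (γ (c₀ * c - c₀) (ψ d))‖ ≤ ‖x‖ * (‖c₀ * c - c₀‖ * ‖d‖) := by
    refine (norm_mul_le _ _).trans ?_
    gcongr
    refine (hι1 _).trans ((γ.norm_le _ _).trans ?_)
    gcongr
    exact hψ ψ
  rw [e]
  refine (norm_add_le _ _).trans ((add_le_add ((norm_sub_le _ _).trans
    (add_le_add ((norm_add_le _ _).trans (add_le_add b1 b2)) (hι1 _))) b4).trans ?_)
  linarith

/-- Amplified tensors almost commute with the first factor of `m`. -/
lemma StarBilin.exists_eventually_norm_amplification_commutator_le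
    (hι : ∀ x c, x * ι c ∈ Set.range ι)
    (hγ : Dense (Submodule.span ℂ {c | ∃ a d, γ a d = c} : Set C))
    (hl : ∀ x y, Tendsto (fun ψ : D →⋆ₐ[ℂ] D => ‖ψ x * y - y * ψ x‖) l (𝓝 0))
    (F : (D →⋆ₐ[ℂ] D) → StarBilin C T P)
    (hF : ∀ ψ c x y, F ψ c (ρ x y) = m (ι (γ c (ψ x))) y) (t : D ⊗[ℂ] D) :
    ∃ R : ℝ, 0 ≤ R ∧ ∀ (c₀ : C) (x : X) (ε : ℝ), 0 < ε → ∀ᶠ ψ in l,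
      ‖F ψ c₀ (ρ.alg t) * m x 1 - m x 1 * F ψ c₀ (ρ.alg t)‖ ≤
        ‖ι (γ c₀ 1) * x - x * ι (γ c₀ 1)‖ * R + ε := by
  induction t with
  | zero => exact ⟨0, le_rfl, fun c₀ x ε hε => Eventually.of_forall fun ψ => by simp [hε.le]⟩
  | tmul a b =>
    refine ⟨‖a‖ * ‖b‖, by positivity, fun c₀ x ε hε => ?_⟩
    filter_upwards [StarBilin.eventually_norm_commutator_le hι hγ hl c₀ x a
      (ε := ε / (‖b‖ + 1)) (by positivity)] with ψ hψ
    rw [ρ.alg_tmul, hF, m.mul_map, m.mul_map, mul_one, one_mul, ← LinearMap.sub_apply, ← map_sub]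
    refine (m.norm_le _ _).trans ?_
    have : ε / (‖b‖ + 1) * ‖b‖ ≤ ε := by
      rw [div_mul_eq_mul_div, div_le_iff₀ (by positivity)]
      nlinarith [norm_nonneg b]
    nlinarith [mul_le_mul_of_nonneg_right hψ (norm_nonneg b)]
  | add s t hs ht =>
    obtain ⟨R, hR, h1⟩ := hs
    obtain ⟨R', hR', h2⟩ := ht
    refine ⟨R + R', by positivity, fun c₀ x ε hε => ?_⟩
    filter_upwards [h1 c₀ x _ (half_pos hε), h2 c₀ x _ (half_pos hε)] with ψ h1 h2
    have e : F ψ c₀ (ρ.alg (s + t)) * m x 1 - m x 1 * F ψ c₀ (ρ.alg (s + t)) =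
        (F ψ c₀ (ρ.alg s) * m x 1 - m x 1 * F ψ c₀ (ρ.alg s)) +
        (F ψ c₀ (ρ.alg t) * m x 1 - m x 1 * F ψ c₀ (ρ.alg t)) := by
      rw [map_add, map_add, add_mul, mul_add]
      abel
    rw [e]
    refine (norm_add_le _ _).trans ((add_le_add h1 h2).trans_eq ?_)
    ring

lemma StarBilin.HalfFlip.eventually_norm_amplification_commutator_le (hρ : ρ.HalfFlip)
    (hι : ∀ x c, x * ι c ∈ Set.range ι)
    (hγ : Dense (Submodule.span ℂ {c | ∃ a d, γ a d = c} : Set C))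
    (hl : ∀ x y, Tendsto (fun ψ : D →⋆ₐ[ℂ] D => ‖ψ x * y - y * ψ x‖) l (𝓝 0))
    (F : (D →⋆ₐ[ℂ] D) → StarBilin C T P)
    (hF : ∀ ψ c x y, F ψ c (ρ x y) = m (ι (γ c (ψ x))) y) {lc : Filter C}
    (hlc : ∀ᶠ c in lc, ‖c‖ ≤ 1)
    (hlc' : ∀ x, Tendsto (fun c => ι (γ c 1) * x - x * ι (γ c 1)) lc (𝓝 0))
    (k : T) (x : X) {ε : ℝ} (hε : 0 < ε) :
    ∀ᶠ c in lc, ∀ᶠ ψ in l, ‖F ψ c k * m x 1 - m x 1 * F ψ c k‖ ≤ ε := by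
  obtain ⟨t, ht⟩ := hρ.dense.exists_dist_lt k (ε := ε / (6 * (‖x‖ + 1))) (by positivity)
  obtain ⟨R, hR, h⟩ := StarBilin.exists_eventually_norm_amplification_commutator_le hι hγ hl F hF t
  have h3 : Tendsto (fun c => ‖ι (γ c 1) * x - x * ι (γ c 1)‖ * R) lc (𝓝 0) := by
    simpa using (hlc' x).norm.mul_const R
  filter_upwards [hlc, h3.eventually (gt_mem_nhds (show 0 < ε / 3 by positivity))] with c hc h4
  filter_upwards [h c x (ε / 3) (by positivity)] with ψ h5
  have e : F ψ c k * m x 1 - m x 1 * F ψ c k = F ψ c (k - ρ.alg t) * m x 1 -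
      m x 1 * F ψ c (k - ρ.alg t) +
      (F ψ c (ρ.alg t) * m x 1 - m x 1 * F ψ c (ρ.alg t)) := by
    rw [map_sub, sub_mul, mul_sub]
    abel
  have hm : ‖m x 1‖ ≤ ‖x‖ := NonUnitalStarAlgHom.norm_apply_le m.left x
  rw [dist_eq_norm, lt_div_iff₀ (by positivity)] at ht
  have h6 : ‖F ψ c (k - ρ.alg t)‖ ≤ ‖k - ρ.alg t‖ :=
    ((F ψ).norm_le _ _).trans (mul_le_of_le_one_left (norm_nonneg _) hc)
  have h7 : ‖F ψ c (k - ρ.alg t)‖ * ‖m x 1‖ ≤ ‖k - ρ.alg t‖ * (‖x‖ + 1) := by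
    gcongr
    linarith
  rw [e]
  refine (norm_add_le _ _).trans ((add_le_add ((norm_sub_le _ _).trans
    (add_le_add (norm_mul_le _ _) (norm_mul_le _ _))) h5).trans ?_)
  nlinarith

end LocalFlipCommutator

section LocalFlipExists

variable {X C P : Type*} {D T : Type*} [NonUnitalCStarAlgebra X] [NonUnitalCStarAlgebra C]
  [CStarAlgebra P] [CStarAlgebra D] [CStarAlgebra T]
  {ρ : StarBilin D D T} {ι : C →⋆ₙₐ[ℂ] X} {γ : StarBilin C D C}

lemma StarBilin.tendsto_left_mul [PartialOrder C] [StarOrderedRing C]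
    (hγ : Dense (Submodule.span ℂ {c | ∃ a d, γ a d = c} : Set C)) (b : C) :
    Tendsto (fun c => γ.left c * b) (CStarAlgebra.approximateUnit C) (𝓝 b) := by
  have hau := CStarAlgebra.increasingApproximateUnit C
  have := tendsto_zero_of_mem_closure_span (B := 2) (l := CStarAlgebra.approximateUnit C)
    (fun c : C => LinearMap.mulLeft ℂ (γ.left c) - LinearMap.id) ?_ ?_ (hγ b)
  · exact tendsto_sub_nhds_zero_iff.1 this
  · filter_upwards [hau.eventually_norm] with c hc v
    have h1 : ‖γ.left c‖ ≤ 1 := (NonUnitalStarAlgHom.norm_apply_le γ.left c).trans hc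
    calc _ ≤ ‖γ.left c * v‖ + ‖v‖ := norm_sub_le _ _
      _ ≤ ‖γ.left c‖ * ‖v‖ + ‖v‖ := add_le_add_left (norm_mul_le _ _) _
      _ ≤ 1 * ‖v‖ + ‖v‖ := by gcongr
      _ = _ := by ring
  · rintro _ ⟨a, d, rfl⟩
    have t : Tendsto (fun c : C => ‖c * a - a‖ * ‖d‖) (CStarAlgebra.approximateUnit C) (𝓝 0) := by
      simpa using (tendsto_iff_norm_sub_tendsto_zero.1 (hau.tendsto_mul_right a)).mul_const ‖d‖
    refine squeeze_zero_norm (fun c => ?_) t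
    have : (LinearMap.mulLeft ℂ (γ.left c) - (LinearMap.id : C →ₗ[ℂ] C)) (γ a d) = γ (c * a - a) d := by
      simp [γ.mul_map]
    rw [this]
    exact γ.norm_le _ _

lemma commSum_map_le {T : Type*} (K : List T) (f : T → selfAdjoint P) (x : P) {η : ℝ}
    (h : ∀ k ∈ K, ‖(f k : P) * x - x * f k‖ ≤ η) : commSum (K.map f) x ≤ K.length * η := by
  rw [commSum, List.map_map]
  refine (List.sum_le_card_nsmul _ η fun r hr => ?_).trans_eq (by simp)
  obtain ⟨k, hk, rfl⟩ := List.mem_map.1 hr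
  exact h k hk

/-- If `C` is an ideal of `X` and absorbs `D`, then exponentials in `P` rotate
finitely many elements `m (ι c) d` into `m (ι C) 1` while almost commuting with finitely many
elements of `m X 1`. -/
lemma StarBilin.HalfFlip.exists_local [Nontrivial D] (hρ : ρ.HalfFlip)
    (hι : ∀ x c, x * ι c ∈ Set.range ι)
    (hγ : Dense (Submodule.span ℂ {c | ∃ a d, γ a d = c} : Set C)) (m : StarBilin X D P)
    (S : Finset X) (R : Finset (C × D)) {ε : ℝ} (hε : 0 < ε) :
    ∃ L : List (selfAdjoint P), (∀ x ∈ S, commSum L (m x 1) ≤ ε) ∧ ∀ p ∈ R, ∃ c,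
      ‖expProd L * m (ι p.1) p.2 * star (expProd L : P) - m (ι c) 1‖ ≤ ε := by
  classical
  let _ := CStarAlgebra.spectralOrder C
  have _ := CStarAlgebra.spectralOrderedRing C
  have hau := CStarAlgebra.increasingApproximateUnit C
  have _ := hau.toIsApproximateUnit.neBot
  obtain ⟨lψ, _, -, hlψ⟩ := exists_filter_of_forall_finset (α := D →⋆ₐ[ℂ] D) (I := D × D)
    (fun _ => True) (fun i ψ => ‖ψ i.1 * i.2 - i.2 * ψ i.1‖) (fun _ _ => norm_nonneg _)
    (fun S ε hε => by
      obtain ⟨ψ, hψ⟩ := hρ.central (S.image Prod.fst ∪ S.image Prod.snd) ε hε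
      exact ⟨ψ, trivial, fun i hi => hψ _
        (Finset.mem_union_left _ (Finset.mem_image_of_mem _ hi)) _
        (Finset.mem_union_right _ (Finset.mem_image_of_mem _ hi))⟩)
  obtain ⟨lK, _, -, hlK⟩ := exists_filter_of_forall_finset (α := List (selfAdjoint T)) (I := D)
    (fun _ => True)
    (fun d K => ‖(expProd K : T) * ρ 1 d * star (expProd K : T) - ρ d 1‖)
    (fun _ _ => norm_nonneg _)
    (fun S ε hε => (hρ.flip S ε hε).imp fun K hK => ⟨trivial, hK⟩)
  obtain ⟨lc, _, hlc, hlc1, -, hlc2⟩ := exists_quasicentral ι hι γ.left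
    (StarBilin.tendsto_left_mul hγ)
  choose F hF using fun ψ => hρ.exists_amplification ι γ m ψ
  have hε4 : 0 < ε / 4 := by positivity
  obtain ⟨K, hK⟩ : ∃ K : List (selfAdjoint T), ∀ p ∈ R,
      ‖p.1‖ * ‖(expProd K : T) * ρ 1 p.2 * star (expProd K : T) - ρ p.2 1‖ < ε / 4 := by
    refine Eventually.exists (f := lK) ((Filter.eventually_all_finset R).2 fun p _ => ?_)
    have : Tendsto (fun K : List (selfAdjoint T) => ‖p.1‖ *
        ‖(expProd K : T) * ρ 1 p.2 * star (expProd K : T) - ρ p.2 1‖) lK (𝓝 0) := by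
      simpa using (hlK p.2).const_mul ‖p.1‖
    exact this.eventually (gt_mem_nhds hε4)
  obtain ⟨c₁, hc₁, hc₁n, hc₁s⟩ : ∃ c₁ : C, (∀ p ∈ R, ‖p.1 - p.1 * γ c₁ 1‖ * ‖p.2‖ < ε / 4) ∧
      ‖c₁‖ ≤ 1 ∧ star c₁ = c₁ := by
    refine Eventually.exists (f := CStarAlgebra.approximateUnit C)
      (((Filter.eventually_all_finset R).2 fun p _ => ?_).and
        (hau.eventually_norm.and hau.eventually_star_eq))
    have h1 := (StarBilin.tendsto_left_mul hγ (star p.1)).star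
    have h2 : Tendsto (fun c => ‖p.1 - star (γ.left c * star p.1)‖ * ‖p.2‖)
        (CStarAlgebra.approximateUnit C) (𝓝 0) := by
      rw [star_star] at h1
      simpa using (h1.const_sub p.1).norm.mul_const ‖p.2‖
    filter_upwards [h2.eventually (gt_mem_nhds hε4), hau.eventually_star_eq] with c hc hs
    simpa [γ.star_map, hs] using hc
  set N : ℝ := 1 + ∑ p ∈ R, ‖p.2‖ with hN
  have hN0 : 0 < N := by positivity
  have hN1 : ∀ p ∈ R, ‖p.2‖ ≤ N := fun p hp => by
    have := Finset.single_le_sum (f := fun p : C × D => ‖p.2‖) (fun _ _ => norm_nonneg _) hp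
    linarith
  set η : ℝ := min ε (ε / 4 / N) / (K.length + 1) with hη
  have hη0 : 0 < η := by positivity
  have hηK : K.length * η ≤ min ε (ε / 4 / N) := by
    rw [hη, mul_div_assoc', div_le_iff₀ (by positivity)]
    nlinarith [show 0 < min ε (ε / 4 / N) by positivity]
  have hS : ∀ᶠ c in lc, ∀ᶠ ψ in lψ, ∀ k ∈ K.toFinset, ∀ x ∈ S ∪ R.image fun p => ι p.1,
      ‖F ψ c k * m x 1 - m x 1 * F ψ c k‖ ≤ η := by
    simp only [Filter.eventually_all_finset]
    exact fun k _ x _ => hρ.eventually_norm_amplification_commutator_le hι hγ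
      (fun x y => hlψ (x, y)) F hF (hlc.mono fun c hc => hc.2) hlc2 k x hη0
  obtain ⟨c₀, hc₀, hS, hc₀R⟩ : ∃ c₀ : C, (0 ≤ c₀ ∧ ‖c₀‖ ≤ 1) ∧ (∀ᶠ ψ in lψ, ∀ k ∈ K.toFinset,
      ∀ x ∈ S ∪ R.image fun p => ι p.1, ‖F ψ c₀ k * m x 1 - m x 1 * F ψ c₀ k‖ ≤ η) ∧
      ∀ p ∈ R, ‖p.1‖ * ((‖c₁ - c₀ * c₁‖ + ‖c₁ - c₀ * c₁‖) *
        (K.map fun k : selfAdjoint T => ‖(k : T)‖).sum * ‖p.2‖) < ε / 4 := by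
    refine Eventually.exists (f := lc) (hlc.and (hS.and
      ((Filter.eventually_all_finset R).2 fun p _ => ?_)))
    have h1 : Tendsto (fun c => ‖c₁ - c * c₁‖) lc (𝓝 0) := by
      simpa using ((hlc1 c₁).const_sub c₁).norm
    have h2 : Tendsto (fun c => ‖p.1‖ * ((‖c₁ - c * c₁‖ + ‖c₁ - c * c₁‖) *
        (K.map fun k : selfAdjoint T => ‖(k : T)‖).sum * ‖p.2‖)) lc (𝓝 0) := by
      simpa using (((h1.add h1).mul_const (K.map fun k : selfAdjoint T => ‖(k : T)‖).sum).mul_const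
        ‖p.2‖).const_mul ‖p.1‖
    exact h2.eventually (gt_mem_nhds hε4)
  obtain ⟨ψ, hψ⟩ := hS.exists
  have hc₀s : IsSelfAdjoint c₀ := hc₀.1.isSelfAdjoint
  have hcomm : ∀ x ∈ S ∪ R.image fun p => ι p.1, commSum (K.map fun k : selfAdjoint T =>
      (⟨F ψ c₀ k, (F ψ).isSelfAdjoint hc₀s k.2⟩ : selfAdjoint P)) (m x 1) ≤
      min ε (ε / 4 / N) := fun x hx =>
    (commSum_map_le _ _ _ fun k hk => hψ k (List.mem_toFinset.2 hk) x hx).trans hηK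
  refine ⟨_, fun x hx => (hcomm x (Finset.mem_union_left _ hx)).trans (min_le_left _ _),
    fun p hp => ⟨p.1 * γ c₁ (ψ p.2), ?_⟩⟩
  refine (StarBilin.norm_amplification_conj_sub_le ι γ m (F ψ) (hF ψ) (map_one ψ) K hc₀s hc₁n
    p.1 p.2 (by rw [hρ.norm_map, norm_one, one_mul]) rfl).trans ?_
  have h1 := hcomm (ι p.1) (Finset.mem_union_right _ (Finset.mem_image_of_mem _ hp))
  have h2 : min ε (ε / 4 / N) * ‖p.2‖ ≤ ε / 4 := by
    calc _ ≤ (ε / 4 / N) * N := by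
          gcongr
          · exact min_le_right _ _
          · exact hN1 p hp
      _ = _ := by field_simp
  have h3 : ‖c₁ - c₁ * c₀‖ = ‖c₁ - c₀ * c₁‖ := by
    rw [← norm_star (c₁ - c₁ * c₀), star_sub, star_mul, hc₁s, hc₀s.star_eq]
  rw [h3]
  have h4 := hc₀R p hp
  have h5 := hK p hp
  have h6 := hc₁ p hp
  have h7 := (mul_le_mul_of_nonneg_right h1 (norm_nonneg p.2)).trans h2
  linarith

end LocalFlipExists

section CStarQuotient

/-- The quotient of a unital C*-algebra by a closed self-adjoint ideal with an approximate unit. -/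
lemma exists_cstarQuotient {M : Type u} [CStarAlgebra M] (I : Ideal M) [I.IsTwoSided]
    (hc : IsClosed (I : Set M)) (hs : ∀ x ∈ I, star x ∈ I) (l : Filter M) [l.NeBot]
    (hl : ∀ᶠ p in l, p ∈ I ∧ ‖1 - p‖ ≤ 1 ∧ star p = p)
    (hl' : ∀ x ∈ I, Tendsto (fun p => x * (1 - p)) l (𝓝 0)) :
    ∃ (Q : Type u) (_ : CStarAlgebra Q) (π : M →⋆ₐ[ℂ] Q), Function.Surjective π ∧
      (∀ y, π y = 0 ↔ y ∈ I) ∧ (∀ y, Tendsto (fun p => ‖y * (1 - p)‖) l (𝓝 ‖π y‖)) ∧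
      ∀ y r, ‖π y‖ < r → ∃ i ∈ I, ‖y - i‖ < r := by
  have _ : IsClosed (I : Set M) := hc
  let mk : M →+* M ⧸ I := Ideal.Quotient.mk I
  have hmk : Function.Surjective mk := Ideal.Quotient.mk_surjective
  let nacg : NormedAddCommGroup (M ⧸ I) := Submodule.Quotient.normedAddCommGroup I
  have hlt : ∀ y r, ‖mk y‖ < r → ∃ i ∈ I, ‖y - i‖ < r := fun y r hr => by
    obtain ⟨z, hz, hzr⟩ := (QuotientAddGroup.norm_lt_iff (S := I.toAddSubgroup)).1 hr
    refine ⟨y - z, ?_, by simpa using hzr⟩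
    rw [← Ideal.Quotient.eq]
    exact hz.symm
  have hle : ∀ y, ‖mk y‖ ≤ ‖y‖ := fun y =>
    QuotientAddGroup.norm_mk_le_norm (S := I.toAddSubgroup)
  have hmkp : ∀ y, ∀ p ∈ I, mk (y * (1 - p)) = mk y := fun y p hp => by
    rw [mul_sub, mul_one, map_sub, Ideal.Quotient.eq_zero_iff_mem.2 (I.mul_mem_left y hp), sub_zero]
  have hnorm : ∀ y, Tendsto (fun p => ‖y * (1 - p)‖) l (𝓝 ‖mk y‖) := fun y => by
    rw [Metric.tendsto_nhds]
    intro ε hε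
    obtain ⟨i, hi, hyi⟩ := hlt y (‖mk y‖ + ε / 2) (by linarith)
    filter_upwards [hl, (hl' i hi).norm.eventually
      (gt_mem_nhds (show ‖(0 : M)‖ < ε / 2 by simpa using hε))] with p ⟨hp, hp1, _⟩ h1
    have h2 : ‖mk y‖ ≤ ‖y * (1 - p)‖ := by
      rw [← hmkp y p hp]
      exact hle _
    have h3 : ‖y * (1 - p)‖ ≤ ‖y - i‖ + ‖i * (1 - p)‖ := by
      calc _ = ‖(y - i) * (1 - p) + i * (1 - p)‖ := by rw [sub_mul, sub_add_cancel]
        _ ≤ ‖y - i‖ * ‖1 - p‖ + ‖i * (1 - p)‖ :=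
          (norm_add_le _ _).trans (add_le_add_left (norm_mul_le _ _) _)
        _ ≤ _ := by gcongr; exact mul_le_of_le_one_right (norm_nonneg _) hp1
    rw [Real.dist_eq, abs_lt]
    constructor <;> linarith
  let _ : NormedRing (M ⧸ I) :=
    { nacg, Ideal.Quotient.ring I with
      dist_eq := nacg.dist_eq
      norm_mul_le := fun a b => by
        obtain ⟨x, rfl⟩ := hmk a
        obtain ⟨y, rfl⟩ := hmk b
        refine ge_of_tendsto ((hnorm x).mul (hnorm y)) (hl.mono fun p hp => ?_)
        rw [← hmkp x p hp.1, ← hmkp y p hp.1, ← map_mul]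
        exact (hle _).trans (norm_mul_le _ _) }
  have hcs : CompleteSpace (M ⧸ I) := Submodule.Quotient.completeSpace I
  let na : NormedAlgebra ℂ (M ⧸ I) :=
    { (inferInstance : Algebra ℂ (M ⧸ I)) with
      norm_smul_le := fun c a => by
        obtain ⟨x, rfl⟩ := hmk a
        refine le_of_tendsto_of_tendsto' (hnorm (c • x)) ((hnorm x).const_mul ‖c‖) fun p => ?_
        rw [smul_mul_assoc, norm_smul] }
  let starHom : M ⧸ I →+ M ⧸ I := QuotientAddGroup.map I.toAddSubgroup I.toAddSubgroup
    (starAddEquiv : M ≃+ M).toAddMonoidHom fun x hx => hs x hx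
  let _ : StarRing (M ⧸ I) :=
    { star := starHom
      star_involutive := fun a => by
        obtain ⟨x, rfl⟩ := hmk a
        exact congrArg mk (star_star x)
      star_mul := fun a b => by
        obtain ⟨x, rfl⟩ := hmk a
        obtain ⟨y, rfl⟩ := hmk b
        exact congrArg mk (star_mul x y)
      star_add := fun a b => map_add starHom a b }
  have hstar : ∀ x, star (mk x) = mk (star x) := fun _ => rfl
  have sm : StarModule ℂ (M ⧸ I) := ⟨fun c a => by
    obtain ⟨x, rfl⟩ := hmk a
    exact congrArg mk (star_smul c x)⟩
  have cs : CStarRing (M ⧸ I) := ⟨fun a => by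
    obtain ⟨x, rfl⟩ := hmk a
    rw [hstar, ← map_mul]
    refine le_of_tendsto_of_tendsto ((hnorm x).mul (hnorm x)) (hnorm (star x * x))
      (hl.mono fun p ⟨_, hp, hps⟩ => ?_)
    simp only
    rw [← CStarRing.norm_star_mul_self, star_mul, star_sub, star_one, hps, ← mul_assoc,
      mul_assoc (1 - p) (star x) x, mul_assoc (1 - p)]
    exact (norm_mul_le _ _).trans (mul_le_of_le_one_left (norm_nonneg _) hp)⟩
  refine ⟨M ⧸ I, { (inferInstance : NormedRing (M ⧸ I)), (inferInstance : StarRing (M ⧸ I)), na with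
    toCompleteSpace := hcs
    norm_mul_self_le := cs.norm_mul_self_le
    star_smul := sm.star_smul }, ⟨⟨mk, fun _ => rfl⟩, hstar⟩, hmk, fun y => ?_, hnorm, hlt⟩
  exact Ideal.Quotient.eq_zero_iff_mem

end CStarQuotient

section UnitaryFilter

lemma norm_mkQ_lt {P : Type*} [SeminormedAddCommGroup P] [NormedSpace ℂ P] (V : Submodule ℂ P)
    {y : P} {r : ℝ} : ‖V.mkQ y‖ < r ↔ ∃ v ∈ V, ‖y - v‖ < r := by
  refine (QuotientAddGroup.norm_lt_iff (S := V.toAddSubgroup)).trans ⟨?_, ?_⟩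
  · rintro ⟨z, hz, hzr⟩
    refine ⟨y - z, ?_, by simpa using hzr⟩
    exact (Submodule.Quotient.eq V).1 hz.symm
  · rintro ⟨v, hv, hr⟩
    exact ⟨y - v, (Submodule.Quotient.eq V).2 (by simpa using hv), hr⟩

/-- Conjugation by a unitary as a linear map. -/
def unitaryConj {P : Type*} [CStarAlgebra P] (w : unitary P) : P →ₗ[ℂ] P :=
  LinearMap.mulRight ℂ (star (w : P)) ∘ₗ LinearMap.mulLeft ℂ (w : P)

@[simp] lemma unitaryConj_apply {P : Type*} [CStarAlgebra P] (w : unitary P) (x : P) :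
    unitaryConj w x = w * x * star (w : P) := rfl

lemma exists_unitary_filter {X P : Type*} [NonUnitalCStarAlgebra X] [CStarAlgebra P]
    (θ : X →⋆ₙₐ[ℂ] P) (s : Set P)
    (h : ∀ (S : Finset X) (R : Finset P), (R : Set P) ⊆ s → ∀ ε : ℝ, 0 < ε →
      ∃ w : unitary P, (∀ x ∈ S, ‖w * θ x * star (w : P) - θ x‖ ≤ ε) ∧
        ∀ y ∈ R, ∃ x, ‖w * y * star (w : P) - θ x‖ ≤ ε) :
    ∃ l : Filter (unitary P), l.NeBot ∧
      (∀ x, Tendsto (fun w : unitary P => w * θ x * star (w : P) - θ x) l (𝓝 0)) ∧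
      ∀ y ∈ closure (Submodule.span ℂ s : Set P), ∀ ε : ℝ, 0 < ε → ∀ᶠ w : unitary P in l,
        ∃ x, ‖w * y * star (w : P) - θ x‖ < ε := by
  classical
  let V : Submodule ℂ P := LinearMap.range (θ : X →ₗ[ℂ] P)
  obtain ⟨l, hl, -, h1⟩ := exists_filter_of_forall_finset (α := unitary P) (I := X ⊕ s)
    (fun _ => True)
    (fun i w => i.elim (fun x => ‖w * θ x * star (w : P) - θ x‖)
      fun y => ‖V.mkQ (w * (y : P) * star (w : P))‖)
    (fun i w => by cases i <;> exact norm_nonneg _)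
    (fun S ε hε => by
      obtain ⟨w, h1, h2⟩ := h S.toLeft (S.toRight.image (↑)) (by simp) (ε / 2) (by positivity)
      refine ⟨w, trivial, ?_⟩
      rintro (x | y) hi
      · exact (h1 x (Finset.mem_toLeft.2 hi)).trans (by linarith)
      · obtain ⟨x, hx⟩ := h2 y (Finset.mem_image_of_mem _ (Finset.mem_toRight.2 hi))
        exact ((norm_mkQ_lt V).2 ⟨θ x, ⟨x, rfl⟩, hx.trans_lt (by linarith)⟩).le)
  refine ⟨l, hl, fun x => tendsto_zero_iff_norm_tendsto_zero.2 (h1 (Sum.inl x)),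
    fun y hy ε hε => ?_⟩
  have := tendsto_zero_of_mem_closure_span (B := 1) (l := l)
    (fun w : unitary P => V.mkQ ∘ₗ unitaryConj w) (Eventually.of_forall fun w v => ?_)
    (fun v hv => tendsto_zero_iff_norm_tendsto_zero.2 (h1 (Sum.inr ⟨v, hv⟩))) hy
  · filter_upwards [this.norm.eventually (gt_mem_nhds (by simpa using hε))] with w hw
    obtain ⟨_, ⟨x, rfl⟩, hx⟩ := (norm_mkQ_lt V).1 hw
    exact ⟨x, hx⟩
  · rw [one_mul, ← norm_unitary_conj w v]
    exact Submodule.Quotient.norm_mk_le _ _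

end UnitaryFilter

section ClosureSpan

variable {M : Type*} [CStarAlgebra M]

lemma mul_mem_topologicalClosure_span {s t : Set M} {V : Submodule ℂ M}
    (hV : IsClosed (V : Set M)) (h : ∀ a ∈ s, ∀ b ∈ t, a * b ∈ V) {a b : M}
    (ha : a ∈ (Submodule.span ℂ s).topologicalClosure)
    (hb : b ∈ (Submodule.span ℂ t).topologicalClosure) : a * b ∈ V := by
  have h1 : ∀ a ∈ s, (Submodule.span ℂ t).topologicalClosure ≤ V.comap (LinearMap.mulLeft ℂ a) :=
    fun a ha => Submodule.topologicalClosure_minimal _ (Submodule.span_le.2 fun b hb => h a ha b hb)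
      (hV.preimage (by fun_prop : Continuous fun b => a * b))
  have h2 : (Submodule.span ℂ s).topologicalClosure ≤ V.comap (LinearMap.mulRight ℂ b) :=
    Submodule.topologicalClosure_minimal _ (Submodule.span_le.2 fun a ha => h1 a ha hb)
      (hV.preimage (by fun_prop : Continuous fun a => a * b))
  exact h2 ha

lemma star_mem_topologicalClosure_span {s : Set M} (h : ∀ a ∈ s, star a ∈ s) {a : M}
    (ha : a ∈ (Submodule.span ℂ s).topologicalClosure) :
    star a ∈ (Submodule.span ℂ s).topologicalClosure := by
  have : (Submodule.span ℂ s).topologicalClosure ≤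
      (Submodule.span ℂ s).topologicalClosure.comap (starLinearEquiv ℂ (A := M)).toLinearMap :=
    Submodule.topologicalClosure_minimal _
      (Submodule.span_le.2 fun a ha => subset_closure (Submodule.subset_span (h a ha)))
      ((Submodule.isClosed_topologicalClosure _).preimage continuous_star)
  exact this ha

end ClosureSpan

section IdealQuotient

variable {E J A D : Type*} {M : Type u} [NonUnitalCStarAlgebra E] [NonUnitalCStarAlgebra J]
  [NonUnitalCStarAlgebra A] [CStarAlgebra D] [CStarAlgebra M]

lemma norm_one_sub_le_one [PartialOrder M] [StarOrderedRing M] {p : M} (h0 : 0 ≤ p)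
    (h1 : ‖p‖ ≤ 1) : ‖1 - p‖ ≤ 1 := by
  have h2 : p ≤ 1 := by
    simpa using (CStarAlgebra.norm_le_iff_le_algebraMap p zero_le_one h0).1 h1
  refine (CStarAlgebra.norm_le_iff_le_algebraMap (1 - p) zero_le_one (sub_nonneg.2 h2)).2 ?_
  simpa using h0

/-- The quotient of `M` by the closed ideal generated by `m (ι J) D` receives the extension of
the quotient map, and the ideal has an approximate unit commuting asymptotically with `m E 1`. -/
lemma StarBilin.exists_quotient (ι : J →⋆ₙₐ[ℂ] E) (q : E →⋆ₙₐ[ℂ] A)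
    (hq : Function.Surjective q) (hker : ∀ e, q e = 0 ↔ e ∈ Set.range ι)
    (m : StarBilin E D M)
    (hM : Dense (Submodule.span ℂ (insert 1 {y | ∃ e d, m e d = y}) : Set M)) :
    ∃ (Q : Type u) (_ : CStarAlgebra Q) (π : M →⋆ₐ[ℂ] Q) (mA : StarBilin A D Q) (l : Filter M),
      l.NeBot ∧ Function.Surjective π ∧ (∀ e d, mA (q e) d = π (m e d)) ∧
      (∀ᶠ p in l, π p = 0 ∧ star p = p) ∧
      (∀ e, Tendsto (fun p => p * m e 1 - m e 1 * p) l (𝓝 0)) ∧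
      (∀ y, Tendsto (fun p => ‖y * (1 - p)‖) l (𝓝 ‖π y‖)) ∧
      ∀ y r, ‖π y‖ < r → ∃ i ∈ closure (Submodule.span ℂ {y | ∃ j d, m (ι j) d = y} : Set M),
        ‖y - i‖ < r := by
  let _ := CStarAlgebra.spectralOrder J
  have _ := CStarAlgebra.spectralOrderedRing J
  let _ := CStarAlgebra.spectralOrder M
  have _ := CStarAlgebra.spectralOrderedRing M
  have hl : ∀ e j, e * ι j ∈ Set.range ι := fun e j => by
    rw [← hker, map_mul, (hker (ι j)).2 ⟨j, rfl⟩, mul_zero]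
  set s : Set M := {y | ∃ j d, m (ι j) d = y} with hs
  set V := (Submodule.span ℂ s).topologicalClosure with hV
  have hVc : IsClosed (V : Set M) := Submodule.isClosed_topologicalClosure _
  have hsV : ∀ y ∈ s, y ∈ V := fun y hy => subset_closure (Submodule.subset_span hy)
  have hleft : ∀ a, ∀ b ∈ V, a * b ∈ V := fun a b hb => by
    refine mul_mem_topologicalClosure_span hVc ?_ (hM a) hb
    rintro _ (rfl | ⟨e, d, rfl⟩) _ ⟨j, d', rfl⟩
    · rw [one_mul]; exact hsV _ ⟨j, d', rfl⟩
    · obtain ⟨j', hj'⟩ := hl e j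
      rw [m.mul_map, ← hj']
      exact hsV _ ⟨_, _, rfl⟩
  have hstar : ∀ a ∈ V, star a ∈ V := fun a ha => by
    refine star_mem_topologicalClosure_span ?_ ha
    rintro _ ⟨j, d, rfl⟩
    exact ⟨star j, star d, by rw [m.star_map, map_star ι]⟩
  let I : Ideal M :=
    { carrier := V
      add_mem' := V.add_mem
      zero_mem' := V.zero_mem
      smul_mem' := fun a b hb => hleft a b hb }
  have hI : I.IsTwoSided := ⟨fun {a} b ha => by
    have := hstar _ (hleft (star b) _ (hstar _ ha))
    rwa [star_mul, star_star, star_star] at this⟩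
  obtain ⟨lJ, _, hJ, hJ1, -, hJ2⟩ := exists_quasicentral ι hl (NonUnitalStarAlgHom.id ℂ J)
    (CStarAlgebra.increasingApproximateUnit J).tendsto_mul_right
  set l : Filter M := lJ.map fun j => m (ι j) 1 with hl_def
  have hp : ∀ᶠ p in l, p ∈ I ∧ ‖1 - p‖ ≤ 1 ∧ star p = p := by
    rw [hl_def, eventually_map]
    filter_upwards [hJ] with j ⟨h0, h1⟩
    have hp0 : 0 ≤ m (ι j) 1 := (map_nonneg (m.left.comp ι) h0 : _)
    refine ⟨hsV _ ⟨j, 1, rfl⟩, norm_one_sub_le_one hp0 ?_, hp0.isSelfAdjoint⟩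
    exact (NonUnitalStarAlgHom.norm_apply_le (m.left.comp ι) j).trans h1
  have hpI : ∀ x ∈ V, Tendsto (fun p => (1 - p) * x) l (𝓝 0) := fun x hx => by
    refine tendsto_zero_of_mem_closure_span (B := 1) (s := s) (l := l)
      (fun p : M => LinearMap.mulLeft ℂ (1 - p)) ?_ ?_ hx
    · filter_upwards [hp] with p ⟨_, hp, _⟩ v
      exact (norm_mul_le _ _).trans (by gcongr)
    · rintro _ ⟨j, d, rfl⟩
      rw [hl_def, tendsto_map'_iff]
      have h1 : Tendsto (fun j' => ‖j' * j - j‖ * ‖d‖) lJ (𝓝 0) := by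
        simpa using (tendsto_iff_norm_sub_tendsto_zero.1 (hJ1 j)).mul_const ‖d‖
      refine squeeze_zero_norm (fun j' => ?_) h1
      have e : (1 - m (ι j') 1) * m (ι j) d = -m (ι (j' * j - j)) d := by
        simp [sub_mul, m.mul_map]
      simp only [Function.comp, LinearMap.mulLeft_apply]
      rw [e, norm_neg]
      refine (m.norm_le _ _).trans ?_
      gcongr
      exact NonUnitalStarAlgHom.norm_apply_le ι _
  obtain ⟨Q, iQ, π, hπ, hπ0, hπn, hπlt⟩ := exists_cstarQuotient I hVc hstar l hp fun x hx => by
    refine tendsto_zero_iff_norm_tendsto_zero.2 (Tendsto.congr' ?_ (hpI _ (hstar x hx)).norm |>.trans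
      (by simp))
    filter_upwards [hp] with p ⟨_, _, hps⟩
    rw [← norm_star (x * (1 - p))]
    simp [hps]
  have hdesc : ∀ e e' d, q e = q e' → π (m e d) = π (m e' d) := fun e e' d h => by
    rw [← sub_eq_zero, ← map_sub π, ← LinearMap.sub_apply, ← map_sub m.lin, hπ0]
    obtain ⟨j, hj⟩ := (hker (e - e')).1 (by rw [map_sub, h, sub_self])
    exact hsV _ ⟨j, d, by rw [hj]⟩
  let lift := Function.surjInv hq
  have hlift : ∀ a, q (lift a) = a := Function.surjInv_eq hq
  let mA : StarBilin A D Q :=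
    { lin :=
        { toFun := fun a => (π : M →ₗ[ℂ] Q) ∘ₗ m (lift a)
          map_add' := fun a b => by
            ext d
            refine (hdesc _ (lift a + lift b) d (by simp [hlift])).trans (by simp)
          map_smul' := fun c a => by
            ext d
            refine (hdesc _ (c • lift a) d (by simp [hlift])).trans (by simp) }
      mul_map' := fun a a' b b' => by
        refine (?_ : π (m _ _) * π (m _ _) = π (m _ _))
        rw [← map_mul, m.mul_map]
        exact hdesc _ _ _ (by simp [hlift])
      star_map' := fun a b => by
        refine (?_ : star (π (m _ _)) = π (m _ _))
        rw [← map_star, m.star_map]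
        exact hdesc _ _ _ (by rw [map_star q, hlift, hlift]) }
  refine ⟨Q, iQ, π, mA, l, inferInstance, hπ, fun e d => hdesc _ _ _ (hlift _),
    hp.mono fun p hp => ⟨(hπ0 p).2 hp.1, hp.2.2⟩, fun e => ?_, hπn, hπlt⟩
  rw [hl_def, tendsto_map'_iff]
  have h1 : Tendsto (fun j => ‖ι j * e - e * ι j‖) lJ (𝓝 0) := by simpa using (hJ2 e).norm
  refine squeeze_zero_norm (fun j => ?_) h1
  have : m (ι j) 1 * m e 1 - m e 1 * m (ι j) 1 = m.left (ι j * e - e * ι j) := by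
    simp [m.mul_map]
  simp only [Function.comp]
  rw [this]
  exact NonUnitalStarAlgHom.norm_apply_le _ _

end IdealQuotient

section Lift

variable {M Q : Type*} [CStarAlgebra M] [CStarAlgebra Q]

lemma norm_realPart_commutator_le (a x : M) :
    ‖(realPart a : M) * x - x * realPart a‖ ≤
      (‖a * x - x * a‖ + ‖a * star x - star x * a‖) / 2 := by
  have e : (realPart a : M) * x - x * realPart a =
      (2⁻¹ : ℝ) • ((a * x - x * a) - star (a * star x - star x * a)) := by
    simp only [realPart_apply_coe, star_sub, star_mul, star_star, smul_mul_assoc, mul_smul_comm,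
      ← smul_sub]
    congr 1
    noncomm_ring
  rw [e, norm_smul, Real.norm_of_nonneg (by norm_num)]
  have := norm_sub_le (a * x - x * a) (star (a * star x - star x * a))
  rw [norm_star (a * star x - star x * a)] at this
  linarith

lemma map_realPart_eq (π : M →⋆ₐ[ℂ] Q) {a : M} (ha : IsSelfAdjoint (π a)) :
    π (realPart a) = π a := by
  have h := map_star π a
  rw [ha.star_eq] at h
  rw [realPart_apply_coe, ← Complex.coe_smul, map_smul, map_add, h, ← two_smul ℂ (π a), smul_smul]
  norm_num

lemma map_expProd (π : M →⋆ₐ[ℂ] Q) (hπ : Continuous π) {g : selfAdjoint Q → selfAdjoint M}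
    (hg : ∀ k, π (g k) = k) (L : List (selfAdjoint Q)) :
    π (expProd (L.map g) : M) = expProd L := by
  let _ := NormedAlgebra.restrictScalars ℚ ℂ M
  let _ := NormedAlgebra.restrictScalars ℚ ℂ Q
  induction L with
  | nil => simp
  | cons k L ih =>
    simp only [List.map_cons, expProd_cons, Submonoid.coe_mul, map_mul, ih,
      selfAdjoint.expUnitary_coe]
    rw [NormedSpace.map_exp π hπ, map_smul, hg]

/-- Commutators in a quotient can be lifted along an asymptotically central approximate unit. -/
lemma eventually_commSum_lift_le (π : M →⋆ₐ[ℂ] Q) {l : Filter M}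
    (hl : ∀ y, Tendsto (fun p => ‖y * (1 - p)‖) l (𝓝 ‖π y‖))
    {lift : Q → M} (hlift : ∀ k, π (lift k) = k) {x : M}
    (hx : Tendsto (fun p => p * x - x * p) l (𝓝 0))
    (hx' : Tendsto (fun p => p * star x - star x * p) l (𝓝 0)) (L : List (selfAdjoint Q))
    {ε : ℝ} (hε : 0 < ε) :
    ∀ᶠ p in l, commSum (L.map fun k : selfAdjoint Q => realPart (lift k * (1 - p))) x ≤
      commSum L (π x) + ε := by
  have key : ∀ (k : Q) (x : M), Tendsto (fun p => p * x - x * p) l (𝓝 0) → ∀ δ : ℝ, 0 < δ →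
      ∀ᶠ p in l, ‖lift k * (1 - p) * x - x * (lift k * (1 - p))‖ < ‖k * π x - π x * k‖ + δ := by
    intro k x hx δ hδ
    have h1 : Tendsto (fun p => ‖(lift k * x - x * lift k) * (1 - p)‖ +
        ‖lift k‖ * ‖p * x - x * p‖) l (𝓝 ‖k * π x - π x * k‖) := by
      simpa [hlift] using (hl (lift k * x - x * lift k)).add (hx.norm.const_mul ‖lift k‖)
    filter_upwards [h1.eventually (gt_mem_nhds (lt_add_of_pos_right _ hδ))] with p hp
    refine lt_of_le_of_lt ?_ hp
    have e : lift k * (1 - p) * x - x * (lift k * (1 - p)) =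
        (lift k * x - x * lift k) * (1 - p) - lift k * (p * x - x * p) := by noncomm_ring
    rw [e]
    exact (norm_sub_le _ _).trans (by gcongr; exact norm_mul_le _ _)
  induction L generalizing ε with
  | nil => simpa using Eventually.of_forall fun _ => hε.le
  | cons k L ih =>
    filter_upwards [ih (half_pos hε), key k x hx _ (half_pos hε), key k (star x) hx' _ (half_pos hε)]
      with p h1 h2 h3
    have h4 := norm_realPart_commutator_le (lift k * (1 - p)) x
    have h5 : ‖(k : Q) * π (star x) - π (star x) * k‖ = ‖(k : Q) * π x - π x * k‖ := by
      have : (k : Q) * π (star x) - π (star x) * k = -star ((k : Q) * π x - π x * k) := by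
        simp [star_sub, star_mul, map_star π]
      rw [this, norm_neg, norm_star]
    simp only [List.map_cons, commSum_cons]
    linarith

end Lift

section Combine

variable {E J A D T : Type*} {M : Type u} [NonUnitalCStarAlgebra E] [NonUnitalCStarAlgebra J]
  [NonUnitalCStarAlgebra A] [CStarAlgebra D] [Nontrivial D] [CStarAlgebra T] [CStarAlgebra M]

lemma StarBilin.HalfFlip.exists_unitary {ρ : StarBilin D D T} (hρ : ρ.HalfFlip)
    (ι : J →⋆ₙₐ[ℂ] E) (q : E →⋆ₙₐ[ℂ] A)
    (hq : Function.Surjective q) (hker : ∀ e, q e = 0 ↔ e ∈ Set.range ι)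
    {γJ : StarBilin J D J} (hγJ : Dense (Submodule.span ℂ {c | ∃ a d, γJ a d = c} : Set J))
    {γA : StarBilin A D A} (hγA : Dense (Submodule.span ℂ {c | ∃ a d, γA a d = c} : Set A))
    (m : StarBilin E D M)
    (hM : Dense (Submodule.span ℂ (insert 1 {y | ∃ e d, m e d = y}) : Set M))
    (S : Finset E) (R : Finset (E × D)) {ε : ℝ} (hε : 0 < ε) :
    ∃ w : unitary M, (∀ x ∈ S, ‖w * m x 1 * star (w : M) - m x 1‖ ≤ ε) ∧
      ∀ p ∈ R, ∃ e, ‖w * m p.1 p.2 * star (w : M) - m e 1‖ ≤ ε := by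
  classical
  obtain ⟨Q, _, π, mA, l, _, hπ, hmA, hl0, hlc, hln, hπlt⟩ :=
    StarBilin.exists_quotient ι q hq hker m hM
  obtain ⟨L, hL1, hL2⟩ := hρ.exists_local (ι := NonUnitalStarAlgHom.id ℂ A) (γ := γA)
    (fun x c => ⟨x * c, rfl⟩) hγA mA (S.image q) (R.image fun p => (q p.1, p.2))
    (show 0 < ε / 4 by positivity)
  obtain ⟨p, hpS, hp0⟩ := (((Filter.eventually_all_finset S).2 fun x _ =>
    eventually_commSum_lift_le π hln (Function.surjInv_eq hπ) (hlc x)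
      (by simpa [m.star_map] using hlc (star x)) L (show 0 < ε / 4 by positivity)).and hl0).exists
  set W : unitary M := expProd (L.map fun k : selfAdjoint Q =>
    realPart (Function.surjInv hπ k * (1 - p))) with hW
  have hπc : Continuous π := 
    AddMonoidHomClass.continuous_of_bound π 1 fun x => by
      simpa using NonUnitalStarAlgHom.norm_apply_le π x
  have hπW : π W = expProd L := map_expProd π hπc (fun k => by
    have h : π (Function.surjInv hπ k * (1 - p)) = k := by simp [Function.surjInv_eq hπ, hp0.1]
    rw [map_realPart_eq π (by rw [h]; exact k.2), h]) L
  have hR : ∀ p ∈ R, ∃ e, ∃ i ∈ closure (Submodule.span ℂ {y | ∃ j d, m (ι j) d = y} : Set M),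
      ‖W * m p.1 p.2 * star (W : M) - m e 1 - i‖ ≤ ε / 2 := fun p hp => by
    obtain ⟨c, hc⟩ := hL2 _ (Finset.mem_image_of_mem _ hp)
    obtain ⟨e, rfl⟩ := hq c
    obtain ⟨i, hi, hi'⟩ := hπlt (W * m p.1 p.2 * star (W : M) - m e 1) (ε / 2) (by
      simp only [map_sub, map_mul, map_star π, hπW, ← hmA]
      exact hc.trans_lt (by linarith))
    exact ⟨e, i, hi, hi'.le⟩
  choose! e i hi hei using hR
  obtain ⟨lZ, _, hZ, hZ'⟩ := exists_unitary_filter m.left {y | ∃ j d, m (ι j) d = y}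
    fun S' R' hR' δ hδ => by
      have hR'' : ∀ y ∈ R', ∃ j d, m (ι j) d = y := fun y hy => hR' hy
      choose! j d hjd using hR''
      obtain ⟨K, hK1, hK2⟩ := hρ.exists_local (ι := ι) (γ := γJ)
        (fun x c => by rw [← hker, map_mul, (hker (ι c)).2 ⟨c, rfl⟩, mul_zero]) hγJ m S'
        (R'.image fun y => (j y, d y)) hδ
      refine ⟨expProd K, fun x hx => (_root_.norm_expProd_conj_sub_le K _).trans (hK1 x hx),
        fun y hy => ?_⟩
      obtain ⟨c, hc⟩ := hK2 _ (Finset.mem_image_of_mem _ hy)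
      exact ⟨ι c, by simpa only [hjd y hy, m.left_apply] using hc⟩
  have hε4 : 0 < ε / 4 := by positivity
  have hZ1 : ∀ x, ∀ᶠ w : unitary M in lZ, ‖w * m x 1 * star (w : M) - m x 1‖ < ε / 4 := fun x =>
    (hZ x).norm.eventually (gt_mem_nhds (by simpa using hε4))
  obtain ⟨Z, ⟨hZS, hZe⟩, hZi⟩ := ((((Filter.eventually_all_finset S).2 fun x _ => hZ1 x).and
    ((Filter.eventually_all_finset R).2 fun p _ => hZ1 (e p))).and
    ((Filter.eventually_all_finset R).2 fun p hp => hZ' _ (hi p hp) _ hε4)).exists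
  refine ⟨Z * W, fun x hx => ?_, fun p hp => ?_⟩
  · have h1 : ‖W * m x 1 * star (W : M) - m x 1‖ ≤ ε / 2 := by
      refine (_root_.norm_expProd_conj_sub_le _ _).trans ((hpS x hx).trans ?_)
      have := hL1 _ (Finset.mem_image_of_mem q hx)
      rw [hmA] at this
      linarith
    have e : ((Z * W : unitary M) : M) * m x 1 * star ((Z * W : unitary M) : M) - m x 1 =
        Z * (W * m x 1 * star (W : M) - m x 1) * star (Z : M) +
          (Z * m x 1 * star (Z : M) - m x 1) := by
      simp only [Submonoid.coe_mul, star_mul]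
      noncomm_ring
    rw [e]
    refine (norm_add_le _ _).trans ?_
    rw [norm_unitary_conj]
    linarith [hZS x hx]
  · obtain ⟨x, hx⟩ := hZi p hp
    refine ⟨e p + x, ?_⟩
    have e₁ : ((Z * W : unitary M) : M) * m p.1 p.2 * star ((Z * W : unitary M) : M) -
        m (e p + x) 1 = Z * (W * m p.1 p.2 * star (W : M) - m (e p) 1 - i p) * star (Z : M) +
          ((Z * m (e p) 1 * star (Z : M) - m (e p) 1) + (Z * i p * star (Z : M) - m x 1)) := by
      simp only [Submonoid.coe_mul, star_mul, map_add, LinearMap.add_apply]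
      noncomm_ring
    rw [e₁]
    refine (norm_add_le _ _).trans ?_
    rw [norm_unitary_conj]
    have h1 := norm_add_le (Z * m (e p) 1 * star (Z : M) - m (e p) 1)
      (Z * i p * star (Z : M) - m x 1)
    have h2 := hei p hp
    have h3 := hZe p hp
    simp only [StarBilin.left_apply] at hx
    linarith

end Combine

section Intertwining

variable {E M : Type*} [NonUnitalCStarAlgebra E] [CStarAlgebra M]

lemma unitary_conj_sub_conj (v w : unitary M) (b x : M) :
    ((w * star v : unitary M) : M) *
        (b - (v * star w : unitary M) * x * star ((v * star w : unitary M) : M)) *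
        star ((w * star v : unitary M) : M) =
      w * ((star v : unitary M) * b * star ((star v : unitary M) : M)) * star (w : M) - x := by
  have hv : ∀ y : M, star (v : M) * (v * y) = y := fun y => by
    rw [← mul_assoc, Unitary.coe_star_mul_self, one_mul]
  have hw : ∀ y : M, (w : M) * (star (w : M) * y) = y := fun y => by
    rw [← mul_assoc, ← Unitary.coe_star, Unitary.coe_mul_star_self, one_mul]
  simp [mul_sub, sub_mul, mul_assoc, hv, hw]

/-- A point-norm limit of unitary conjugates of an isometric homomorphism. -/
lemma exists_limit_conj (θ : E →⋆ₙₐ[ℂ] M) (hθ : ∀ e, ‖θ e‖ = ‖e‖) {k : Filter (unitary M)}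
    [k.NeBot] {a : ℕ → E} (ha : DenseRange a) {y : ℕ → M}
    (hk : ∀ n, Tendsto (fun v : unitary M => v * θ (a n) * star (v : M)) k (𝓝 (y n))) :
    ∃ Φ : E →⋆ₙₐ[ℂ] M, (∀ e, ‖Φ e‖ = ‖e‖) ∧
      ∀ e, Tendsto (fun v : unitary M => v * θ e * star (v : M)) k (𝓝 (Φ e)) := by
  have hex : ∀ e, ∃ z, Tendsto (fun v : unitary M => v * θ e * star (v : M)) k (𝓝 z) := by
    intro e
    refine cauchy_map_iff_exists_tendsto.1 (Metric.cauchy_iff.2 ⟨inferInstance, fun ε hε => ?_⟩)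
    obtain ⟨n, hn⟩ := ha.exists_dist_lt e (show 0 < ε / 4 by positivity)
    refine ⟨Metric.ball (y n) (ε / 2), ?_, fun x hx z hz => ?_⟩
    · rw [mem_map]
      filter_upwards [hk n (Metric.ball_mem_nhds _ (show 0 < ε / 4 by positivity))] with v hv
      have h1 : dist (v * θ e * star (v : M)) (v * θ (a n) * star (v : M)) < ε / 4 := by
        rw [dist_eq_norm, ← sub_mul, ← mul_sub, norm_unitary_conj, ← map_sub, hθ, ← dist_eq_norm]
        exact hn
      have h2 : dist (v * θ (a n) * star (v : M)) (y n) < ε / 4 := hv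
      rw [Set.mem_preimage, Metric.mem_ball]
      linarith [dist_triangle (v * θ e * star (v : M)) (v * θ (a n) * star (v : M)) (y n)]
    · rw [Metric.mem_ball] at hx hz
      linarith [dist_triangle_right x z (y n)]
  choose Φ hΦ using hex
  refine ⟨{ toFun := Φ
            map_smul' := fun c e => tendsto_nhds_unique (hΦ (c • e)) ?_
            map_zero' := tendsto_nhds_unique (hΦ 0) (by simp)
            map_add' := fun e e' => tendsto_nhds_unique (hΦ (e + e')) ?_
            map_mul' := fun e e' => tendsto_nhds_unique (hΦ (e * e')) ?_
            map_star' := fun e => tendsto_nhds_unique (hΦ (star e)) ?_ }, fun e => ?_, hΦ⟩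
  · simpa [map_smul] using (hΦ e).const_smul c
  · simpa [mul_add, add_mul] using (hΦ e).add (hΦ e')
  · refine ((hΦ e).mul (hΦ e')).congr fun v => ?_
    calc _ = v * θ e * (star (v : M) * v) * θ e' * star (v : M) := by noncomm_ring
      _ = v * θ (e * e') * star (v : M) := by
        rw [Unitary.coe_star_mul_self, mul_one, map_mul, mul_assoc (v : M)]
  · simpa [mul_assoc, map_star θ] using (hΦ e).star
  · refine tendsto_nhds_unique (hΦ e).norm ?_
    simp [norm_unitary_conj, hθ]

/-- One-sided approximate intertwining. -/
lemma exists_hom_range_eq [TopologicalSpace.SeparableSpace E] (θ : E →⋆ₙₐ[ℂ] M)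
    (hθ : ∀ e, ‖θ e‖ = ‖e‖) {B : Set M} (hBc : IsClosed B) (hBθ : ∀ e, θ e ∈ B)
    (hBw : ∀ (w : unitary M), ∀ b ∈ B, w * b * star (w : M) ∈ B)
    {b : ℕ → M} (hbB : ∀ n, b n ∈ B) (hb : B ⊆ closure (Set.range b))
    {l : Filter (unitary M)} [l.NeBot]
    (hl : ∀ e, Tendsto (fun w : unitary M => w * θ e * star (w : M) - θ e) l (𝓝 0))
    (hlB : ∀ y ∈ B, ∀ ε : ℝ, 0 < ε → ∀ᶠ w : unitary M in l,
      ∃ e, ‖w * y * star (w : M) - θ e‖ < ε) :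
    ∃ Φ : E →⋆ₙₐ[ℂ] M, (∀ e, ‖Φ e‖ = ‖e‖) ∧ Set.range Φ = B := by
  set a : ℕ → E := TopologicalSpace.denseSeq E with ha_def
  have ha : DenseRange a := TopologicalSpace.denseRange_denseSeq E
  let F : unitary M → ℕ → M := fun v n => v * θ (a n) * star (v : M)
  set Y : Set (ℕ → M) := closure (Set.range F) with hY
  have hYc : IsClosed Y := isClosed_closure
  have hBaire : BaireSpace Y := by
    have := hYc.isCompletelyMetrizableSpace
    infer_instance
  let U : ℕ × ℕ → Set (ℕ → M) := fun p => {y | ∃ n, ‖b p.1 - y n‖ < 1 / ((p.2 : ℝ) + 1)}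
  have hUo : ∀ p, IsOpen (U p) := fun p => by
    simp only [U, Set.ofPred_exists]
    exact isOpen_iUnion fun n => isOpen_lt (by fun_prop) continuous_const
  have hUd : ∀ p, Dense ((↑) ⁻¹' U p : Set Y) := fun p => by
    rw [Subtype.dense_iff]
    refine closure_minimal ?_ isClosed_closure
    rintro _ ⟨v, rfl⟩
    have h1 : Tendsto (fun w : unitary M => F (v * star w)) l (𝓝 (F v)) := by
      refine tendsto_pi_nhds.2 fun n => tendsto_iff_norm_sub_tendsto_zero.2 ?_
      have h2 := (hl (a n)).norm
      rw [norm_zero] at h2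
      refine h2.congr fun w => ?_
      have hv : ∀ z : M, star (v : M) * (v * z) = z := fun z => by
        rw [← mul_assoc, Unitary.coe_star_mul_self, one_mul]
      rw [norm_sub_rev _ (F v n), ← norm_unitary_conj (w * star v) (F v n - F (v * star w) n)]
      refine Eq.trans ?_ (congrArg norm (unitary_conj_sub_conj v w (F v n) (θ (a n))).symm)
      simp [F, mul_assoc, hv]
    have h3 := hlB _ (hBw (star v) _ (hbB p.1)) _ (show 0 < 1 / ((p.2 : ℝ) + 1) by positivity)
    refine mem_closure_of_tendsto h1 (h3.mono ?_)
    rintro w ⟨e, he⟩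
    have hFY : F (v * star w) ∈ Y := subset_closure ⟨_, rfl⟩
    refine ⟨⟨_, hFY⟩, ?_, rfl⟩
    have hc : Continuous fun e => ‖w * ((star v : unitary M) * b p.1 *
        star ((star v : unitary M) : M)) * star (w : M) - θ e‖ :=
      (continuous_const.sub (AddMonoidHomClass.isometry_of_norm θ hθ).continuous).norm
    obtain ⟨n, hn⟩ := ha.exists_mem_open (isOpen_Iio.preimage hc) ⟨e, he⟩
    refine ⟨n, lt_of_eq_of_lt ?_ hn⟩
    rw [← norm_unitary_conj (w * star v)]
    exact congrArg _ (unitary_conj_sub_conj v w (b p.1) (θ (a n)))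
  obtain ⟨⟨y, hyY⟩, hyU⟩ : ∃ y : Y, ∀ p, (y : ℕ → M) ∈ U p := by
    have : Nonempty Y := ⟨⟨F 1, subset_closure ⟨_, rfl⟩⟩⟩
    obtain ⟨y, hy⟩ := (dense_iInter_of_isOpen
      (fun p => (hUo p).preimage continuous_subtype_val) hUd).nonempty
    exact ⟨y, fun p => Set.mem_iInter.1 hy p⟩
  have hk : (comap F (𝓝 y)).NeBot := 
    comap_neBot_iff_frequently.2 (mem_closure_iff_frequently.1 hyY)
  obtain ⟨Φ, hΦn, hΦ⟩ := exists_limit_conj θ hθ ha (k := comap F (𝓝 y)) (y := y)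
    fun n => tendsto_pi_nhds.1 (tendsto_comap (f := F)) n
  have hΦa : ∀ n, Φ (a n) = y n := fun n =>
    tendsto_nhds_unique (hΦ (a n)) (tendsto_pi_nhds.1 (tendsto_comap (f := F)) n)
  refine ⟨Φ, hΦn, Set.Subset.antisymm ?_ ?_⟩
  · rintro _ ⟨e, rfl⟩
    exact hBc.mem_of_tendsto (hΦ e) (Eventually.of_forall fun v => hBw v _ (hBθ e))
  · have hcl : IsClosed (Set.range Φ) :=
      (AddMonoidHomClass.isometry_of_norm Φ hΦn).isClosedEmbedding.isClosed_range
    refine hb.trans (closure_minimal ?_ hcl)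
    rintro _ ⟨j, rfl⟩
    rw [← hcl.closure_eq, Metric.mem_closure_range_iff]
    intro ε hε
    obtain ⟨k, hk⟩ := exists_nat_one_div_lt hε
    obtain ⟨n, hn⟩ := hyU (j, k)
    exact ⟨a n, by rw [hΦa, dist_eq_norm]; exact hn.trans hk⟩

end Intertwining

/-- Composition of a multiplicative bilinear map with a homomorphism. -/
def StarBilin.comp {A : Type u} {B : Type v} {P : Type w} {P' : Type x} [NonUnitalCStarAlgebra A]
    [CStarAlgebra B] [NonUnitalCStarAlgebra P] [NonUnitalCStarAlgebra P'] (ρ : StarBilin A B P)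
    (f : P →⋆ₙₐ[ℂ] P') : StarBilin A B P' where
  lin := ρ.lin.compr₂ (f : P →ₗ[ℂ] P')
  mul_map' a a' b b' := ((map_mul f _ _).symm.trans (congrArg f (ρ.mul_map a a' b b')) :)
  star_map' a b := ((map_star f _).symm.trans (congrArg f (ρ.star_map a b)) :)

@[simp] lemma StarBilin.comp_apply {A : Type u} {B : Type v} {P : Type w} {P' : Type x}
    [NonUnitalCStarAlgebra A] [CStarAlgebra B] [NonUnitalCStarAlgebra P]
    [NonUnitalCStarAlgebra P'] (ρ : StarBilin A B P) (f : P →⋆ₙₐ[ℂ] P') (a : A) (b : B) :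
    ρ.comp f a b = f (ρ a b) := rfl

lemma StarBilin.map_mem_span {A : Type u} {B : Type v} {P : Type w} {P' : Type x}
    [NonUnitalCStarAlgebra A] [CStarAlgebra B] [NonUnitalCStarAlgebra P]
    [NonUnitalCStarAlgebra P'] (ρ : StarBilin A B P) (f : P →⋆ₙₐ[ℂ] P') {y : P}
    (hy : y ∈ Submodule.span ℂ {y | ∃ a b, ρ a b = y}) :
    f y ∈ Submodule.span ℂ {y | ∃ a b, ρ.comp f a b = y} := by
  have h := Submodule.mem_map_of_mem (f := (f : P →ₗ[ℂ] P')) hy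
  rw [Submodule.map_span] at h
  refine Submodule.span_mono ?_ h
  rintro _ ⟨_, ⟨a, b, rfl⟩, rfl⟩
  exact ⟨a, b, rfl⟩

lemma CStarTensor.exists_absorbing {A : Type u} {D : Type v} {T : Type w}
    [NonUnitalCStarAlgebra A] [CStarAlgebra D] [NonUnitalCStarAlgebra T] (h : CStarTensor A D T)
    (φ : T ≃⋆ₐ[ℂ] A) :
    ∃ γ : StarBilin A D A, Dense (Submodule.span ℂ {c | ∃ a d, γ a d = c} : Set A) := by
  let f : T →⋆ₙₐ[ℂ] A := (φ : T →⋆ₙₐ[ℂ] A)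
  have hf : Continuous f := AddMonoidHomClass.continuous_of_bound f 1 fun x => by
    simpa using NonUnitalStarAlgHom.norm_apply_le f x
  have hs : Function.Surjective f := φ.surjective
  refine ⟨h.toStarBilin.comp f, (hs.denseRange.dense_image hf h.dense_span).mono ?_⟩
  rintro _ ⟨y, hy, rfl⟩
  exact h.toStarBilin.map_mem_span f hy

lemma CStarTensor.separableSpace {A : Type u} {D : Type v} {T : Type w}
    [NonUnitalCStarAlgebra A] [CStarAlgebra D] [NonUnitalCStarAlgebra T] (h : CStarTensor A D T)
    [TopologicalSpace.SeparableSpace A] [TopologicalSpace.SeparableSpace D] :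
    TopologicalSpace.SeparableSpace T := by
  have hc : Continuous fun p : A × D => h.tmul p.1 p.2 :=
    (LinearMap.mkContinuous₂ h.toStarBilin.lin 1 fun a b => by
      simp [h.norm_tmul]).continuous₂
  have hs : {t : T | ∃ a b, h.tmul a b = t} = Set.range fun p : A × D => h.tmul p.1 p.2 := by
    ext; simp
  have := (TopologicalSpace.isSeparable_range hc).span (R := ℂ) |>.closure
  rw [← hs, h.dense_span.closure_eq] at this
  exact TopologicalSpace.isSeparable_univ_iff.1 this

lemma nonempty_starAlgEquiv_of_range_inr_eq {E T : Type*} [NonUnitalCStarAlgebra E]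
    [NonUnitalCStarAlgebra T] (Φ : E →⋆ₙₐ[ℂ] Unitization ℂ T) (hΦ : Function.Injective Φ)
    (hr : Set.range Φ = Set.range (Unitization.inr : T → Unitization ℂ T)) :
    Nonempty (T ≃⋆ₐ[ℂ] E) := by
  have h1 : ∀ e, ∃ t : T, (t : Unitization ℂ T) = Φ e := fun e => by
    have : Φ e ∈ Set.range Φ := ⟨e, rfl⟩
    rwa [hr] at this
  choose ψ hψ using h1
  have hi : Function.Injective (Unitization.inr : T → Unitization ℂ T) :=
    Unitization.inr_injective
  let f : E →⋆ₙₐ[ℂ] T :=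
    { toFun := ψ
      map_smul' := fun c e => hi (by simp [hψ])
      map_zero' := hi (by simp [hψ])
      map_add' := fun e e' => hi (by simp [hψ])
      map_mul' := fun e e' => hi (by simp [hψ])
      map_star' := fun e => hi (by rw [hψ, Unitization.inr_star, hψ, map_star Φ]) }
  refine ⟨(StarAlgEquiv.ofBijective f ⟨fun e e' h => hΦ ?_, fun t => ?_⟩).symm⟩
  · rw [← hψ, ← hψ]
    exact congrArg _ h
  · obtain ⟨e, he⟩ : (t : Unitization ℂ T) ∈ Set.range Φ := hr ▸ ⟨t, rfl⟩
    exact ⟨e, hi ((hψ e).trans he)⟩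

lemma StarBilin.HalfFlip.nonempty_starAlgEquiv {J E A D TD : Type*} {ED : Type u}
    [NonUnitalCStarAlgebra J] [NonUnitalCStarAlgebra E] [NonUnitalCStarAlgebra A]
    [CStarAlgebra D] [Nontrivial D] [CStarAlgebra TD] [NonUnitalCStarAlgebra ED]
    [TopologicalSpace.SeparableSpace E] [TopologicalSpace.SeparableSpace D]
    {ρ : StarBilin D D TD} (hρ : ρ.HalfFlip)
    (ι : J →⋆ₙₐ[ℂ] E) (q : E →⋆ₙₐ[ℂ] A)
    (hq : Function.Surjective q) (hker : ∀ e, q e = 0 ↔ e ∈ Set.range ι)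
    {γJ : StarBilin J D J} (hγJ : Dense (Submodule.span ℂ {c | ∃ a d, γJ a d = c} : Set J))
    {γA : StarBilin A D A} (hγA : Dense (Submodule.span ℂ {c | ∃ a d, γA a d = c} : Set A))
    (h : CStarTensor E D ED) : Nonempty (ED ≃⋆ₐ[ℂ] E) := by
  have _ := h.separableSpace
  let inr : ED →⋆ₙₐ[ℂ] Unitization ℂ ED := Unitization.inrNonUnitalStarAlgHom ℂ ED
  have hinr : Isometry inr := Unitization.isometry_inr (𝕜 := ℂ) (A := ED)
  set m : StarBilin E D (Unitization ℂ ED) := h.toStarBilin.comp inr with hm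
  have hmem : ∀ y, inr y ∈ closure
      (Submodule.span ℂ {y | ∃ e d, m e d = y} : Set (Unitization ℂ ED)) := fun y =>
    map_mem_closure hinr.continuous (h.dense_span y) fun _ => h.toStarBilin.map_mem_span inr
  have hM : Dense (Submodule.span ℂ (insert 1 {y | ∃ e d, m e d = y}) :
      Set (Unitization ℂ ED)) := fun y => by
    rw [← Submodule.topologicalClosure_coe, SetLike.mem_coe]
    induction y with
    | inl_add_inr c y =>
      refine Submodule.add_mem _ ?_ ?_
      · rw [show (Unitization.inl c : Unitization ℂ ED) = c • 1 by ext <;> simp]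
        exact Submodule.smul_mem _ _ (subset_closure (Submodule.subset_span (Set.mem_insert _ _)))
      · exact closure_mono (Submodule.span_mono (Set.subset_insert _ _)) (hmem y)
  obtain ⟨l, _, hl, hl'⟩ := exists_unitary_filter m.left {y | ∃ e d, m e d = y}
    fun S R hR ε hε => by
      classical
      have hR' : ∀ y ∈ R, ∃ e d, m e d = y := fun y hy => hR hy
      choose! e d hed using hR'
      obtain ⟨w, hw, hw'⟩ := hρ.exists_unitary ι q hq hker hγJ hγA m hM S
        (R.image fun y => (e y, d y)) hε
      refine ⟨w, hw, fun y hy => ?_⟩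
      obtain ⟨x, hx⟩ := hw' _ (Finset.mem_image_of_mem _ hy)
      exact ⟨x, by simpa only [hed y hy, m.left_apply] using hx⟩
  have hθ : ∀ e, ‖m.left e‖ = ‖e‖ := fun e => by
    rw [m.left_apply, hm, StarBilin.comp_apply, (AddMonoidHomClass.isometry_iff_norm inr).1 hinr]
    simp [h.norm_tmul]
  obtain ⟨Φ, hΦ, hr⟩ := exists_hom_range_eq m.left hθ (B := Set.range inr)
    (b := fun n => inr (TopologicalSpace.denseSeq ED n)) (l := l)
    hinr.isClosedEmbedding.isClosed_range (fun e => ⟨_, rfl⟩) (fun w => by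
      rintro _ ⟨y, rfl⟩
      exact ⟨(w * inr y * star (w : Unitization ℂ ED)).snd, by
        ext
        · simp [inr]
        · simp [inr]⟩)
    (fun n => ⟨_, rfl⟩) (by
      rintro _ ⟨y, rfl⟩
      exact map_mem_closure hinr.continuous (TopologicalSpace.denseRange_denseSeq ED y)
        (by rintro _ ⟨n, rfl⟩; exact ⟨n, rfl⟩)) hl
    (by rintro _ ⟨y, rfl⟩; exact hl' _ (hmem y))
  exact nonempty_starAlgEquiv_of_range_inr_eq Φ (AddMonoidHomClass.isometry_of_norm Φ hΦ).injective
    hr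

lemma CStarTensor.subsingleton {A : Type u} {D : Type v} {T : Type w}
    [NonUnitalCStarAlgebra A] [CStarAlgebra D] [NonUnitalCStarAlgebra T] (h : CStarTensor A D T)
    [Subsingleton D] : Subsingleton T := by
  have h0 : {t : T | ∃ a b, h.tmul a b = t} ⊆ {0} := by
    rintro _ ⟨a, b, rfl⟩
    rw [Set.mem_singleton_iff, ← norm_eq_zero, h.norm_tmul, Subsingleton.elim b 0, norm_zero,
      mul_zero]
  have h1 : Submodule.span ℂ {t : T | ∃ a b, h.tmul a b = t} = ⊥ := Submodule.span_eq_bot.2 h0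
  have h2 := h.dense_span
  rw [h1] at h2
  refine subsingleton_of_forall_eq 0 fun t => ?_
  simpa using h2 t

/-- `D`-stability is closed under extensions: if `0 → J → E → A → 0` is a short exact
sequence of separable C*-algebras, `D` is separable, unital, strongly self-absorbing and
`K₁`-injective, and both `J` and `A` are `D`-stable, then `E` is `D`-stable. -/
theorem stmt_17 {J E A D TD JD AD : Type u}
    [NonUnitalCStarAlgebra J] [NonUnitalCStarAlgebra E] [NonUnitalCStarAlgebra A]
    [CStarAlgebra D] [CStarAlgebra TD]
    [NonUnitalCStarAlgebra JD] [NonUnitalCStarAlgebra AD]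
    [TopologicalSpace.SeparableSpace J] [TopologicalSpace.SeparableSpace E]
    [TopologicalSpace.SeparableSpace A] [TopologicalSpace.SeparableSpace D]
    (hD : MinTensor D D TD) (hDu : hD.tmul 1 1 = 1)
    (hssa : IsStronglySelfAbsorbing hD) (hK1 : K1Injective D)
    -- the short exact sequence `0 → J → E → A → 0`
    (ι : J →⋆ₙₐ[ℂ] E) (hι : Function.Injective ι)
    (q : E →⋆ₙₐ[ℂ] A) (hq : Function.Surjective q)
    (hker : ∀ e : E, q e = 0 ↔ e ∈ Set.range ι)
    -- `J` and `A` are `D`-stable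
    (hJD : MinTensor J D JD) (hJstable : Nonempty (JD ≃⋆ₐ[ℂ] J))
    (hAD : MinTensor A D AD) (hAstable : Nonempty (AD ≃⋆ₐ[ℂ] A)) :
    -- then `E` is `D`-stable
    ∀ (ED : Type u) [NonUnitalCStarAlgebra ED],
      MinTensor E D ED → Nonempty (ED ≃⋆ₐ[ℂ] E) := by
  intro ED _ hED
  obtain ⟨φJ⟩ := hJstable
  obtain ⟨φA⟩ := hAstable
  rcases subsingleton_or_nontrivial D with hD0 | hD1
  · have _ : Subsingleton ED := hED.subsingleton
    have _ : Subsingleton JD := hJD.subsingleton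
    have _ : Subsingleton AD := hAD.subsingleton
    have _ : Subsingleton J := φJ.symm.injective.subsingleton
    have _ : Subsingleton A := φA.symm.injective.subsingleton
    have _ : Subsingleton E := subsingleton_of_forall_eq 0 fun e => by
      obtain ⟨j, rfl⟩ := (hker e).1 (Subsingleton.elim _ _)
      rw [Subsingleton.elim j 0, map_zero]
    exact ⟨StarAlgEquiv.ofBijective (0 : ED →⋆ₙₐ[ℂ] E)
      ⟨Function.injective_of_subsingleton _, fun e => ⟨0, Subsingleton.elim _ _⟩⟩⟩
  · obtain ⟨γJ, hγJ⟩ := hJD.exists_absorbing φJ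
    obtain ⟨γA, hγA⟩ := hAD.exists_absorbing φA
    exact (hD.halfFlip hDu hssa hK1).nonempty_starAlgEquiv ι q hq hker hγJ hγA hED.toCStarTensor
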